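/- Let α be a fixed real constant with 0 ≤ α < 1/2. Then for large T, the exponential sum S = ∑_{(T/(2π))^{3/2−α} ≤ k ≤ (T/π)^{3/2−α}} d₃(k) k^{1/(3−2α) − 1/2} e^{−(3/2−α) i k^{1/(3/2−α)}} satisfies S ≪ T^{1−α/6+ε}. -/

import Mathlib

open Complex Filter Real MeasureTheory Finset

noncomputable def chi (s : ℂ) : ℂ :=
  2 ^ s * (π : ℂ) ^ (s - 1) * Complex.sin (π * s / 2) * Complex.Gamma (1 - s)

noncomputable def Z (t : ℝ) : ℂ :=
  chi (1 / 2 + I * t) ^ (-(1 / 2 : ℂ)) * riemannZeta (1 / 2 + I * t)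

/-- number of positive divisors -/
noncomputable def d (k : ℕ) : ℕ := k.divisors.card

/-- number of ordered triples of positive integers with product `n` -/
noncomputable def d3 (n : ℕ) : ℕ :=
  ((Finset.Icc 1 n ×ˢ Finset.Icc 1 n ×ˢ Finset.Icc 1 n).filter
    fun p : ℕ × ℕ × ℕ => p.1 * p.2.1 * p.2.2 = n).card

/-- sum over integers `a ≤ k ≤ b` where terms at integer endpoints are halved -/
noncomputable def psum (a b : ℝ) (f : ℕ → ℂ) : ℂ :=
  ∑ k ∈ Finset.Icc ⌈a⌉₊ ⌊b⌋₊,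
    (if (k : ℝ) = a ∨ (k : ℝ) = b then (1 / 2 : ℂ) else 1) * f k

/-- The point `e^{ix}` of the unit circle. -/
noncomputable def cis (x : ℝ) : ℂ := Complex.exp (x * I)

theorem norm_cis (x : ℝ) : ‖cis x‖ = 1 := Complex.norm_exp_ofReal_mul_I x

theorem cis_add (x y : ℝ) : cis (x + y) = cis x * cis y := by
  simp [cis, add_mul, Complex.exp_add]

theorem cis_eq (x : ℝ) : cis x = Real.cos x + Real.sin x * I := by
  simp [cis, Complex.exp_mul_I]

theorem conj_cis (x : ℝ) : (starRingEnd ℂ) (cis x) = cis (-x) := by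
  simp [cis, ← Complex.exp_conj]

theorem cis_sub (x y : ℝ) : cis (x - y) = cis x * (starRingEnd ℂ) (cis y) := by
  rw [conj_cis, ← cis_add, sub_eq_add_neg]

theorem cis_two_pi_int (k : ℤ) : cis (2 * π * k) = 1 := by
  rw [cis, Complex.exp_eq_one_iff]
  exact ⟨k, by push_cast; ring⟩

theorem continuous_cis : Continuous cis := by unfold cis; fun_prop

theorem hasDerivAt_cis {f : ℝ → ℝ} {f' x : ℝ} (h : HasDerivAt f f' x) :
    HasDerivAt (fun t => cis (f t)) (f' * I * cis (f x)) x := by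
  have := (h.ofReal_comp.mul_const I).cexp
  simp only [cis]
  convert this using 1
  ring

theorem cis_cot (x : ℝ) (hs : Real.sin (x / 2) ≠ 0) :
    ((1 / 2 : ℂ) + ((Real.cos (x / 2) / Real.sin (x / 2) : ℝ) : ℂ) / 2 * I) * (1 - cis x) = 1 := by
  have h1 : cis x = cis (x / 2) * cis (x / 2) := by rw [← cis_add]; ring_nf
  have h2 : ((Real.cos (x / 2) : ℝ) : ℂ) ^ 2 = 1 - ((Real.sin (x / 2) : ℝ) : ℂ) ^ 2 := by
    have := Real.cos_sq' (x / 2)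
    exact_mod_cast this
  have h3 : ((Real.sin (x / 2) : ℝ) : ℂ) ≠ 0 := by exact_mod_cast hs
  rw [h1, cis_eq, ofReal_div]
  generalize ((Real.cos (x / 2) : ℝ) : ℂ) = C at *
  generalize ((Real.sin (x / 2) : ℝ) : ℂ) = S at *
  have e : (C + S * I) * (C + S * I) = 1 - 2 * S ^ 2 + 2 * C * S * I := by
    linear_combination h2 + S ^ 2 * I_sq
  have e2 : (S + C * I) * (2 * S ^ 2 - 2 * C * S * I) = 2 * S := by
    linear_combination 2 * S * h2 - 2 * C ^ 2 * S * I_sq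
  rw [e]
  calc (1 / 2 + C / S / 2 * I) * (1 - (1 - 2 * S ^ 2 + 2 * C * S * I))
      = ((S + C * I) * (2 * S ^ 2 - 2 * C * S * I)) / (2 * S) := by field_simp; ring
    _ = 1 := by rw [e2]; field_simp

theorem kuzmin_landau (g : ℕ → ℝ) (A B : ℕ) {θ : ℝ} (hθ : 0 < θ)
    (hmono : ∀ n, A ≤ n → n + 1 < B → g (n + 1) - g n ≤ g (n + 2) - g (n + 1))
    (hlo : ∀ n, A ≤ n → n < B → θ ≤ g (n + 1) - g n)
    (hhi : ∀ n, A ≤ n → n < B → g (n + 1) - g n ≤ 2 * π - θ) :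
    ‖∑ n ∈ Finset.Ico A B, cis (g n)‖ ≤ 2 * π / θ := by
  rcases le_or_gt B A with hBA | hAB
  · simp [Finset.Ico_eq_empty_of_le hBA]; positivity
  set δ : ℕ → ℝ := fun n => g (n + 1) - g n with hδ
  set s : ℕ → ℝ := fun n => Real.sin (δ n / 2)
  set ct : ℕ → ℝ := fun n => Real.cos (δ n / 2) / s n with hct
  set c : ℕ → ℂ := fun n => 1 / 2 + (ct n : ℂ) / 2 * I with hc
  have hθπ : θ ≤ π := by
    have := hlo A le_rfl hAB
    have := hhi A le_rfl hAB
    linarith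
  have hs : ∀ n, A ≤ n → n < B → θ / π ≤ s n := by
    intro n h1 h2
    have ha := hlo n h1 h2
    have hb := hhi n h1 h2
    have key : ∀ y, θ / 2 ≤ y → y ≤ π / 2 → θ / π ≤ Real.sin y := by
      intro y hy1 hy2
      have := Real.mul_le_sin (x := y) (by linarith) hy2
      calc θ / π = 2 / π * (θ / 2) := by ring
        _ ≤ 2 / π * y := by gcongr
        _ ≤ _ := this
    rcases le_total (δ n / 2) (π / 2) with h | h
    · exact key _ (by simp only [hδ]; linarith) h
    · show θ / π ≤ Real.sin (δ n / 2)
      rw [← Real.sin_pi_sub]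
      exact key _ (by simp only [hδ]; linarith) (by linarith)
  have hpos : 0 < θ / π := by positivity
  have hct_le : ∀ n, A ≤ n → n < B → |ct n| ≤ π / θ := by
    intro n h1 h2
    have h := hs n h1 h2
    have hsn : 0 < s n := by linarith
    simp only [hct, abs_div, abs_of_pos hsn]
    calc |Real.cos (δ n / 2)| / s n ≤ 1 / (θ / π) := by
          gcongr
          exact Real.abs_cos_le_one _
      _ = π / θ := by field_simp
  have hcn : ∀ n, A ≤ n → n < B → c n * (1 - cis (δ n)) = 1 := by
    intro n h1 h2
    exact cis_cot (δ n) (by have := hs n h1 h2; show s n ≠ 0; linarith)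
  have hcnorm : ∀ n, A ≤ n → n < B → ‖c n‖ ≤ π / (2 * θ) := by
    intro n h1 h2
    have h := hs n h1 h2
    have hsn : 0 < s n := by linarith
    have e1 : ‖1 - cis (δ n)‖ = 2 * s n := by
      have h1' : cis (δ n) = cis (δ n / 2) * cis (δ n / 2) := by rw [← cis_add]; ring_nf
      have h2' : cis (δ n / 2) * cis (-(δ n / 2)) = 1 := by
        rw [← cis_add]; simp [cis]
      have : 1 - cis (δ n) = cis (δ n / 2) * (((-(2 * s n) : ℝ) : ℂ) * I) := by
        have e3 : cis (-(δ n / 2)) - cis (δ n / 2) = ((-(2 * s n) : ℝ) : ℂ) * I := by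
          rw [cis_eq, cis_eq]; simp [s]; ring
        rw [← e3, mul_sub, h2', h1']
      rw [this, norm_mul, norm_cis, norm_mul, Complex.norm_I, Complex.norm_real, Real.norm_eq_abs,
        abs_neg, abs_of_pos (by linarith)]
      ring
    have e2 := congrArg norm (hcn n h1 h2)
    rw [norm_mul, e1, norm_one] at e2
    have : ‖c n‖ = 1 / (2 * s n) := by field_simp; linarith
    rw [this]
    calc 1 / (2 * s n) ≤ 1 / (2 * (θ / π)) := by gcongr
      _ = _ := by field_simp
  have hanti : ∀ n, A ≤ n → n + 1 < B → ct (n + 1) ≤ ct n := by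
    intro n h1 h2
    have hs1 := hs n h1 (by omega)
    have hs2 := hs (n + 1) (by omega) h2
    have hm := hmono n h1 h2
    have hl := hlo n h1 (by omega)
    have hh := hhi (n + 1) (by omega) h2
    simp only [hct]
    rw [div_le_div_iff₀ (by linarith) (by linarith)]
    have : 0 ≤ Real.sin (δ (n + 1) / 2 - δ n / 2) := by
      apply Real.sin_nonneg_of_nonneg_of_le_pi
      · simp only [hδ]; linarith
      · simp only [hδ] at *; linarith
    rw [Real.sin_sub] at this
    simp only [s]
    nlinarith
  have key : ∀ b, A + 1 ≤ b → b ≤ B →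
      ‖∑ n ∈ Finset.Ico A b, cis (g n) + c (b - 1) * cis (g b)‖
        ≤ π / (2 * θ) + (ct A - ct (b - 1)) / 2 := by
    intro b hb
    have step : ∀ n, A ≤ n → n < B → cis (g n) + c n * cis (g (n + 1)) = c n * cis (g n) := by
      intro n h1 h2
      have e1 : cis (g (n + 1)) = cis (g n) * cis (δ n) := by rw [← cis_add]; simp [hδ]
      rw [e1]
      linear_combination (-cis (g n)) * hcn n h1 h2
    induction b, hb using Nat.le_induction with
    | base =>
      intro h
      simp only [Finset.sum_Ico_succ_top (le_refl A), Finset.Ico_self, Finset.sum_empty, zero_add,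
        Nat.add_sub_cancel, sub_self, zero_div, add_zero]
      rw [step A le_rfl (by omega), norm_mul, norm_cis, mul_one]
      exact hcnorm A le_rfl (by omega)
    | succ b hb ih =>
      intro h
      have ih := ih (by omega)
      obtain ⟨k, rfl⟩ : ∃ k, b = k + 1 := ⟨b - 1, by omega⟩
      rw [Finset.sum_Ico_succ_top (by omega)]
      simp only [Nat.add_sub_cancel] at ih ⊢
      have e : ∑ n ∈ Finset.Ico A (k + 1), cis (g n) + cis (g (k + 1)) + c (k + 1) * cis (g (k + 1 + 1))
          = (∑ n ∈ Finset.Ico A (k + 1), cis (g n) + c k * cis (g (k + 1))) +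
            (c (k + 1) - c k) * cis (g (k + 1)) := by
        linear_combination step (k + 1) (by omega) (by omega)
      rw [e]
      refine (norm_add_le _ _).trans ?_
      have e2 : c (k + 1) - c k = ((-(ct k - ct (k + 1)) / 2 : ℝ) : ℂ) * I := by
        simp only [hc]; push_cast; ring
      have h0 := hanti k (by omega) (by omega)
      have e3 : ‖c (k + 1) - c k‖ = (ct k - ct (k + 1)) / 2 := by
        rw [e2, norm_mul, Complex.norm_I, Complex.norm_real, Real.norm_eq_abs, mul_one, abs_div,
          abs_neg, abs_of_nonneg (by linarith), abs_two]
      rw [norm_mul, norm_cis, e3]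
      linarith
  have hk := key B (by omega) le_rfl
  have h1 : ‖c (B - 1) * cis (g B)‖ ≤ π / (2 * θ) := by
    rw [norm_mul, norm_cis, mul_one]
    exact hcnorm _ (by omega) (by omega)
  have h2 := hct_le A le_rfl hAB
  have h3 := hct_le (B - 1) (by omega) (by omega)
  have h4 : ‖∑ n ∈ Finset.Ico A B, cis (g n)‖ ≤
      ‖∑ n ∈ Finset.Ico A B, cis (g n) + c (B - 1) * cis (g B)‖ + ‖c (B - 1) * cis (g B)‖ := by
    have := norm_sub_le (∑ n ∈ Finset.Ico A B, cis (g n) + c (B - 1) * cis (g B)) (c (B - 1) * cis (g B))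
    simpa using this
  rw [abs_le] at h2 h3
  have e1 : π / (2 * θ) = (π / θ) / 2 := by field_simp
  have e2 : 2 * π / θ = 2 * (π / θ) := by ring
  rw [e1] at hk h1
  rw [e2]
  linarith [h2.2, h3.1]

theorem le_of_step_le {δ : ℕ → ℝ} {A B : ℕ} {lam : ℝ}
    (h : ∀ n, A ≤ n → n + 1 < B → lam ≤ δ (n + 1) - δ n) {m n : ℕ} (hm : A ≤ m) (hmn : m ≤ n)
    (hn : n < B) : lam * (n - m : ℝ) ≤ δ n - δ m := by
  induction n, hmn using Nat.le_induction with
  | base => simp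
  | succ k hk ih =>
    have := ih (by omega)
    have := h k (by omega) hn
    push_cast
    linarith

theorem step_le_le {δ : ℕ → ℝ} {A B : ℕ} {lam : ℝ}
    (h : ∀ n, A ≤ n → n + 1 < B → δ (n + 1) - δ n ≤ lam) {m n : ℕ} (hm : A ≤ m) (hmn : m ≤ n)
    (hn : n < B) : δ n - δ m ≤ lam * (n - m : ℝ) := by
  have := le_of_step_le (δ := fun n => - δ n) (lam := -lam) (A := A) (B := B)
    (fun n h1 h2 => by have := h n h1 h2; linarith) hm hmn hn
  linarith

/-- A finite set of naturals that is closed under betweenness is an interval. -/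
theorem exists_eq_Ico (S : Finset ℕ) (A B : ℕ) (hS : ∀ n ∈ S, A ≤ n ∧ n < B)
    (hconv : ∀ a ∈ S, ∀ b ∈ S, ∀ n, a ≤ n → n ≤ b → n ∈ S) :
    ∃ A' B', A ≤ A' ∧ B' ≤ B ∧ S = Finset.Ico A' B' := by
  rcases S.eq_empty_or_nonempty with rfl | hne
  · exact ⟨A, min A B, le_rfl, min_le_right _ _, by simp⟩
  · refine ⟨S.min' hne, S.max' hne + 1, (hS _ (S.min'_mem hne)).1, (hS _ (S.max'_mem hne)).2, ?_⟩
    ext n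
    simp only [Finset.mem_Ico, Nat.lt_succ_iff]
    exact ⟨fun h => ⟨S.min'_le _ h, S.le_max' _ h⟩, fun h =>
      hconv _ (S.min'_mem hne) _ (S.max'_mem hne) n h.1 h.2⟩

theorem filter_monotone_eq_Ico {δ : ℕ → ℝ} {A B : ℕ}
    (h : ∀ n, A ≤ n → n + 1 < B → 0 ≤ δ (n + 1) - δ n) (x y : ℝ) :
    ∃ A' B', A ≤ A' ∧ B' ≤ B ∧
      (Finset.Ico A B).filter (fun n => x ≤ δ n ∧ δ n < y) = Finset.Ico A' B' := by
  refine exists_eq_Ico _ A B (fun n hn => by simpa using (Finset.mem_filter.1 hn).1) ?_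
  intro a ha b hb n han hnb
  simp only [Finset.mem_filter, Finset.mem_Ico] at ha hb ⊢
  have h1 := le_of_step_le h ha.1.1 han (by omega)
  have h2 := le_of_step_le h (by omega) hnb hb.1.2
  exact ⟨by omega, by linarith [ha.2.1], by linarith [hb.2.2]⟩

theorem card_filter_step_le {δ : ℕ → ℝ} {A B : ℕ} {lam : ℝ} (hlam : 0 < lam)
    (h : ∀ n, A ≤ n → n + 1 < B → lam ≤ δ (n + 1) - δ n) (x : ℝ) {θ : ℝ} (hθ : 0 ≤ θ) :
    (((Finset.Ico A B).filter (fun n => x ≤ δ n ∧ δ n < x + θ)).card : ℝ) ≤ θ / lam + 1 := by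
  obtain ⟨A', B', hA, hB, he⟩ := filter_monotone_eq_Ico
    (fun n h1 h2 => hlam.le.trans (h n h1 h2)) x (x + θ)
  rw [he, Nat.card_Ico]
  rcases le_or_gt B' A' with hle | hlt
  · rw [Nat.sub_eq_zero_of_le hle]; simp; positivity
  · have hm1 : A' ∈ Finset.Ico A' B' := by simp [hlt]
    have hm2 : B' - 1 ∈ Finset.Ico A' B' := by simp; omega
    rw [← he, Finset.mem_filter] at hm1 hm2
    have := le_of_step_le h hA (show A' ≤ B' - 1 by omega) (by omega)
    have e : ((B' - 1 : ℕ) : ℝ) = B' - 1 := by push_cast [show 1 ≤ B' by omega]; ring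
    rw [e] at this
    rw [Nat.cast_sub hlt.le]
    have h3 : ((B':ℝ) - A' - 1) ≤ θ / lam := by
      rw [le_div_iff₀ hlam]
      nlinarith [hm1.2.1, hm2.2.2]
    linarith

theorem norm_sum_cis_le_card (S : Finset ℕ) (g : ℕ → ℝ) : ‖∑ n ∈ S, cis (g n)‖ ≤ S.card := by
  refine (norm_sum_le _ _).trans ?_
  simp [norm_cis]

theorem norm_sum_cis_middle (g : ℕ → ℝ) (A B : ℕ)
    (hmono : ∀ n, A ≤ n → n + 1 < B → 0 ≤ (g (n + 2) - g (n + 1)) - (g (n + 1) - g n))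
    {θ : ℝ} (hθ : 0 < θ) (ν : ℤ) :
    ‖∑ n ∈ (Finset.Ico A B).filter (fun n => 2 * π * ν + θ ≤ g (n + 1) - g n ∧
      g (n + 1) - g n < 2 * π * ν + (2 * π - θ)), cis (g n)‖ ≤ 2 * π / θ := by
  obtain ⟨A', B', hA, hB, he⟩ := filter_monotone_eq_Ico (δ := fun n => g (n + 1) - g n)
    hmono (2 * π * ν + θ) (2 * π * ν + (2 * π - θ))
  have hin : ∀ n, A' ≤ n → n < B' → 2 * π * ν + θ ≤ g (n + 1) - g n ∧
      g (n + 1) - g n < 2 * π * ν + (2 * π - θ) := by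
    intro n h1 h2
    have : n ∈ Finset.Ico A' B' := by simp [h1, h2]
    rw [← he, Finset.mem_filter] at this
    exact this.2
  rw [he]
  have h := kuzmin_landau (fun n => g n - 2 * π * ν * n) A' B' hθ
    (fun n h1 h2 => by
      have := hmono n (by omega) (by omega)
      push_cast; linarith)
    (fun n h1 h2 => by have := (hin n h1 h2).1; push_cast; linarith)
    (fun n h1 h2 => by have := (hin n h1 h2).2; push_cast; linarith)
  convert h using 3
  rename_i n _
  rw [cis_sub, conj_cis]
  have : cis (-(2 * π * ν * n)) = 1 := by
    have := cis_two_pi_int (-(ν * n))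
    push_cast at this
    rw [← this]; congr 1; ring
  rw [this, mul_one]

theorem van_der_corput_discrete (g : ℕ → ℝ) {A B : ℕ} (hAB' : A ≤ B) {lam h : ℝ}
    (hlam : 0 < lam) (hlam1 : lam ≤ 1) (hh : 0 ≤ h)
    (hlo : ∀ n, A ≤ n → n + 1 < B → lam ≤ (g (n + 2) - g (n + 1)) - (g (n + 1) - g n))
    (hhi : ∀ n, A ≤ n → n + 1 < B → (g (n + 2) - g (n + 1)) - (g (n + 1) - g n) ≤ h * lam) :
    ‖∑ n ∈ Finset.Ico A B, cis (g n)‖ ≤ ((B - A : ℝ) * (h * lam) + 2) * (12 / √lam) := by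
  rcases hAB'.eq_or_lt with rfl | hAB
  · simp
    positivity
  set δ : ℕ → ℝ := fun n => g (n + 1) - g n with hδ
  set θ := √lam with hθ
  have hθ0 : 0 < θ := Real.sqrt_pos.2 hlam
  have hθ1 : θ ≤ 1 := Real.sqrt_le_one.2 hlam1
  have hθ2 : θ * θ = lam := Real.mul_self_sqrt hlam.le
  have hπ := Real.pi_gt_three
  have hmono : ∀ n, A ≤ n → n + 1 < B → 0 ≤ δ (n + 1) - δ n :=
    fun n h1 h2 => hlam.le.trans (hlo n h1 h2)
  set r : ℕ → ℤ := fun n => ⌊δ n / (2 * π)⌋ with hr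
  have hfl : ∀ n, 2 * π * r n ≤ δ n ∧ δ n < 2 * π * r n + 2 * π := by
    intro n
    have h1 := Int.floor_le (δ n / (2 * π))
    have h2 := Int.lt_floor_add_one (δ n / (2 * π))
    rw [le_div_iff₀ (by positivity)] at h1
    rw [div_lt_iff₀ (by positivity)] at h2
    constructor
    · linarith
    · linarith
  have hmaps : ∀ n ∈ Finset.Ico A B, r n ∈ Finset.Icc (r A) (r (B - 1)) := by
    intro n hn
    rw [Finset.mem_Ico] at hn
    rw [Finset.mem_Icc]
    constructor
    · apply Int.floor_le_floor
      gcongr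
      have := le_of_step_le hmono le_rfl hn.1 hn.2
      linarith
    · apply Int.floor_le_floor
      gcongr
      have := le_of_step_le hmono hn.1 (show n ≤ B - 1 by omega) (by omega)
      linarith
  rw [← Finset.sum_fiberwise_of_maps_to hmaps]
  have hfib : ∀ ν : ℤ, ‖∑ n ∈ (Finset.Ico A B).filter (fun n => r n = ν), cis (g n)‖ ≤ 12 / θ := by
    intro ν
    have hsplit : (Finset.Ico A B).filter (fun n => r n = ν) =
        ((Finset.Ico A B).filter (fun n => 2 * π * ν ≤ δ n ∧ δ n < 2 * π * ν + θ) ∪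
        (Finset.Ico A B).filter (fun n => 2 * π * ν + θ ≤ δ n ∧ δ n < 2 * π * ν + (2 * π - θ))) ∪
        (Finset.Ico A B).filter (fun n => 2 * π * ν + (2 * π - θ) ≤ δ n ∧
          δ n < 2 * π * ν + (2 * π - θ) + θ) := by
      ext n
      simp only [Finset.mem_filter, Finset.mem_union]
      have h1 := hfl n
      constructor
      · rintro ⟨hn, rfl⟩
        rcases lt_or_ge (δ n) (2 * π * (r n) + θ) with h2 | h2
        · exact Or.inl (Or.inl ⟨hn, h1.1, h2⟩)
        · rcases lt_or_ge (δ n) (2 * π * (r n) + (2 * π - θ)) with h3 | h3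
          · exact Or.inl (Or.inr ⟨hn, h2, h3⟩)
          · exact Or.inr ⟨hn, h3, by linarith⟩
      · intro h
        have h4 : n ∈ Finset.Ico A B ∧ 2 * π * ν ≤ δ n ∧ δ n < 2 * π * ν + 2 * π := by
          rcases h with (h | h) | h
          · exact ⟨h.1, h.2.1, by linarith [h.2.2]⟩
          · exact ⟨h.1, by linarith [h.2.1], by linarith [h.2.2]⟩
          · exact ⟨h.1, by linarith [h.2.1], by linarith [h.2.2]⟩
        refine ⟨h4.1, ?_⟩
        simp only [hr]
        rw [Int.floor_eq_iff, le_div_iff₀ (by positivity), div_lt_iff₀ (by positivity)]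
        constructor <;> linarith [h4.2.1, h4.2.2]
    rw [hsplit, Finset.sum_union, Finset.sum_union]
    · have t1 := (norm_sum_cis_le_card ((Finset.Ico A B).filter (fun n => 2 * π * ν ≤ δ n ∧
        δ n < 2 * π * ν + θ)) g).trans (card_filter_step_le hlam hlo (2 * π * ν) hθ0.le)
      have t2 := norm_sum_cis_middle g A B hmono hθ0 ν
      have t3 := (norm_sum_cis_le_card ((Finset.Ico A B).filter (fun n =>
        2 * π * ν + (2 * π - θ) ≤ δ n ∧ δ n < 2 * π * ν + (2 * π - θ) + θ)) g).trans
        (card_filter_step_le hlam hlo (2 * π * ν + (2 * π - θ)) hθ0.le)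
      refine (norm_add_le _ _).trans ((add_le_add (norm_add_le _ _) le_rfl).trans ?_)
      have e : θ / lam = 1 / θ := by rw [← hθ2]; field_simp
      rw [e] at t1 t3
      have e1 : (1:ℝ) ≤ 1 / θ := by rw [le_div_iff₀ hθ0]; linarith
      have e2 : 2 * π / θ ≤ 8 * (1 / θ) := by
        rw [mul_one_div]; gcongr; linarith [Real.pi_lt_four]
      have e3 : 12 / θ = 12 * (1 / θ) := by ring
      rw [e3]
      simp only [hδ] at t1 t2 t3 ⊢
      linarith
    · rw [Finset.disjoint_filter]
      intro n _ h1 h2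
      linarith [h1.2, h2.1]
    · rw [Finset.disjoint_left]
      intro n h1 h2
      simp only [Finset.mem_filter, Finset.mem_union] at h1 h2
      rcases h1 with h1 | h1
      · linarith [h1.2.2, h2.2.1]
      · linarith [h1.2.2, h2.2.1]
  refine (norm_sum_le _ _).trans ((Finset.sum_le_card_nsmul _ _ _ fun ν _ => hfib ν).trans ?_)
  rw [nsmul_eq_mul]
  gcongr
  have hle : r A ≤ r (B - 1) := by
    have := hmaps A (by simp [hAB])
    exact (Finset.mem_Icc.1 this).2
  rw [Int.card_Icc]
  have : (((r (B - 1) + 1 - r A).toNat : ℕ) : ℝ) = r (B - 1) + 1 - r A := by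
    have : (((r (B - 1) + 1 - r A).toNat : ℕ) : ℤ) = r (B - 1) + 1 - r A :=
      Int.toNat_of_nonneg (by omega)
    exact_mod_cast this
  rw [this]
  have h1 := (hfl (B - 1)).1
  have h2 := (hfl A).2
  have h3 := step_le_le (δ := δ) hhi le_rfl (show A ≤ B - 1 by omega) (by omega)
  have e : ((B - 1 : ℕ) : ℝ) = B - 1 := by push_cast [show 1 ≤ B by omega]; ring
  rw [e] at h3
  have hh' : 0 ≤ h * lam := by positivity
  have h4 : 2 * π * ((r (B - 1) : ℝ) - r A - 1) ≤ (B - A : ℝ) * (h * lam) := by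
    nlinarith
  have h5 : (0:ℝ) ≤ (B - A : ℝ) * (h * lam) := by
    have : (A:ℝ) ≤ B := by exact_mod_cast hAB.le
    apply mul_nonneg <;> linarith
  by_contra! hcon
  nlinarith

theorem exists_second_difference_rpow (p : ℝ) {a : ℝ} (ha : 0 < a) :
    ∃ η, a < η ∧ η < a + 2 ∧
      ((a + 2) ^ p - (a + 1) ^ p) - ((a + 1) ^ p - a ^ p) = p * (p - 1) * η ^ (p - 2) := by
  have hd : ∀ q x : ℝ, 0 < x → HasDerivAt (fun y : ℝ => y ^ q) (q * x ^ (q - 1)) x :=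
    fun q x hx => Real.hasDerivAt_rpow_const (Or.inl hx.ne')
  have hd1 : ∀ q x : ℝ, 0 < x → HasDerivAt (fun y : ℝ => (y + 1) ^ q) (q * (x + 1) ^ (q - 1)) x :=
    fun q x hx => HasDerivAt.comp_add_const x 1 (hd q (x + 1) (by linarith))
  obtain ⟨ξ, hξ, h1⟩ := exists_hasDerivAt_eq_slope (fun y : ℝ => (y + 1) ^ p - y ^ p)
    (fun x => p * (x + 1) ^ (p - 1) - p * x ^ (p - 1)) (show a < a + 1 by linarith)
    (fun x hx => ((hd1 p x (by linarith [hx.1])).sub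
      (hd p x (by linarith [hx.1]))).continuousAt.continuousWithinAt)
    (fun x hx => (hd1 p x (by linarith [hx.1])).sub (hd p x (by linarith [hx.1])))
  obtain ⟨η, hη, h2⟩ := exists_hasDerivAt_eq_slope (fun y : ℝ => y ^ (p - 1))
    (fun x => (p - 1) * x ^ (p - 1 - 1)) (show ξ < ξ + 1 by linarith)
    (fun x hx => (hd (p - 1) x (by linarith [hx.1, hξ.1])).continuousAt.continuousWithinAt)
    (fun x hx => hd (p - 1) x (by linarith [hx.1, hξ.1]))
  refine ⟨η, by linarith [hη.1, hξ.1], by linarith [hη.2, hξ.2], ?_⟩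
  simp only [add_sub_cancel_left, div_one] at h1 h2
  have e : p - 1 - 1 = p - 2 := by ring
  have e2 : a + 1 + 1 = a + 2 := by ring
  rw [e] at h2
  rw [e2] at h1
  rw [← h1]
  linear_combination p * (-h2)

theorem rpow_le_of_ratio {x M k q : ℝ} (hM : 0 < M) (hk : 1 ≤ k) (h1 : M / k ≤ x) (h2 : x ≤ k * M) :
    x ^ q ≤ k ^ |q| * M ^ q ∧ k ^ (-|q|) * M ^ q ≤ x ^ q := by
  have hk0 : 0 < k := by linarith
  have hx : 0 < x := lt_of_lt_of_le (by positivity) h1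
  have e : x = (x / M) * M := by field_simp
  have hr1 : x / M ≤ k := by rw [div_le_iff₀ hM]; exact h2
  have hr2 : k⁻¹ ≤ x / M := by
    rw [le_div_iff₀ hM]
    calc k⁻¹ * M = M / k := by field_simp
      _ ≤ x := h1
  have hkey : (x / M) ^ q ≤ k ^ |q| ∧ k ^ (-|q|) ≤ (x / M) ^ q := by
    rcases le_total 0 q with hq | hq
    · rw [abs_of_nonneg hq]
      refine ⟨Real.rpow_le_rpow (by positivity) hr1 hq, ?_⟩
      rw [Real.rpow_neg hk0.le, ← Real.inv_rpow hk0.le]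
      exact Real.rpow_le_rpow (by positivity) hr2 hq
    · rw [abs_of_nonpos hq, neg_neg]
      refine ⟨?_, Real.rpow_le_rpow_of_nonpos (by positivity) hr1 hq⟩
      rw [Real.rpow_neg hk0.le, ← Real.inv_rpow hk0.le]
      exact Real.rpow_le_rpow_of_nonpos (by positivity) hr2 hq
  have hMq : 0 ≤ M ^ q := by positivity
  have e3 : x ^ q = (x / M) ^ q * M ^ q := by
    rw [← Real.mul_rpow (by positivity) hM.le, ← e]
  rw [e3]
  exact ⟨mul_le_mul_of_nonneg_right hkey.1 hMq, mul_le_mul_of_nonneg_right hkey.2 hMq⟩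

theorem norm_sum_cis_neg (S : Finset ℕ) (g : ℕ → ℝ) :
    ‖∑ n ∈ S, cis (-(g n))‖ = ‖∑ n ∈ S, cis (g n)‖ := by
  rw [← RCLike.norm_conj, map_sum]
  simp only [conj_cis, neg_neg]

theorem norm_sum_cis_rpow_le {p c : ℝ} (hp : p * (p - 1) ≠ 0) (hc : 1 ≤ c) :
    ∃ C : ℝ, 0 < C ∧ ∀ M θ : ℝ, 1 ≤ M → θ ≠ 0 → ∀ A B : ℕ,
      (∀ n : ℕ, A ≤ n → n < B → M ≤ n ∧ (n : ℝ) ≤ c * M) →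
      ‖∑ n ∈ Finset.Ico A B, cis (θ * (n : ℝ) ^ p)‖ ≤
        C * (√(|θ| * M ^ p) + M / √(|θ| * M ^ p)) := by
  set k := c + 2 with hk
  have hk1 : 1 ≤ k := by linarith
  set K := |p * (p - 1)| * k ^ (-|p - 2|) with hK
  have hK0 : 0 < K := by have := abs_pos.2 hp; positivity
  set h := k ^ |p - 2| * k ^ |p - 2| with hh
  have hh0 : 0 < h := by positivity
  refine ⟨24 * h * c * √K + 24 / √K + 2 * c * √K, by positivity, ?_⟩
  intro M θ hM hθ A B hAB
  have hM0 : 0 < M := by linarith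
  set D := |θ| * M ^ p with hD
  have hθ0 := abs_pos.2 hθ
  have hD0 : 0 < D := by positivity
  have hKs : 0 < √K := Real.sqrt_pos.2 hK0
  have hDs : 0 < √D := Real.sqrt_pos.2 hD0
  rcases le_or_gt B A with hBA | hlt
  · rw [Finset.Ico_eq_empty_of_le hBA]; simp; positivity
  have hcard : (B - A : ℝ) ≤ 2 * c * M := by
    have h1 := (hAB A le_rfl hlt).1
    have h2 := (hAB (B - 1) (by omega) (by omega)).2
    rw [Nat.cast_sub (by omega)] at h2
    push_cast at h2
    nlinarith
  set lam := K * D / M ^ 2 with hlam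
  have hlam0 : 0 < lam := by positivity
  have hsl : √lam = √K * √D / M := by
    rw [hlam, Real.sqrt_div (by positivity), Real.sqrt_mul hK0.le, Real.sqrt_sq hM0.le]
  rcases le_or_gt lam 1 with hl | hl
  · have hsd : ∀ n : ℕ, A ≤ n → n + 1 < B → ∃ E : ℝ, lam ≤ |θ| * |p * (p - 1)| * E ∧
        |θ| * |p * (p - 1)| * E ≤ h * lam ∧
        (((n + 2 : ℕ) : ℝ) ^ p - ((n + 1 : ℕ) : ℝ) ^ p) - (((n + 1 : ℕ) : ℝ) ^ p - (n : ℝ) ^ p)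
          = p * (p - 1) * E := by
      intro n h1 h2
      have hn := hAB n h1 (by omega)
      obtain ⟨η, ha, hb, he⟩ := exists_second_difference_rpow p (a := n) (by linarith)
      refine ⟨η ^ (p - 2), ?_, ?_, ?_⟩
      · have := (rpow_le_of_ratio (x := η) (M := M) (k := k) (q := p - 2) hM0 hk1
          ((div_le_self hM0.le hk1).trans (by linarith)) (by rw [hk]; nlinarith)).2
        calc lam = |θ| * |p * (p - 1)| * (k ^ (-|p - 2|) * M ^ (p - 2)) := by
              rw [hlam, hD, hK, Real.rpow_sub hM0, Real.rpow_two]; ring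
          _ ≤ _ := by gcongr
      · have := (rpow_le_of_ratio (x := η) (M := M) (k := k) (q := p - 2) hM0 hk1
          ((div_le_self hM0.le hk1).trans (by linarith)) (by rw [hk]; nlinarith)).1
        calc _ ≤ |θ| * |p * (p - 1)| * (k ^ |p - 2| * M ^ (p - 2)) := by gcongr
          _ = h * lam := by
              have : k ^ (-|p - 2|) = (k ^ |p - 2|)⁻¹ := Real.rpow_neg (by linarith) _
              have hkp : k ^ |p - 2| ≠ 0 := by positivity
              rw [hlam, hD, hK, hh, Real.rpow_sub hM0, Real.rpow_two, this]
              field_simp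
      · rw [← he]; push_cast; ring
    have hmain : ‖∑ n ∈ Finset.Ico A B, cis (θ * (n : ℝ) ^ p)‖ ≤
        ((B - A : ℝ) * (h * lam) + 2) * (12 / √lam) := by
      rcases lt_or_ge 0 (θ * (p * (p - 1))) with hs | hs
      · have e0 : |θ| * |p * (p - 1)| = θ * (p * (p - 1)) := by rw [← abs_mul, abs_of_pos hs]
        refine van_der_corput_discrete (fun n => θ * (n : ℝ) ^ p) hlt.le hlam0 hl hh0.le ?_ ?_
        · intro n h1 h2
          obtain ⟨E, hE1, hE2, hE3⟩ := hsd n h1 h2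
          rw [e0] at hE1
          calc lam ≤ _ := hE1
            _ = θ * (p * (p - 1) * E) := by ring
            _ = _ := by rw [← hE3]; ring
        · intro n h1 h2
          obtain ⟨E, hE1, hE2, hE3⟩ := hsd n h1 h2
          rw [e0] at hE2
          calc _ = θ * (p * (p - 1) * E) := by rw [← hE3]; ring
            _ = θ * (p * (p - 1)) * E := by ring
            _ ≤ _ := hE2
      · have e0 : |θ| * |p * (p - 1)| = -(θ * (p * (p - 1))) := by
          rw [← abs_mul, abs_of_nonpos hs]
        rw [← norm_sum_cis_neg]
        refine van_der_corput_discrete (fun n => -(θ * (n : ℝ) ^ p)) hlt.le hlam0 hl hh0.le ?_ ?_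
        · intro n h1 h2
          obtain ⟨E, hE1, hE2, hE3⟩ := hsd n h1 h2
          rw [e0] at hE1
          calc lam ≤ _ := hE1
            _ = -θ * (p * (p - 1) * E) := by ring
            _ = _ := by rw [← hE3]; ring
        · intro n h1 h2
          obtain ⟨E, hE1, hE2, hE3⟩ := hsd n h1 h2
          rw [e0] at hE2
          calc _ = -θ * (p * (p - 1) * E) := by rw [← hE3]; ring
            _ = -(θ * (p * (p - 1))) * E := by ring
            _ ≤ _ := hE2
    have hls : 0 < √lam := Real.sqrt_pos.2 hlam0
    calc _ ≤ _ := hmain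
      _ ≤ (2 * c * M * (h * lam) + 2) * (12 / √lam) := by gcongr
      _ = 24 * h * c * M * (lam / √lam) + 24 * (1 / √lam) := by ring
      _ = 24 * h * c * √K * √D + 24 / √K * (M / √D) := by
          rw [Real.div_sqrt, hsl]; field_simp
      _ ≤ _ := by
          have e1 : 0 ≤ 24 / √K * √D := by positivity
          have e2 : 0 ≤ 24 * h * c * √K * (M / √D) := by positivity
          have e3 : 0 ≤ 2 * c * √K * (√D + M / √D) := by positivity
          linarith
  · have hls : 1 ≤ √lam := Real.one_le_sqrt.2 hl.le
    have h1 := norm_sum_cis_le_card (Finset.Ico A B) (fun n => θ * (n : ℝ) ^ p)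
    rw [Nat.card_Ico, Nat.cast_sub hlt.le] at h1
    calc _ ≤ _ := h1
      _ ≤ 2 * c * M * 1 := by linarith
      _ ≤ 2 * c * M * √lam := by gcongr
      _ = 2 * c * √K * √D := by rw [hsl]; field_simp
      _ ≤ _ := by
          have e1 : 0 ≤ (24 * h * c * √K + 24 / √K) * (√D + M / √D) := by positivity
          have e2 : 0 ≤ 2 * c * √K * (M / √D) := by positivity
          linarith

theorem sum_inv_sqrt_le (Q : ℕ) : ∑ q ∈ Finset.Ico 1 Q, 1 / √(q : ℝ) ≤ 2 * √Q := by
  have key : ∀ Q : ℕ, ∑ q ∈ Finset.Ico 1 (Q + 1), 1 / √(q : ℝ) ≤ 2 * √Q := by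
    intro Q
    induction Q with
    | zero => simp
    | succ Q ih =>
      rw [Finset.sum_Ico_succ_top (by omega)]
      have h1 : 0 < √((Q + 1 : ℕ) : ℝ) := Real.sqrt_pos.2 (by positivity)
      have h2 : √(Q:ℝ) ≤ √((Q + 1 : ℕ) : ℝ) := Real.sqrt_le_sqrt (by push_cast; linarith)
      have h3 : √(Q:ℝ) * √(Q:ℝ) = Q := Real.mul_self_sqrt (by positivity)
      have h4 : √((Q + 1 : ℕ) : ℝ) * √((Q + 1 : ℕ) : ℝ) = Q + 1 := by
        rw [Real.mul_self_sqrt (by positivity)]; push_cast; ring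
      have h5 : 1 / √((Q + 1 : ℕ) : ℝ) ≤ 2 * √((Q + 1 : ℕ) : ℝ) - 2 * √Q := by
        rw [div_le_iff₀ h1]
        nlinarith [sq_nonneg (√((Q + 1 : ℕ) : ℝ) - √(Q:ℝ))]
      linarith
  refine le_trans (Finset.sum_le_sum_of_subset_of_nonneg (Finset.Ico_subset_Ico_right (by omega))
    fun _ _ _ => by positivity) (key Q)

theorem sum_inv_sqrt_dist_le (V : Finset ℕ) (Q n : ℕ)
    (hV : ∀ k ∈ V, k < n + Q ∧ n < k + Q) :
    ∑ k ∈ V.filter (· ≠ n), 1 / √|(k : ℝ) - n| ≤ 4 * √Q := by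
  have hsplit : V.filter (· ≠ n) = V.filter (· < n) ∪ V.filter (n < ·) := by
    ext k; simp only [Finset.mem_filter, Finset.mem_union]; grind
  have hdisj : Disjoint (V.filter (· < n)) (V.filter (n < ·)) := by
    rw [Finset.disjoint_filter]; intro k _ h1 h2; omega
  rw [hsplit, Finset.sum_union hdisj]
  have h1 : ∑ k ∈ V.filter (· < n), 1 / √|(k : ℝ) - n| ≤ ∑ q ∈ Finset.Ico 1 Q, 1 / √(q : ℝ) := by
    have e : ∑ k ∈ V.filter (· < n), 1 / √|(k : ℝ) - n| =
        ∑ q ∈ (V.filter (· < n)).image (fun k => n - k), 1 / √(q : ℝ) := by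
      rw [Finset.sum_image]
      · refine Finset.sum_congr rfl fun k hk => ?_
        have hk := (Finset.mem_filter.1 hk).2
        rw [Nat.cast_sub hk.le, abs_sub_comm, abs_of_nonneg]
        have : (k:ℝ) ≤ n := by exact_mod_cast hk.le
        linarith
      · intro a ha b hb hab
        simp at ha hb hab
        omega
    rw [e]
    refine Finset.sum_le_sum_of_subset_of_nonneg ?_ fun _ _ _ => by positivity
    intro q hq
    simp only [Finset.mem_image, Finset.mem_filter] at hq
    obtain ⟨k, ⟨hk, hk2⟩, rfl⟩ := hq
    have := hV k hk
    simp; omega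
  have h2 : ∑ k ∈ V.filter (n < ·), 1 / √|(k : ℝ) - n| ≤ ∑ q ∈ Finset.Ico 1 Q, 1 / √(q : ℝ) := by
    have e : ∑ k ∈ V.filter (n < ·), 1 / √|(k : ℝ) - n| =
        ∑ q ∈ (V.filter (n < ·)).image (fun k => k - n), 1 / √(q : ℝ) := by
      rw [Finset.sum_image]
      · refine Finset.sum_congr rfl fun k hk => ?_
        have hk := (Finset.mem_filter.1 hk).2
        rw [Nat.cast_sub hk.le, abs_of_nonneg]
        have : (n:ℝ) ≤ k := by exact_mod_cast hk.le
        linarith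
      · intro a ha b hb hab
        simp at ha hb hab
        omega
    rw [e]
    refine Finset.sum_le_sum_of_subset_of_nonneg ?_ fun _ _ _ => by positivity
    intro q hq
    simp only [Finset.mem_image, Finset.mem_filter] at hq
    obtain ⟨k, ⟨hk, hk2⟩, rfl⟩ := hq
    have := hV k hk
    simp; omega
  have := sum_inv_sqrt_le Q
  linarith

theorem abs_rpow_sub_rpow {s c : ℝ} (hc : 1 ≤ c) {N x y : ℝ} (hN : 0 < N)
    (hx : N ≤ x ∧ x ≤ c * N) (hy : N ≤ y ∧ y ≤ c * N) :
    |s| * c ^ (-|s - 1|) * N ^ (s - 1) * |x - y| ≤ |x ^ s - y ^ s| ∧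
    |x ^ s - y ^ s| ≤ |s| * c ^ |s - 1| * N ^ (s - 1) * |x - y| := by
  wlog hlt : y < x generalizing x y
  · rcases (not_lt.1 hlt).eq_or_lt with rfl | h
    · simp
    · have := this hy hx h
      rwa [abs_sub_comm x y, abs_sub_comm (x ^ s)]
  obtain ⟨ξ, hξ, h1⟩ := exists_hasDerivAt_eq_slope (fun y : ℝ => y ^ s)
    (fun x => s * x ^ (s - 1)) hlt
    (fun z hz => (Real.hasDerivAt_rpow_const (Or.inl (by linarith [hz.1]))).continuousAt.continuousWithinAt)
    (fun z hz => Real.hasDerivAt_rpow_const (Or.inl (by linarith [hz.1])))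
  have hξ0 : 0 < ξ := by linarith [hξ.1]
  have hr := rpow_le_of_ratio (x := ξ) (M := N) (k := c) (q := s - 1) hN hc
    ((div_le_self hN.le hc).trans (by linarith [hξ.1])) (by linarith [hξ.2])
  have e : x ^ s - y ^ s = s * ξ ^ (s - 1) * (x - y) := by
    rw [eq_div_iff (by linarith)] at h1
    linarith
  rw [e, abs_mul, abs_mul, abs_of_pos (show 0 < ξ ^ (s - 1) by positivity)]
  constructor
  · calc _ = |s| * (c ^ (-|s - 1|) * N ^ (s - 1)) * |x - y| := by ring
      _ ≤ _ := by gcongr; exact hr.2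
  · calc _ ≤ |s| * (c ^ |s - 1| * N ^ (s - 1)) * |x - y| := by gcongr; exact hr.1
      _ = _ := by ring

theorem sqrt_add_div_sqrt_le {D M X q Q c k1 k2 : ℝ} (hM : 0 < M) (hX : 0 < X) (hq : 0 < q)
    (hqQ : q ≤ Q) (hc : 0 < c) (hk1 : 0 < k1) (hk2 : 0 < k2) (h1 : k1 * X * q ≤ D)
    (h2 : D ≤ k2 * X * q) (hQX : Q ≤ c * X) (hXQ : X * Q ^ 3 ≤ c * M ^ 2) :
    √D + M / √D ≤ (√(k2 * c) + √(c / k1)) * (M / √(Q * q)) := by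
  have hQ : 0 < Q := by linarith
  have hD : 0 < D := lt_of_lt_of_le (by positivity) h1
  rw [add_mul]
  apply add_le_add
  · rw [mul_div_assoc', le_div_iff₀ (by positivity), ← Real.sqrt_mul hD.le]
    rw [← Real.sqrt_sq hM.le, ← Real.sqrt_mul (by positivity)]
    apply Real.sqrt_le_sqrt
    calc D * (Q * q) ≤ (k2 * X * q) * (Q * q) := by gcongr
      _ = k2 * (X * (Q * q ^ 2)) := by ring
      _ ≤ k2 * (X * (Q * Q ^ 2)) := by gcongr
      _ = k2 * (X * Q ^ 3) := by ring
      _ ≤ k2 * (c * M ^ 2) := by gcongr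
      _ = _ := by ring
  · have hs : √(Q * q) ≤ √(c / k1) * √D := by
      rw [← Real.sqrt_mul (by positivity)]
      apply Real.sqrt_le_sqrt
      calc Q * q ≤ c * X * q := by gcongr
        _ = c / k1 * (k1 * X * q) := by field_simp
        _ ≤ _ := by gcongr
    rw [mul_div_assoc', div_le_div_iff₀ (by positivity) (by positivity)]
    calc M * √(Q * q) ≤ M * (√(c / k1) * √D) := by gcongr
      _ = _ := by ring

theorem norm_bilinear_sq_le (S V : Finset ℕ) (a b : ℕ → ℂ) (e : ℕ → ℕ → ℂ) {Bd L : ℝ}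
    (hb : ∀ n ∈ V, ‖b n‖ ≤ Bd) (K : ℕ → ℕ → ℝ)
    (hK : ∀ n ∈ V, ∀ n' ∈ V, ‖∑ m ∈ S, e m n * (starRingEnd ℂ) (e m n')‖ ≤ K n n')
    (hL : ∀ n ∈ V, ∑ n' ∈ V, K n n' ≤ L) :
    ‖∑ m ∈ S, ∑ n ∈ V, a m * b n * e m n‖ ^ 2 ≤
      (∑ m ∈ S, ‖a m‖ ^ 2) * (Bd ^ 2 * (V.card * L)) := by
  set g : ℕ → ℂ := fun m => ∑ n ∈ V, b n * e m n with hg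
  have h1 : ‖∑ m ∈ S, ∑ n ∈ V, a m * b n * e m n‖ ≤ ∑ m ∈ S, ‖a m‖ * ‖g m‖ := by
    refine (norm_sum_le _ _).trans (Finset.sum_le_sum fun m _ => ?_)
    rw [← norm_mul, hg, Finset.mul_sum]
    simp only [mul_assoc]; rfl
  have h2 : (∑ m ∈ S, ‖a m‖ * ‖g m‖) ^ 2 ≤ (∑ m ∈ S, ‖a m‖ ^ 2) * ∑ m ∈ S, ‖g m‖ ^ 2 :=
    Finset.sum_mul_sq_le_sq_mul_sq _ _ _
  have h3 : ((∑ m ∈ S, ‖g m‖ ^ 2 : ℝ) : ℂ) =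
      ∑ n ∈ V, ∑ n' ∈ V, b n * (starRingEnd ℂ) (b n') *
        ∑ m ∈ S, e m n * (starRingEnd ℂ) (e m n') := by
    push_cast
    have : ∀ m, ((‖g m‖ : ℝ) : ℂ) ^ 2 = ∑ n ∈ V, ∑ n' ∈ V, b n * (starRingEnd ℂ) (b n') *
        (e m n * (starRingEnd ℂ) (e m n')) := by
      intro m
      rw [← Complex.mul_conj', hg, map_sum, Finset.sum_mul_sum]
      refine Finset.sum_congr rfl fun n _ => Finset.sum_congr rfl fun n' _ => ?_
      rw [map_mul]; ring
    simp only [this, Finset.mul_sum]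
    rw [Finset.sum_comm]
    refine Finset.sum_congr rfl fun n _ => ?_
    rw [Finset.sum_comm]
  have h4 : ∑ m ∈ S, ‖g m‖ ^ 2 ≤ Bd ^ 2 * (V.card * L) := by
    have h0 : (0:ℝ) ≤ ∑ m ∈ S, ‖g m‖ ^ 2 := Finset.sum_nonneg fun _ _ => by positivity
    rw [← abs_of_nonneg h0, ← Real.norm_eq_abs, ← Complex.norm_real, h3]
    calc _ ≤ ∑ n ∈ V, ∑ n' ∈ V, Bd ^ 2 * K n n' := by
          refine (norm_sum_le _ _).trans (Finset.sum_le_sum fun n hn => ?_)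
          refine (norm_sum_le _ _).trans (Finset.sum_le_sum fun n' hn' => ?_)
          rw [norm_mul, norm_mul, RCLike.norm_conj, sq]
          have := (norm_nonneg (b n)).trans (hb n hn)
          exact mul_le_mul (mul_le_mul (hb n hn) (hb n' hn') (norm_nonneg _) this)
            (hK n hn n' hn') (norm_nonneg _) (by positivity)
      _ ≤ ∑ n ∈ V, Bd ^ 2 * L := by
          refine Finset.sum_le_sum fun n hn => ?_
          rw [← Finset.mul_sum]
          exact mul_le_mul_of_nonneg_left (hL n hn) (by positivity)
      _ = _ := by rw [Finset.sum_const, nsmul_eq_mul]; ring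
  calc _ ≤ (∑ m ∈ S, ‖a m‖ * ‖g m‖) ^ 2 := by gcongr
    _ ≤ _ := h2
    _ ≤ _ := by gcongr

theorem norm_bilinear_block_le {p s c : ℝ} (hp : p * (p - 1) ≠ 0) (hs : s ≠ 0) (hc : 1 ≤ c) :
    ∃ C : ℝ, 0 < C ∧ ∀ M N θ : ℝ, 1 ≤ M → 0 < N → θ ≠ 0 → ∀ Q : ℕ, 1 ≤ Q →
      Q * N ≤ c * (|θ| * M ^ p * N ^ s) → |θ| * M ^ p * N ^ s * Q ^ 3 ≤ c * M ^ 2 * N →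
      ∀ A B : ℕ, (∀ m : ℕ, A ≤ m → m < B → M ≤ m ∧ (m : ℝ) ≤ c * M) →
      ∀ V : Finset ℕ, (∀ n ∈ V, N ≤ n ∧ (n : ℝ) ≤ c * N) →
      (∀ n ∈ V, ∀ n' ∈ V, n < n' + Q) → ((V.card : ℝ) ≤ Q) →
      ∀ P : ℕ → ℕ → Prop, ∀ _ : ∀ m n, Decidable (P m n),
      (∀ n ∈ V, ∀ m₁ m₂ m, A ≤ m₁ → m₂ < B → P m₁ n → P m₂ n → m₁ ≤ m → m ≤ m₂ → P m n) →
      ∀ (a b : ℕ → ℂ) (Bd : ℝ), 0 ≤ Bd → (∀ n ∈ V, ‖b n‖ ≤ Bd) →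
      ‖∑ m ∈ Finset.Ico A B, ∑ n ∈ V,
        a m * b n * (if P m n then cis (θ * (m : ℝ) ^ p * (n : ℝ) ^ s) else 0)‖ ≤
      C * Bd * √(Q * M) * √(∑ m ∈ Finset.Ico A B, ‖a m‖ ^ 2) := by
  obtain ⟨C₁, hC₁, hC⟩ := norm_sum_cis_rpow_le hp hc
  set k1 := |s| * c ^ (-|s - 1|) with hk1
  set k2 := |s| * c ^ |s - 1| with hk2
  have hs0 : 0 < |s| := abs_pos.2 hs
  have hc0 : 0 < c := by linarith
  have hk1p : 0 < k1 := by positivity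
  have hk2p : 0 < k2 := by positivity
  set K₀ := C₁ * (√(k2 * c) + √(c / k1)) with hK₀
  have hK₀p : 0 < K₀ := by positivity
  refine ⟨√(c + 4 * K₀), by positivity, ?_⟩
  intro M N θ hM hN hθ Q hQ hQN hQM A B hAB V hV hVQ hVc P _ hP a b Bd hBd hb
  have hM0 : 0 < M := by linarith
  have hθ0 : 0 < |θ| := abs_pos.2 hθ
  have hQ0 : (0:ℝ) < Q := by exact_mod_cast hQ
  set X := |θ| * M ^ p * N ^ (s - 1) with hX
  have hXp : 0 < X := by positivity
  have hNs : N ^ s = N ^ (s - 1) * N := by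
    rw [Real.rpow_sub_one hN.ne']; field_simp
  have hQX : (Q:ℝ) ≤ c * X := by
    rw [hNs] at hQN
    refine le_of_mul_le_mul_right (hQN.trans_eq ?_) hN
    rw [hX]; ring
  have hXQ : X * Q ^ 3 ≤ c * M ^ 2 := by
    rw [hNs] at hQM
    refine le_of_mul_le_mul_right (le_of_eq_of_le ?_ hQM) hN
    rw [hX]; ring
  set e : ℕ → ℕ → ℂ := fun m n => if P m n then cis (θ * (m : ℝ) ^ p * (n : ℝ) ^ s) else 0 with he
  set K : ℕ → ℕ → ℝ := fun n n' => if n' = n then c * M else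
    K₀ * M / √Q * (1 / √|(n' : ℝ) - n|) with hKdef
  have hcard : ((Finset.Ico A B).card : ℝ) ≤ c * M := by
    have : Finset.Ico A B ⊆ Finset.Ioc 0 ⌊c * M⌋₊ := by
      intro m hm
      obtain ⟨h1, h2⟩ := Finset.mem_Ico.1 hm
      obtain ⟨h3, h4⟩ := hAB m h1 h2
      rw [Finset.mem_Ioc]
      refine ⟨?_, Nat.le_floor h4⟩
      have : (0:ℝ) < m := by linarith
      exact_mod_cast this
    have h := Finset.card_le_card this
    rw [Nat.card_Ioc] at h
    calc ((Finset.Ico A B).card : ℝ) ≤ (⌊c * M⌋₊ : ℝ) := by exact_mod_cast h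
      _ ≤ c * M := Nat.floor_le (by positivity)
  have hkey : ∀ n ∈ V, ∀ n' ∈ V,
      ‖∑ m ∈ Finset.Ico A B, e m n * (starRingEnd ℂ) (e m n')‖ ≤ K n n' := by
    intro n hn n' hn'
    simp only [hKdef]
    split_ifs with hnn
    · refine (norm_sum_le _ _).trans (le_trans ?_ hcard)
      rw [← nsmul_one, ← Finset.sum_const]
      refine Finset.sum_le_sum fun m _ => ?_
      have h1 : ∀ n, ‖e m n‖ ≤ 1 := by
        intro n; simp only [he]; split_ifs
        · rw [norm_cis]
        · simp
      rw [norm_mul, RCLike.norm_conj]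
      exact mul_le_one₀ (h1 n) (norm_nonneg _) (h1 n')
    · obtain ⟨A', B', hA', hB', heq⟩ := exists_eq_Ico
        ((Finset.Ico A B).filter fun m => P m n ∧ P m n') A B
        (fun m hm => by simpa using (Finset.mem_filter.1 hm).1) (by
          intro x hx y hy m h1 h2
          simp only [Finset.mem_filter, Finset.mem_Ico] at hx hy ⊢
          exact ⟨by omega, hP n hn x y m (by omega) (by omega) hx.2.1 hy.2.1 h1 h2,
            hP n' hn' x y m (by omega) (by omega) hx.2.2 hy.2.2 h1 h2⟩)
      set θ' := θ * ((n:ℝ) ^ s - (n':ℝ) ^ s) with hθ'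
      have hsum : ∑ m ∈ Finset.Ico A B, e m n * (starRingEnd ℂ) (e m n') =
          ∑ m ∈ Finset.Ico A' B', cis (θ' * (m:ℝ) ^ p) := by
        rw [← heq, Finset.sum_filter]
        refine Finset.sum_congr rfl fun m _ => ?_
        simp only [he]
        by_cases h1 : P m n <;> by_cases h2 : P m n' <;> simp [h1, h2]
        rw [← cis_sub, hθ']
        congr 1; ring
      have hd := abs_rpow_sub_rpow (s := s) hc hN (hV n hn) (hV n' hn')
      set q := |(n:ℝ) - n'| with hq
      have hqp : 0 < q := by
        rw [hq, abs_pos, sub_ne_zero]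
        exact fun h => hnn (by exact_mod_cast h.symm)
      have hqQ : q ≤ Q := by
        rw [hq, abs_le]
        have h1 := hVQ n hn n' hn'
        have h2 := hVQ n' hn' n hn
        have h1' : (n:ℝ) < n' + Q := by exact_mod_cast h1
        have h2' : (n':ℝ) < n + Q := by exact_mod_cast h2
        constructor <;> linarith
      have e1 : |θ'| * M ^ p = |θ| * M ^ p * |(n:ℝ) ^ s - (n':ℝ) ^ s| := by
        rw [hθ', abs_mul]; ring
      have hD1 : k1 * X * q ≤ |θ'| * M ^ p := by
        rw [e1]
        calc _ = |θ| * M ^ p * (k1 * N ^ (s - 1) * q) := by rw [hX]; ring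
          _ ≤ _ := by gcongr; exact hd.1
      have hD2 : |θ'| * M ^ p ≤ k2 * X * q := by
        rw [e1]
        calc _ ≤ |θ| * M ^ p * (k2 * N ^ (s - 1) * q) := by gcongr; exact hd.2
          _ = _ := by rw [hX]; ring
      have hθ'0 : θ' ≠ 0 := by
        intro h0
        rw [h0] at hD1
        have : 0 < k1 * X * q := by positivity
        simp at hD1
        linarith
      rw [hsum]
      refine (hC M θ' hM hθ'0 A' B' fun m h1 h2 => hAB m (by omega) (by omega)).trans ?_
      have := sqrt_add_div_sqrt_le (D := |θ'| * M ^ p) (M := M) hM0 hXp hqp hqQ hc0 hk1p hk2p hD1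
        hD2 hQX hXQ
      calc _ ≤ C₁ * ((√(k2 * c) + √(c / k1)) * (M / √(Q * q))) := by gcongr
        _ = _ := by
          rw [Real.sqrt_mul hQ0.le, abs_sub_comm (n':ℝ), ← hq, hK₀]
          field_simp
  have hL : ∀ n ∈ V, ∑ n' ∈ V, K n n' ≤ (c + 4 * K₀) * M := by
    intro n hn
    rw [← Finset.sum_filter_add_sum_filter_not V (fun k => k ≠ n)]
    have h1 : ∑ n' ∈ V.filter (· ≠ n), K n n' ≤ 4 * K₀ * M := by
      calc _ = ∑ n' ∈ V.filter (· ≠ n), K₀ * M / √Q * (1 / √|(n' : ℝ) - n|) := by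
            refine Finset.sum_congr rfl fun k hk => ?_
            simp only [hKdef, if_neg (Finset.mem_filter.1 hk).2]
        _ ≤ K₀ * M / √Q * (4 * √Q) := by
            rw [← Finset.mul_sum]
            gcongr
            exact sum_inv_sqrt_dist_le V Q n fun k hk => ⟨hVQ k hk n hn, hVQ n hn k hk⟩
        _ = _ := by
            have : √(Q:ℝ) ≠ 0 := by positivity
            field_simp
    have h2 : ∑ n' ∈ V.filter (fun k => ¬ k ≠ n), K n n' ≤ c * M := by
      have : V.filter (fun k => ¬ k ≠ n) = {n} := by
        ext k; simp only [Finset.mem_filter, Finset.mem_singleton, not_not]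
        exact ⟨fun h => h.2, fun h => ⟨h ▸ hn, h⟩⟩
      rw [this, Finset.sum_singleton]
      simp [hKdef]
    linarith
  have hmain := norm_bilinear_sq_le (Finset.Ico A B) V a b e hb K hkey hL
  have hS0 : 0 ≤ ∑ m ∈ Finset.Ico A B, ‖a m‖ ^ 2 := Finset.sum_nonneg fun _ _ => by positivity
  refine abs_le_of_sq_le_sq' ?_ (by positivity) |>.2
  refine hmain.trans ?_
  rw [mul_pow, mul_pow, mul_pow, Real.sq_sqrt (by positivity), Real.sq_sqrt (by positivity),
    Real.sq_sqrt hS0]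
  calc _ ≤ (∑ m ∈ Finset.Ico A B, ‖a m‖ ^ 2) * (Bd ^ 2 * (Q * ((c + 4 * K₀) * M))) := by gcongr
    _ = _ := by ring

theorem norm_bilinear_le {p s c : ℝ} (hp : p * (p - 1) ≠ 0) (hs : s ≠ 0) (hc : 1 ≤ c) :
    ∃ C : ℝ, 0 < C ∧ ∀ M N θ : ℝ, 1 ≤ M → 0 < N → θ ≠ 0 → ∀ Q : ℕ, 1 ≤ Q → Q ≤ c * N →
      Q * N ≤ c * (|θ| * M ^ p * N ^ s) → |θ| * M ^ p * N ^ s * Q ^ 3 ≤ c * M ^ 2 * N →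
      ∀ A B : ℕ, (∀ m : ℕ, A ≤ m → m < B → M ≤ m ∧ (m : ℝ) ≤ c * M) →
      ∀ U : Finset ℕ, (∀ n ∈ U, N ≤ n ∧ (n : ℝ) ≤ c * N) →
      ∀ P : ℕ → ℕ → Prop, ∀ _ : ∀ m n, Decidable (P m n),
      (∀ n ∈ U, ∀ m₁ m₂ m, A ≤ m₁ → m₂ < B → P m₁ n → P m₂ n → m₁ ≤ m → m ≤ m₂ → P m n) →
      ∀ (a b : ℕ → ℂ) (Bd : ℝ), 0 ≤ Bd → (∀ n ∈ U, ‖b n‖ ≤ Bd) →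
      ‖∑ m ∈ Finset.Ico A B, ∑ n ∈ U,
        a m * b n * (if P m n then cis (θ * (m : ℝ) ^ p * (n : ℝ) ^ s) else 0)‖ ≤
      C * Bd * N * √(M / Q) * √(∑ m ∈ Finset.Ico A B, ‖a m‖ ^ 2) := by
  obtain ⟨C, hC0, hC⟩ := norm_bilinear_block_le hp hs hc
  refine ⟨2 * c * C, by positivity, ?_⟩
  intro M N θ hM hN hθ Q hQ hQc hQN hQM A B hAB U hU P _ hP a b Bd hBd hb
  have hQ0 : (0:ℝ) < Q := by exact_mod_cast hQ
  have hM0 : 0 < M := by linarith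
  set f : ℕ → ℕ → ℂ := fun m n =>
    a m * b n * (if P m n then cis (θ * (m : ℝ) ^ p * (n : ℝ) ^ s) else 0) with hf
  set J := U.image (· / Q) with hJ
  have hJc : (J.card : ℝ) ≤ 2 * c * N / Q := by
    have : J ⊆ Finset.range (⌊c * N / Q⌋₊ + 1) := by
      intro j hj
      obtain ⟨n, hn, rfl⟩ := Finset.mem_image.1 hj
      rw [Finset.mem_range, Nat.lt_succ_iff]
      refine Nat.le_floor (Nat.cast_div_le.trans ?_)
      gcongr
      exact (hU n hn).2
    have h := Finset.card_le_card this
    rw [Finset.card_range] at h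
    have h1 : (⌊c * N / Q⌋₊ : ℝ) ≤ c * N / Q := Nat.floor_le (by positivity)
    have h2 : 1 ≤ c * N / Q := by rw [le_div_iff₀ hQ0, one_mul]; exact hQc
    calc (J.card : ℝ) ≤ ⌊c * N / Q⌋₊ + 1 := by exact_mod_cast h
      _ ≤ c * N / Q + c * N / Q := by linarith
      _ = _ := by ring
  have hsplit : ∑ m ∈ Finset.Ico A B, ∑ n ∈ U, f m n =
      ∑ j ∈ J, ∑ m ∈ Finset.Ico A B, ∑ n ∈ U.filter (fun n => n / Q = j), f m n := by
    rw [Finset.sum_comm (s := J)]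
    refine Finset.sum_congr rfl fun m _ => ?_
    exact (Finset.sum_fiberwise_of_maps_to (fun n hn => Finset.mem_image_of_mem _ hn) _).symm
  rw [hsplit]
  set R := √(∑ m ∈ Finset.Ico A B, ‖a m‖ ^ 2)
  have hblock : ∀ j ∈ J, ‖∑ m ∈ Finset.Ico A B, ∑ n ∈ U.filter (fun n => n / Q = j), f m n‖ ≤
      C * Bd * √(Q * M) * R := by
    intro j _
    have hmem : ∀ n ∈ U.filter (fun n => n / Q = j), n ∈ U ∧ j * Q ≤ n ∧ n < j * Q + Q := by
      intro n hn
      obtain ⟨h1, h2⟩ := Finset.mem_filter.1 hn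
      have h3 := Nat.div_add_mod n Q
      have h4 := Nat.mod_lt n hQ
      rw [h2, mul_comm] at h3
      exact ⟨h1, by omega, by omega⟩
    refine hC M N θ hM hN hθ Q hQ hQN hQM A B hAB _ (fun n hn => hU n (hmem n hn).1) ?_ ?_ P _
      (fun n hn => hP n (hmem n hn).1) a b Bd hBd (fun n hn => hb n (hmem n hn).1)
    · intro n hn n' hn'
      have := hmem n hn
      have := hmem n' hn'
      omega
    · have : U.filter (fun n => n / Q = j) ⊆ Finset.Ico (j * Q) (j * Q + Q) := by
        intro n hn
        have := hmem n hn
        rw [Finset.mem_Ico]; omega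
      have h := Finset.card_le_card this
      rw [Nat.card_Ico] at h
      have h' : (U.filter (fun n => n / Q = j)).card ≤ Q := by omega
      exact_mod_cast h'
  have hsq : √(Q * M) = Q * √(M / Q) := by
    rw [show (Q * M : ℝ) = Q ^ 2 * (M / Q) by field_simp, Real.sqrt_mul (by positivity),
      Real.sqrt_sq hQ0.le]
  calc _ ≤ ∑ j ∈ J, C * Bd * √(Q * M) * R := (norm_sum_le _ _).trans (Finset.sum_le_sum hblock)
    _ = J.card * (C * Bd * √(Q * M) * R) := by rw [Finset.sum_const, nsmul_eq_mul]
    _ ≤ (2 * c * N / Q) * (C * Bd * √(Q * M) * R) := by gcongr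
    _ = _ := by rw [hsq]; field_simp

theorem card_divisors_le_rpow {ε : ℝ} (hε : 0 < ε) :
    ∃ C : ℝ, 0 < C ∧ ∀ n : ℕ, n ≠ 0 → (n.divisors.card : ℝ) ≤ C * (n : ℝ) ^ ε := by
  have hl2 : 0 < Real.log 2 := Real.log_pos (by norm_num)
  set K : ℝ := 1 + 1 / (ε * Real.log 2) with hK
  have hK1 : 1 ≤ K := by rw [hK]; have : 0 < 1 / (ε * Real.log 2) := by positivity
                         linarith
  set P : ℕ := ⌈(2:ℝ) ^ (1 / ε)⌉₊ with hP
  set c : ℕ → ℝ := fun p => if p < P then K else 1 with hcdef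
  have hc1 : ∀ p, 1 ≤ c p := by intro p; simp only [hcdef]; split_ifs <;> linarith
  have hloc : ∀ p : ℕ, 2 ≤ p → ∀ v : ℕ, (v : ℝ) + 1 ≤ c p * ((p : ℝ) ^ v) ^ ε := by
    intro p hp v
    have hp2 : (2:ℝ) ≤ p := by exact_mod_cast hp
    rw [← Real.rpow_natCast, ← Real.rpow_mul (by positivity)]
    simp only [hcdef]
    split_ifs with h
    · have h1 : (2:ℝ) ^ ((v:ℝ) * ε) ≤ (p:ℝ) ^ ((v:ℝ) * ε) :=
        Real.rpow_le_rpow (by norm_num) hp2 (by positivity)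
      have h2 : 1 + Real.log 2 * (v * ε) ≤ (2:ℝ) ^ ((v:ℝ) * ε) := by
        rw [Real.rpow_def_of_pos (by norm_num)]
        linarith [Real.add_one_le_exp (Real.log 2 * (v * ε))]
      have h3 : (v:ℝ) + 1 ≤ K * (1 + Real.log 2 * (v * ε)) := by
        have : K * (1 + Real.log 2 * (v * ε)) =
            1 + Real.log 2 * (v * ε) + 1 / (ε * Real.log 2) + v := by
          rw [hK]; field_simp; ring
        rw [this]
        have : 0 < 1 / (ε * Real.log 2) := by positivity
        have : 0 ≤ Real.log 2 * (v * ε) := by positivity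
        linarith
      calc _ ≤ K * (1 + Real.log 2 * (v * ε)) := h3
        _ ≤ _ := by gcongr; exact h2.trans h1
    · have h1 : (2:ℝ) ^ (1 / ε) ≤ p := (Nat.le_ceil _).trans (by exact_mod_cast not_lt.1 h)
      have h2 : (2:ℝ) ≤ (p:ℝ) ^ ε := by
        calc (2:ℝ) = ((2:ℝ) ^ (1 / ε)) ^ ε := by
              rw [← Real.rpow_mul (by norm_num), one_div_mul_cancel hε.ne', Real.rpow_one]
          _ ≤ _ := Real.rpow_le_rpow (by positivity) h1 hε.le
      rw [mul_comm (v:ℝ), Real.rpow_mul (by positivity), Real.rpow_natCast, one_mul]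
      calc (v:ℝ) + 1 ≤ (2:ℝ) ^ v := by exact_mod_cast Nat.lt_two_pow_self
        _ ≤ _ := by gcongr
  refine ⟨∏ p ∈ Finset.range P, c p, Finset.prod_pos fun p _ => by linarith [hc1 p], ?_⟩
  intro n hn
  have hn' : (n : ℝ) = ∏ p ∈ n.primeFactors, (p:ℝ) ^ (n.factorization p) := by
    conv_lhs => rw [← Nat.prod_factorization_pow_eq_self hn, Finsupp.prod]
    push_cast
    rfl
  rw [Nat.card_divisors hn]
  conv_rhs => rw [hn']
  push_cast
  rw [← Real.finsetProd_rpow _ _ (fun _ _ => by positivity)]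
  calc _ ≤ ∏ p ∈ n.primeFactors, (c p * ((p:ℝ) ^ (n.factorization p)) ^ ε) := by
        refine Finset.prod_le_prod (fun _ _ => by positivity) fun p hp => ?_
        exact hloc p (Nat.prime_of_mem_primeFactors hp).two_le _
    _ = (∏ p ∈ n.primeFactors, c p) * ∏ p ∈ n.primeFactors, ((p:ℝ) ^ (n.factorization p)) ^ ε :=
        Finset.prod_mul_distrib
    _ ≤ _ := by
        refine mul_le_mul_of_nonneg_right ?_ (Finset.prod_nonneg fun _ _ => by positivity)
        rw [← Finset.prod_filter_mul_prod_filter_not n.primeFactors (· < P)]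
        have : ∏ p ∈ n.primeFactors.filter (fun p => ¬ p < P), c p = 1 := by
          refine Finset.prod_eq_one fun p hp => ?_
          simp only [hcdef, if_neg (Finset.mem_filter.1 hp).2]
        rw [this, mul_one]
        have hsub : n.primeFactors.filter (· < P) ⊆ Finset.range P := fun p hp =>
          Finset.mem_range.2 (Finset.mem_filter.1 hp).2
        rw [← Finset.prod_sdiff hsub]
        refine le_mul_of_one_le_left (Finset.prod_nonneg fun p _ => by linarith [hc1 p]) ?_
        rw [← Finset.prod_const_one (s := Finset.range P \ n.primeFactors.filter (· < P))]
        exact Finset.prod_le_prod (fun _ _ => zero_le_one) fun p _ => hc1 p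

/-- Ordered triples of positive integers with product `n`. -/
def tripleSet (n : ℕ) : Finset (ℕ × ℕ × ℕ) :=
  (Finset.Icc 1 n ×ˢ Finset.Icc 1 n ×ˢ Finset.Icc 1 n).filter
    fun p : ℕ × ℕ × ℕ => p.1 * p.2.1 * p.2.2 = n

theorem mem_tripleSet {n : ℕ} (hn : n ≠ 0) (p : ℕ × ℕ × ℕ) :
    p ∈ tripleSet n ↔ p.1 * p.2.1 * p.2.2 = n := by
  simp only [tripleSet, Finset.mem_filter, Finset.mem_product, Finset.mem_Icc]
  refine ⟨fun h => h.2, fun h => ⟨?_, h⟩⟩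
  obtain ⟨x, y, z⟩ := p
  simp only at h ⊢
  have hx : x ∣ n := ⟨y * z, by rw [← h]; ring⟩
  have hy : y ∣ n := ⟨x * z, by rw [← h]; ring⟩
  have hz : z ∣ n := ⟨x * y, by rw [← h]; ring⟩
  have hn0 : 0 < n := Nat.pos_of_ne_zero hn
  exact ⟨⟨Nat.pos_of_dvd_of_pos hx hn0, Nat.le_of_dvd hn0 hx⟩,
    ⟨Nat.pos_of_dvd_of_pos hy hn0, Nat.le_of_dvd hn0 hy⟩,
    ⟨Nat.pos_of_dvd_of_pos hz hn0, Nat.le_of_dvd hn0 hz⟩⟩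

theorem sum_tripleSet_rotate {n : ℕ} (hn : n ≠ 0) (F : ℕ → ℕ → ℕ → ℂ) :
    ∑ p ∈ tripleSet n, F p.1 p.2.1 p.2.2 = ∑ p ∈ tripleSet n, F p.2.2 p.1 p.2.1 := by
  refine Finset.sum_nbij' (fun p => (p.2.1, p.2.2, p.1)) (fun p => (p.2.2, p.1, p.2.1))
    ?_ ?_ ?_ ?_ ?_
  · intro p hp
    rw [mem_tripleSet hn] at hp ⊢
    rw [← hp]; ring
  · intro p hp
    rw [mem_tripleSet hn] at hp ⊢
    rw [← hp]; ring
  · intro p _; rfl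
  · intro p _; rfl
  · intro p _; rfl

theorem sum_tripleSet_swap {n : ℕ} (hn : n ≠ 0) (F : ℕ → ℕ → ℕ → ℂ) :
    ∑ p ∈ tripleSet n, F p.1 p.2.1 p.2.2 = ∑ p ∈ tripleSet n, F p.1 p.2.2 p.2.1 := by
  refine Finset.sum_nbij' (fun p => (p.1, p.2.2, p.2.1)) (fun p => (p.1, p.2.2, p.2.1))
    ?_ ?_ ?_ ?_ ?_
  · intro p hp
    rw [mem_tripleSet hn] at hp ⊢
    rw [← hp]; ring
  · intro p hp
    rw [mem_tripleSet hn] at hp ⊢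
    rw [← hp]; ring
  · intro p _; rfl
  · intro p _; rfl
  · intro p _; rfl

theorem sum_tripleSet {n : ℕ} (hn : n ≠ 0) (F : ℕ → ℕ → ℕ → ℂ) :
    ∑ p ∈ tripleSet n, F p.1 p.2.1 p.2.2 =
      ∑ p ∈ n.divisorsAntidiagonal, ∑ q ∈ p.1.divisorsAntidiagonal, F q.1 q.2 p.2 := by
  rw [Finset.sum_sigma']
  refine Finset.sum_nbij' (fun p => ⟨(p.1 * p.2.1, p.2.2), (p.1, p.2.1)⟩)
    (fun s => (s.2.1, s.2.2, s.1.2)) ?_ ?_ ?_ ?_ ?_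
  · intro p hp
    rw [mem_tripleSet hn] at hp
    simp only [Finset.mem_sigma, Nat.mem_divisorsAntidiagonal, true_and]
    refine ⟨⟨hp, hn⟩, fun h => hn (by rw [← hp, h, zero_mul])⟩
  · rintro ⟨⟨m, k⟩, ⟨x, y⟩⟩ hs
    simp only [Finset.mem_sigma, Nat.mem_divisorsAntidiagonal] at hs
    rw [mem_tripleSet hn]
    simp only
    rw [hs.2.1, hs.1.1]
  · intro p _; rfl
  · rintro ⟨⟨m, k⟩, ⟨x, y⟩⟩ hs
    simp only [Finset.mem_sigma, Nat.mem_divisorsAntidiagonal] at hs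
    obtain ⟨_, rfl, _⟩ := hs
    rfl
  · intro p _; rfl

/-- Splitting the triples with product `k` according to which of the first two entries are at
least `q`. -/
theorem d3_eq_sum (q k : ℕ) (hk : k ≠ 0) : (d3 k : ℂ) =
    ∑ p ∈ k.divisorsAntidiagonal,
      ((((p.1.divisorsAntidiagonal.card : ℂ) +
        ((p.1.divisorsAntidiagonal.filter fun r => r.1 < q).card : ℂ)) *
          (if q ≤ p.2 then 1 else 0)) +
        ((p.1.divisorsAntidiagonal.filter fun r => r.1 < q ∧ r.2 < q).card : ℂ)) := by
  have h1 : (d3 k : ℂ) = ∑ p ∈ tripleSet k, ((if q ≤ p.1 then 1 else 0) +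
      ((if p.1 < q then 1 else 0) * (if q ≤ p.2.1 then 1 else 0) +
        (if p.1 < q ∧ p.2.1 < q then 1 else 0)) : ℂ) := by
    rw [show d3 k = (tripleSet k).card from rfl, Finset.card_eq_sum_ones]
    push_cast
    refine Finset.sum_congr rfl fun p _ => ?_
    by_cases hx : p.1 < q <;> by_cases hy : p.2.1 < q <;> simp [hx, hy, not_le.2, not_lt.1]
  rw [h1, Finset.sum_add_distrib, Finset.sum_add_distrib]
  have e1 := sum_tripleSet_rotate hk fun x _ _ => (if q ≤ x then 1 else 0 : ℂ)
  have e1' := sum_tripleSet hk fun _ _ z => (if q ≤ z then 1 else 0 : ℂ)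
  have e2 := sum_tripleSet_swap hk
    fun x y _ => ((if x < q then 1 else 0) * (if q ≤ y then 1 else 0) : ℂ)
  have e2' := sum_tripleSet hk
    fun x _ z => ((if x < q then 1 else 0) * (if q ≤ z then 1 else 0) : ℂ)
  have e3 := sum_tripleSet hk fun x y _ => ((if x < q ∧ y < q then 1 else 0) : ℂ)
  rw [e1, e1', e2, e2', e3, ← Finset.sum_add_distrib, ← Finset.sum_add_distrib]
  refine Finset.sum_congr rfl fun p _ => ?_
  rw [← Finset.sum_mul, Finset.sum_const, Finset.sum_boole, Finset.sum_boole, nsmul_eq_mul]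
  ring

theorem sum_Ioc_divisorsAntidiagonal (A B : ℕ) (G : ℕ → ℕ → ℂ) :
    ∑ k ∈ Finset.Ioc A B, ∑ p ∈ k.divisorsAntidiagonal, G p.1 p.2 =
      ∑ m ∈ Finset.Icc 1 B, ∑ n ∈ Finset.Icc 1 B,
        if A < m * n ∧ m * n ≤ B then G m n else 0 := by
  rw [Finset.sum_sigma', ← Finset.sum_product', ← Finset.sum_filter]
  refine Finset.sum_nbij' (fun s => s.2) (fun p => ⟨p.1 * p.2, p⟩) ?_ ?_ ?_ ?_ ?_
  · rintro ⟨k, m, n⟩ hs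
    simp only [Finset.mem_sigma, Nat.mem_divisorsAntidiagonal, Finset.mem_Ioc] at hs
    obtain ⟨⟨h1, h2⟩, rfl, h3⟩ := hs
    have hm : 0 < m := Nat.pos_of_ne_zero (left_ne_zero_of_mul h3)
    have hn : 0 < n := Nat.pos_of_ne_zero (right_ne_zero_of_mul h3)
    simp only [Finset.mem_filter, Finset.mem_product, Finset.mem_Icc]
    refine ⟨⟨⟨hm, (Nat.le_mul_of_pos_right m hn).trans h2⟩, hn,
      (Nat.le_mul_of_pos_left n hm).trans h2⟩, h1, h2⟩
  · rintro ⟨m, n⟩ hs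
    simp only [Finset.mem_filter, Finset.mem_product, Finset.mem_Icc] at hs
    simp only [Finset.mem_sigma, Nat.mem_divisorsAntidiagonal, Finset.mem_Ioc, true_and]
    exact ⟨hs.2, by omega⟩
  · rintro ⟨k, m, n⟩ hs
    simp only [Finset.mem_sigma, Nat.mem_divisorsAntidiagonal, Finset.mem_Ioc] at hs
    obtain ⟨_, rfl, _⟩ := hs
    rfl
  · intro p _; rfl
  · intro p _; rfl

theorem exists_d3_decomposition (q M : ℕ) (hqM : q * q ≤ M) :
    ∃ a b : ℕ → ℂ, (∀ m, M < m → a m = 0) ∧ (∀ m, m ≤ M → b m = 0) ∧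
      (∀ m, ‖a m‖ ≤ 3 * m.divisors.card) ∧ (∀ m, ‖b m‖ ≤ 2 * m.divisors.card) ∧
      ∀ A B : ℕ, M * q ≤ A → ∀ f : ℕ → ℂ, ∑ k ∈ Finset.Ioc A B, (d3 k : ℂ) * f k =
        ∑ m ∈ Finset.Icc 1 B, ∑ n ∈ Finset.Icc 1 B,
          (if A < m * n ∧ m * n ≤ B then a m * f (m * n) else 0) +
        ∑ m ∈ Finset.Icc 1 B, ∑ n ∈ Finset.Icc 1 B,
          (if A < m * n ∧ m * n ≤ B ∧ q ≤ n then b m * f (m * n) else 0) := by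
  set u : ℕ → ℂ := fun m => (m.divisorsAntidiagonal.card : ℂ) +
        ((m.divisorsAntidiagonal.filter fun r => r.1 < q).card : ℂ) with hu
  set w : ℕ → ℂ := fun m =>
    ((m.divisorsAntidiagonal.filter fun r => r.1 < q ∧ r.2 < q).card : ℂ) with hw
  have hcard : ∀ m : ℕ, m.divisorsAntidiagonal.card = m.divisors.card := fun m => by
    rw [← Nat.map_div_right_divisors, Finset.card_map]
  have hu2 : ∀ m, ‖u m‖ ≤ 2 * m.divisors.card := by
    intro m
    have : (m.divisorsAntidiagonal.filter fun r => r.1 < q).card ≤ m.divisors.card :=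
      (Finset.card_filter_le _ _).trans (hcard m).le
    have h' : ((m.divisorsAntidiagonal.filter fun r => r.1 < q).card : ℝ) ≤ m.divisors.card := by
      exact_mod_cast this
    simp only [hu]
    refine (norm_add_le _ _).trans ?_
    rw [hcard]
    simp only [Complex.norm_natCast]
    linarith
  have hw2 : ∀ m, ‖w m‖ ≤ m.divisors.card := by
    intro m
    simp only [hw, Complex.norm_natCast]
    exact_mod_cast (Finset.card_filter_le _ _).trans (hcard m).le
  have hw0 : ∀ m, M < m → w m = 0 := by
    intro m hm
    simp only [hw, Nat.cast_eq_zero, Finset.card_eq_zero, Finset.filter_eq_empty_iff]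
    rintro ⟨x, y⟩ hr ⟨h1, h2⟩
    have := (Nat.mem_divisorsAntidiagonal.1 hr).1
    simp only at this h1 h2
    have : x * y ≤ q * q := Nat.mul_le_mul h1.le h2.le
    omega
  refine ⟨fun m => (if m ≤ M then u m else 0) + w m, fun m => if m ≤ M then 0 else u m,
    ?_, ?_, ?_, ?_, ?_⟩
  · intro m hm
    simp [hw0 m hm, not_le.2 hm]
  · intro m hm
    simp [hm]
  · intro m
    refine (norm_add_le _ _).trans ?_
    have h1 : ‖(if m ≤ M then u m else 0)‖ ≤ 2 * m.divisors.card := by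
      split_ifs
      · exact hu2 m
      · simp
    linarith [hw2 m]
  · intro m
    simp only
    split_ifs
    · simp
    · exact hu2 m
  · intro A B hA f
    have h1 : ∑ k ∈ Finset.Ioc A B, (d3 k : ℂ) * f k = ∑ k ∈ Finset.Ioc A B,
        ∑ p ∈ k.divisorsAntidiagonal,
          (u p.1 * (if q ≤ p.2 then 1 else 0) + w p.1) * f (p.1 * p.2) := by
      refine Finset.sum_congr rfl fun k hk => ?_
      rw [d3_eq_sum q k (by have := (Finset.mem_Ioc.1 hk).1; omega), Finset.sum_mul]
      refine Finset.sum_congr rfl fun p hp => ?_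
      rw [(Nat.mem_divisorsAntidiagonal.1 hp).1]
    rw [h1, sum_Ioc_divisorsAntidiagonal A B
      fun m n => (u m * (if q ≤ n then 1 else 0) + w m) * f (m * n), ← Finset.sum_add_distrib]
    refine Finset.sum_congr rfl fun m _ => ?_
    rw [← Finset.sum_add_distrib]
    refine Finset.sum_congr rfl fun n _ => ?_
    by_cases h : A < m * n ∧ m * n ≤ B
    · by_cases hm : m ≤ M
      · have hqn : q ≤ n := by
          by_contra hlt
          have : m * n ≤ M * q := Nat.mul_le_mul hm (by omega)
          omega
        simp [h, hm, hqn]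
      · by_cases hqn : q ≤ n
        · simp [h, hm, hqn]; ring
        · simp [h, hm, hqn]
    · have h' : ¬ (A < m * n ∧ m * n ≤ B ∧ q ≤ n) := fun h2 => h ⟨h2.1, h2.2.1⟩
      simp [h, h']

theorem type_two_dyadic {β κ : ℝ} (hβ : 2 / 3 ≤ β) (hβ1 : β < 1) (hκ : 0 < κ) :
    ∃ C : ℝ, 0 < C ∧ ∀ A B M q N : ℕ, 1 ≤ A → B ≤ 2 * A → 1 ≤ q → 1 ≤ N → q ≤ 2 * N →
      N * M ≤ 2 * A → (A : ℝ) ^ (1 - β / 2) ≤ M → (q : ℝ) ≤ (A : ℝ) ^ (2 / 3 - β / 2) → 4 ≤ M →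
      ∀ U : Finset ℕ, (∀ n ∈ U, N ≤ n ∧ n ≤ 2 * N) → 
      ∀ (b : ℕ → ℂ) (D : ℝ), 0 ≤ D → (∀ m, 1 ≤ m → m ≤ B → ‖b m‖ ≤ D) →
      ‖∑ m ∈ Finset.Icc 1 B, ∑ n ∈ U, (if A < m * n ∧ m * n ≤ B then
        b m * cis (κ * ((m * n : ℕ) : ℝ) ^ β) else 0)‖ ≤ C * D * (A / √q) := by
  set c : ℝ := 4 + 4 / κ + 8 * κ with hc
  have hc4 : 4 ≤ c := by rw [hc]; have : 0 < 4 / κ := by positivity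
                         linarith
  have hcκ : 4 / κ ≤ c := by rw [hc]; linarith
  have hcκ' : 8 * κ ≤ c := by rw [hc]; have : 0 < 4 / κ := by positivity
                              linarith
  have hβ0 : 0 < β := by linarith
  obtain ⟨C, hC0, hC⟩ := norm_bilinear_le (p := β) (s := β) (c := c)
    (mul_ne_zero hβ0.ne' (by linarith)) hβ0.ne' (by linarith)
  refine ⟨C, hC0, ?_⟩
  intro A B M₀ q N hA hBA hq hN hqN hNM hM₀ hqA hM4 U hU b D hD hb
  have hA0 : (0:ℝ) < A := by exact_mod_cast hA
  have hA1 : (1:ℝ) ≤ A := by exact_mod_cast hA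
  have hN0 : (0:ℝ) < N := by exact_mod_cast hN
  have hq0 : (0:ℝ) < q := by exact_mod_cast hq
  have hM0 : (0:ℝ) < M₀ := by have : 0 < M₀ := by omega
                              exact_mod_cast this
  have hNM' : (N:ℝ) * M₀ ≤ 2 * A := by exact_mod_cast hNM
  have hqN' : (q:ℝ) ≤ 2 * N := by exact_mod_cast hqN
  set M : ℝ := A / (2 * N) with hM
  have hM1 : 1 ≤ M := by
    rw [hM, le_div_iff₀ (by positivity), one_mul]
    have h4 : (4:ℝ) ≤ M₀ := by exact_mod_cast hM4
    nlinarith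
  have hMN : M ^ β * (N:ℝ) ^ β = (A / 2 : ℝ) ^ β := by
    rw [← Real.mul_rpow (by positivity) (by positivity), hM]
    congr 1; field_simp
  have hNA : (N:ℝ) ≤ 2 * (A:ℝ) ^ (β / 2) := by
    have h1 : (A:ℝ) ^ (1 - β / 2) * (A:ℝ) ^ (β / 2) = A := by
      rw [← Real.rpow_add hA0]; simp
    have h2 : (0:ℝ) < (A:ℝ) ^ (1 - β / 2) := by positivity
    have h3 : (N:ℝ) * (A:ℝ) ^ (1 - β / 2) ≤ 2 * ((A:ℝ) ^ (1 - β / 2) * (A:ℝ) ^ (β / 2)) := by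
      rw [h1]; exact le_trans (by gcongr) hNM'
    nlinarith
  obtain ⟨x, hx⟩ : ∃ x, x = A / (2 * N) := ⟨_, rfl⟩
  obtain ⟨y, hy⟩ : ∃ y, y = 2 * A / N := ⟨_, rfl⟩
  set S := Finset.Ico (x + 1) (min B y + 1) with hS
  have hSmem : ∀ m : ℕ, x + 1 ≤ m → m < min B y + 1 →
      M ≤ m ∧ (m:ℝ) ≤ c * M := by
    intro m h1 h2
    constructor
    · rw [hM, div_le_iff₀ (by positivity)]
      have h3 : A < m * (2 * N) := (Nat.div_lt_iff_lt_mul (by omega)).1 (by rw [← hx]; omega)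
      exact_mod_cast h3.le
    · have h3 : m * N ≤ 2 * A := (Nat.le_div_iff_mul_le (by omega)).1 (by rw [← hy]; omega)
      have h4 : (m:ℝ) * N ≤ 2 * A := by exact_mod_cast h3
      calc (m:ℝ) ≤ 2 * A / N := by rw [le_div_iff₀ hN0]; exact h4
        _ = 4 * M := by rw [hM]; field_simp; norm_num
        _ ≤ c * M := by gcongr
  have hrestrict : ∑ m ∈ Finset.Icc 1 B, ∑ n ∈ U, (if A < m * n ∧ m * n ≤ B then
        b m * cis (κ * ((m * n : ℕ) : ℝ) ^ β) else 0) =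
      ∑ m ∈ S, ∑ n ∈ U, b m * 1 * (if A < m * n ∧ m * n ≤ B then
        cis (κ * (m : ℝ) ^ β * (n : ℝ) ^ β) else 0) := by
    have hsub : S ⊆ Finset.Icc 1 B := by
      intro m hm
      rw [hS, Finset.mem_Ico] at hm
      rw [Finset.mem_Icc]
      omega
    symm
    rw [← Finset.sum_subset hsub]
    · refine Finset.sum_congr rfl fun m _ => Finset.sum_congr rfl fun n _ => ?_
      split_ifs
      · rw [mul_one, Nat.cast_mul, Real.mul_rpow (by positivity) (by positivity), ← mul_assoc]
      · simp
    · intro m hm hmS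
      refine Finset.sum_eq_zero fun n hn => ?_
      rw [if_neg]
      rintro ⟨h1, h2⟩
      apply hmS
      obtain ⟨h3, h4⟩ := hU n hn
      rw [hS, Finset.mem_Ico]
      have h5 : A < m * (2 * N) := lt_of_lt_of_le h1 (Nat.mul_le_mul_left m h4)
      have h6 : m * N ≤ 2 * A := (Nat.mul_le_mul_left m h3).trans (h2.trans hBA)
      have h7 := (Nat.div_lt_iff_lt_mul (show 0 < 2 * N by omega)).2 h5
      have h8 := (Nat.le_div_iff_mul_le (show 0 < N by omega)).2 h6
      rw [← hx] at h7
      rw [← hy] at h8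
      have := (Finset.mem_Icc.1 hm).2
      omega
  rw [hrestrict]
  have hcond1 : (q:ℝ) ≤ c * N := hqN'.trans (by gcongr; linarith)
  have hcond2 : (q:ℝ) * N ≤ c * (|κ| * M ^ β * (N:ℝ) ^ β) := by
    rw [abs_of_pos hκ, mul_assoc κ, hMN]
    have h2 : (1:ℝ) / 2 ≤ (1 / 2 : ℝ) ^ β := by
      conv_lhs => rw [← Real.rpow_one (1 / 2 : ℝ)]
      exact Real.rpow_le_rpow_of_exponent_ge (by norm_num) (by norm_num) hβ1.le
    have h3 : (A:ℝ) ^ β / 2 ≤ (A / 2 : ℝ) ^ β := by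
      rw [show (A / 2 : ℝ) = A * (1 / 2) by ring, Real.mul_rpow (by positivity) (by positivity),
        div_eq_mul_one_div]
      gcongr
    calc (q:ℝ) * N ≤ (A : ℝ) ^ (2 / 3 - β / 2) * (2 * (A:ℝ) ^ (β / 2)) := by gcongr
      _ = 2 * (A:ℝ) ^ (2 / 3 : ℝ) := by
        rw [mul_left_comm, ← Real.rpow_add hA0]; ring_nf
      _ ≤ 2 * (A:ℝ) ^ β := by
        have := Real.rpow_le_rpow_of_exponent_le hA1 hβ
        linarith
      _ = 4 / κ * (κ * ((A:ℝ) ^ β / 2)) := by field_simp; norm_num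
      _ ≤ _ := by gcongr
  have hcond3 : |κ| * M ^ β * (N:ℝ) ^ β * (q:ℝ) ^ 3 ≤ c * M ^ 2 * N := by
    rw [abs_of_pos hκ, mul_assoc κ, hMN]
    have h1 : (A / 2 : ℝ) ^ β ≤ (A:ℝ) ^ β :=
      Real.rpow_le_rpow (by positivity) (by linarith) hβ0.le
    have h2 : (A:ℝ) ^ β * ((A : ℝ) ^ (2 / 3 - β / 2)) ^ 3 * (A:ℝ) ^ (β / 2) = (A:ℝ) ^ 2 := by
      rw [← Real.rpow_natCast, ← Real.rpow_natCast, ← Real.rpow_mul hA0.le,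
        ← Real.rpow_add hA0, ← Real.rpow_add hA0]
      congr 1
      push_cast
      ring
    calc κ * (A / 2 : ℝ) ^ β * (q:ℝ) ^ 3 ≤ κ * (A:ℝ) ^ β * ((A : ℝ) ^ (2 / 3 - β / 2)) ^ 3 := by
          gcongr
      _ ≤ 8 * κ * M ^ 2 * N := by
          have h3 : 8 * κ * M ^ 2 * N = κ * (2 * (A:ℝ) ^ 2 / N) := by
            rw [hM]; field_simp; norm_num
          rw [h3, mul_assoc]
          gcongr
          rw [le_div_iff₀ hN0]
          calc _ ≤ (A:ℝ) ^ β * ((A : ℝ) ^ (2 / 3 - β / 2)) ^ 3 * (2 * (A:ℝ) ^ (β / 2)) := by gcongr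
            _ = 2 * ((A:ℝ) ^ β * ((A : ℝ) ^ (2 / 3 - β / 2)) ^ 3 * (A:ℝ) ^ (β / 2)) := by ring
            _ = _ := by rw [h2]
      _ ≤ _ := by gcongr
  have hmain := hC M N κ hM1 hN0 hκ.ne' q hq hcond1 hcond2 hcond3 _ _ hSmem U
    (fun n hn => ⟨by exact_mod_cast (hU n hn).1, by
      have : (n:ℝ) ≤ 2 * N := by exact_mod_cast (hU n hn).2
      nlinarith⟩)
    (fun m n => A < m * n ∧ m * n ≤ B) (fun _ _ => inferInstance) (by
      intro n _ m₁ m₂ m _ _ h1 h2 h3 h4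
      exact ⟨h1.1.trans_le (Nat.mul_le_mul_right n h3), (Nat.mul_le_mul_right n h4).trans h2.2⟩)
    b (fun _ => 1) 1 zero_le_one (fun _ _ => by simp)
  refine hmain.trans ?_
  have hsum : ∑ m ∈ S, ‖b m‖ ^ 2 ≤ 4 * M * D ^ 2 := by
    have hcard : (S.card : ℝ) ≤ 4 * M := by
      have h1 : S.card ≤ 2 * A / N := by
        rw [← hy, hS, Nat.card_Ico]; omega
      calc (S.card : ℝ) ≤ ((2 * A / N : ℕ) : ℝ) := by exact_mod_cast h1
        _ ≤ ((2 * A : ℕ) : ℝ) / N := Nat.cast_div_le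
        _ = 4 * M := by rw [hM]; push_cast; field_simp; norm_num
    calc _ ≤ ∑ m ∈ S, D ^ 2 := by
          refine Finset.sum_le_sum fun m hm => ?_
          rw [hS, Finset.mem_Ico] at hm
          have := hb m (by omega) (by omega)
          gcongr
      _ = S.card * D ^ 2 := by rw [Finset.sum_const, nsmul_eq_mul]
      _ ≤ _ := by gcongr
  calc _ ≤ C * 1 * N * √(M / q) * √(4 * M * D ^ 2) := by gcongr
    _ = C * D * (A / √q) := by
      rw [Real.sqrt_div (by positivity), Real.sqrt_mul (by positivity), Real.sqrt_sq hD,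
        show 4 * M = 2 ^ 2 * M by ring, Real.sqrt_mul (by positivity), Real.sqrt_sq (by norm_num)]
      have h1 : √M * √M = M := Real.mul_self_sqrt (by positivity)
      calc _ = C * D * (2 * N * (√M * √M) / √q) := by ring
        _ = _ := by rw [h1, hM]; field_simp

theorem type_two_bound {β κ : ℝ} (hβ : 2 / 3 ≤ β) (hβ1 : β < 1) (hκ : 0 < κ) :
    ∃ C : ℝ, 0 < C ∧ ∀ A B M q : ℕ, 1 ≤ A → B ≤ 2 * A → 1 ≤ q →
      (A : ℝ) ^ (1 - β / 2) ≤ M → (q : ℝ) ≤ (A : ℝ) ^ (2 / 3 - β / 2) → 4 ≤ M →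
      ∀ (b : ℕ → ℂ) (D : ℝ), 0 ≤ D → (∀ m, m ≤ M → b m = 0) →
      (∀ m, 1 ≤ m → m ≤ B → ‖b m‖ ≤ D) →
      ‖∑ m ∈ Finset.Icc 1 B, ∑ n ∈ Finset.Icc 1 B, (if A < m * n ∧ m * n ≤ B ∧ q ≤ n then
        b m * cis (κ * ((m * n : ℕ) : ℝ) ^ β) else 0)‖ ≤
        C * D * (A / √q) * (Nat.log 2 B + 1 : ℕ) := by
  obtain ⟨C, hC0, hC⟩ := type_two_dyadic hβ hβ1 hκ
  refine ⟨C, hC0, ?_⟩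
  intro A B M q hA hBA hq hM hqA hM4 b D hD hb0 hb
  set U : ℕ → Finset ℕ := fun j =>
    (Finset.Icc 1 B).filter (fun n => q ≤ n ∧ Nat.log 2 n = j) with hU
  set F : ℕ → ℕ → ℂ := fun m n => if A < m * n ∧ m * n ≤ B then
        b m * cis (κ * ((m * n : ℕ) : ℝ) ^ β) else 0 with hF
  have hsplit : ∑ m ∈ Finset.Icc 1 B, ∑ n ∈ Finset.Icc 1 B,
      (if A < m * n ∧ m * n ≤ B ∧ q ≤ n then
        b m * cis (κ * ((m * n : ℕ) : ℝ) ^ β) else 0) =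
      ∑ j ∈ Finset.range (Nat.log 2 B + 1), ∑ m ∈ Finset.Icc 1 B, ∑ n ∈ U j, F m n := by
    rw [Finset.sum_comm (s := Finset.range _)]
    refine Finset.sum_congr rfl fun m _ => ?_
    have h1 : ∑ n ∈ Finset.Icc 1 B, (if A < m * n ∧ m * n ≤ B ∧ q ≤ n then
        b m * cis (κ * ((m * n : ℕ) : ℝ) ^ β) else 0) =
        ∑ n ∈ (Finset.Icc 1 B).filter (q ≤ ·), F m n := by
      rw [Finset.sum_filter]
      refine Finset.sum_congr rfl fun n _ => ?_
      simp only [hF]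
      by_cases h : q ≤ n <;> simp [h]
    rw [h1, ← Finset.sum_fiberwise_of_maps_to (t := Finset.range (Nat.log 2 B + 1))
      (g := Nat.log 2)]
    · refine Finset.sum_congr rfl fun j _ => ?_
      rw [hU, Finset.filter_filter]
    · intro n hn
      rw [Finset.mem_range, Nat.lt_succ_iff]
      exact Nat.log_mono_right (Finset.mem_Icc.1 (Finset.mem_filter.1 hn).1).2
  rw [hsplit]
  have hX : 0 ≤ C * D * (A / √q) := by positivity
  have hj : ∀ j ∈ Finset.range (Nat.log 2 B + 1),
      ‖∑ m ∈ Finset.Icc 1 B, ∑ n ∈ U j, F m n‖ ≤ C * D * (A / √q) := by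
    intro j _
    have hUm : ∀ n ∈ U j, 2 ^ j ≤ n ∧ n ≤ 2 * 2 ^ j ∧ q ≤ n := by
      intro n hn
      simp only [hU, Finset.mem_filter, Finset.mem_Icc] at hn
      obtain ⟨h1, h2, h3⟩ := hn
      have h4 := (Nat.log_eq_iff (b := 2) (m := j) (n := n) (Or.inr ⟨by norm_num, by omega⟩)).1 h3
      rw [pow_succ] at h4
      omega
    by_cases hz : 2 ^ j * M ≤ 2 * A ∧ q ≤ 2 * 2 ^ j
    · exact hC A B M q (2 ^ j) hA hBA hq Nat.one_le_two_pow hz.2 hz.1 hM hqA hM4 (U j)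
        (fun n hn => ⟨(hUm n hn).1, (hUm n hn).2.1⟩) b D hD hb
    · rw [Finset.sum_eq_zero, norm_zero]
      · exact hX
      intro m _
      refine Finset.sum_eq_zero fun n hn => ?_
      obtain ⟨h1, h2, h3⟩ := hUm n hn
      simp only [hF]
      split_ifs with h
      · by_cases hm : m ≤ M
        · rw [hb0 m hm, zero_mul]
        · exfalso
          apply hz
          refine ⟨?_, by omega⟩
          calc 2 ^ j * M ≤ n * m := Nat.mul_le_mul h1 (by omega)
            _ = m * n := mul_comm _ _
            _ ≤ _ := h.2.trans hBA
      · rfl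
  calc _ ≤ ∑ j ∈ Finset.range (Nat.log 2 B + 1), C * D * (A / √q) :=
        (norm_sum_le _ _).trans (Finset.sum_le_sum hj)
    _ = _ := by rw [Finset.sum_const, Finset.card_range, nsmul_eq_mul]; ring

theorem HasSum.of_eq {f g : ℕ → ℂ} {a b : ℂ} (h : HasSum f a) (hf : ∀ k, g k = f k) (hb : b = a) :
    HasSum g b := by
  rw [hb, funext hf]
  exact h

theorem hasSum_cos_bernoulli_two {x : ℝ} (hx : x ∈ Set.Icc (0 : ℝ) 1) :
    HasSum (fun n : ℕ => 1 / (n : ℝ) ^ 2 * Real.cos (2 * π * n * x))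
      (π ^ 2 * (x ^ 2 - x + 1 / 6)) := by
  have h := hasSum_one_div_nat_pow_mul_cos one_ne_zero hx
  have hb : Polynomial.eval x (Polynomial.map (algebraMap ℚ ℝ) (Polynomial.bernoulli 2)) =
      x ^ 2 - x + 1 / 6 := by
    rw [Polynomial.bernoulli, Finset.sum_range_succ, Finset.sum_range_succ,
      Finset.sum_range_succ, Finset.sum_range_zero]
    have h2 : _root_.bernoulli 2 = 1 / 6 := by
      rw [bernoulli_eq_bernoulli'_of_ne_one (by decide), bernoulli'_two]
    simp [bernoulli_one, h2]
    ring
  simp only [mul_one] at h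
  rw [hb] at h
  have hc : (-1 : ℝ) ^ (1 + 1) * (2 * π) ^ 2 / 2 / ((Nat.factorial 2 : ℕ) : ℝ) = π ^ 2 := by
    norm_num [Nat.factorial]
    ring
  rw [hc] at h
  exact h

/-- The Euler-Maclaurin formula on a unit interval, with the periodic Bernoulli function expanded
into its Fourier series. -/
theorem hasSum_integral_cos_unit (F F' F'' : ℝ → ℂ) (n : ℕ)
    (h1 : ∀ x ∈ Set.Icc (n : ℝ) (n + 1), HasDerivAt F (F' x) x)
    (h2 : ∀ x ∈ Set.Icc (n : ℝ) (n + 1), HasDerivAt F' (F'' x) x)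
    (h3 : ContinuousOn F'' (Set.Icc (n : ℝ) (n + 1))) :
    HasSum (fun k : ℕ => 2 * ∫ x in (n : ℝ)..(n + 1),
        ((Real.cos (2 * π * (k + 1 : ℕ) * x) : ℝ) : ℂ) * F x)
      ((F n + F (n + 1)) / 2 - ∫ x in (n : ℝ)..(n + 1), F x) := by
  have hle : (n : ℝ) ≤ n + 1 := by linarith
  have hui : Set.uIcc (n : ℝ) (n + 1) = Set.Icc (n : ℝ) (n + 1) := Set.uIcc_of_le hle
  have c1 : ContinuousOn F (Set.Icc (n : ℝ) (n + 1)) := fun x hx => (h1 x hx).continuousAt.continuousWithinAt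
  have c2 : ContinuousOn F' (Set.Icc (n : ℝ) (n + 1)) := fun x hx => (h2 x hx).continuousAt.continuousWithinAt
  have i1 : IntervalIntegrable F volume n (n + 1) := (hui ▸ c1).intervalIntegrable
  have i2 : IntervalIntegrable F' volume n (n + 1) := (hui ▸ c2).intervalIntegrable
  have i3 : IntervalIntegrable F'' volume n (n + 1) := (hui ▸ h3).intervalIntegrable
  set P : ℝ → ℝ := fun x => (x - n) ^ 2 - (x - n) + 1 / 6 with hP
  have dP : ∀ x : ℝ, HasDerivAt (fun x => ((P x : ℝ) : ℂ)) (((2 * (x - n) - 1 : ℝ)) : ℂ) x := by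
    intro x
    refine HasDerivAt.ofReal_comp ?_
    have h := (hasDerivAt_id x).sub_const (n:ℝ)
    refine (((h.pow 2).sub h).add_const (1 / 6 : ℝ)).congr_deriv ?_
    simp
  have dQ : ∀ x : ℝ, HasDerivAt (fun x : ℝ => (((2 * (x - n) - 1 : ℝ)) : ℂ)) (2 : ℂ) x := by
    intro x
    have h := ((((hasDerivAt_id x).sub_const (n:ℝ)).const_mul 2).sub_const 1).ofReal_comp
    exact h.congr_deriv (by norm_num)
  have e1 : ∫ x in (n : ℝ)..(n + 1), ((P x : ℝ) : ℂ) * F'' x =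
      1 / 6 * (F' (n + 1) - F' n) - (F (n + 1) + F n) + 2 * ∫ x in (n : ℝ)..(n + 1), F x := by
    rw [intervalIntegral.integral_mul_deriv_eq_deriv_mul (fun x _ => dP x)
      (fun x hx => h2 x (hui ▸ hx)) (Continuous.intervalIntegrable (by fun_prop) _ _) i3,
      intervalIntegral.integral_mul_deriv_eq_deriv_mul (fun x _ => dQ x)
      (fun x hx => h1 x (hui ▸ hx)) (Continuous.intervalIntegrable (by fun_prop) _ _) i2,
      intervalIntegral.integral_const_mul]
    simp only [hP]
    push_cast
    ring
  have e2 : ∀ k : ℕ, ∫ x in (n : ℝ)..(n + 1), ((Real.cos (2 * π * k * x) : ℝ) : ℂ) * F'' x =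
      (F' (n + 1) - F' n) - 4 * π ^ 2 * k ^ 2 *
        ∫ x in (n : ℝ)..(n + 1), ((Real.cos (2 * π * k * x) : ℝ) : ℂ) * F x := by
    intro k
    have hl : ∀ x : ℝ, HasDerivAt (fun x : ℝ => 2 * π * k * x) (2 * π * k) x := fun x => by
      simpa using (hasDerivAt_id x).const_mul (2 * π * k)
    have dc : ∀ x : ℝ, HasDerivAt (fun x : ℝ => ((Real.cos (2 * π * k * x) : ℝ) : ℂ))
        (((-Real.sin (2 * π * k * x) * (2 * π * k) : ℝ)) : ℂ) x := fun x => (hl x).cos.ofReal_comp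
    have ds : ∀ x : ℝ, HasDerivAt (fun x : ℝ => ((-Real.sin (2 * π * k * x) * (2 * π * k) : ℝ) : ℂ))
        (((-(Real.cos (2 * π * k * x) * (2 * π * k)) * (2 * π * k) : ℝ)) : ℂ) x :=
      fun x => ((hl x).sin.neg.mul_const (2 * π * k)).ofReal_comp
    have v1 : Real.cos (2 * π * k * n) = 1 := by
      rw [show 2 * π * k * n = (k * n : ℕ) * (2 * π) by push_cast; ring]
      exact Real.cos_nat_mul_two_pi _
    have v2 : Real.cos (2 * π * k * (n + 1)) = 1 := by
      rw [show 2 * π * k * (n + 1) = (k * (n + 1) : ℕ) * (2 * π) by push_cast; ring]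
      exact Real.cos_nat_mul_two_pi _
    have v3 : Real.sin (2 * π * k * n) = 0 := by
      rw [show 2 * π * k * n = (2 * k * n : ℕ) * π by push_cast; ring]
      exact Real.sin_nat_mul_pi _
    have v4 : Real.sin (2 * π * k * (n + 1)) = 0 := by
      rw [show 2 * π * k * (n + 1) = (2 * k * (n + 1) : ℕ) * π by push_cast; ring]
      exact Real.sin_nat_mul_pi _
    rw [intervalIntegral.integral_mul_deriv_eq_deriv_mul (fun x _ => dc x)
      (fun x hx => h2 x (hui ▸ hx)) (Continuous.intervalIntegrable (by fun_prop) _ _) i3,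
      intervalIntegral.integral_mul_deriv_eq_deriv_mul (fun x _ => ds x)
      (fun x hx => h1 x (hui ▸ hx)) (Continuous.intervalIntegrable (by fun_prop) _ _) i2,
      v1, v2, v3, v4, ← intervalIntegral.integral_const_mul]
    simp only [neg_zero, zero_mul, ofReal_zero, ofReal_one, one_mul, sub_zero, zero_sub,
      sub_neg_eq_add]
    rw [← sub_eq_zero]
    have : ∀ x : ℝ, (((-(Real.cos (2 * π * k * x) * (2 * π * k)) * (2 * π * k) : ℝ)) : ℂ) * F x =
        -(4 * π ^ 2 * k ^ 2 * (((Real.cos (2 * π * k * x) : ℝ) : ℂ) * F x)) := by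
      intro x; push_cast; ring
    simp only [this, intervalIntegral.integral_neg]
    ring
  have hs : HasSum (fun k : ℕ => ∫ x in (n : ℝ)..(n + 1),
      (((1 / (k : ℝ) ^ 2 * Real.cos (2 * π * k * x) : ℝ)) : ℂ) * F'' x)
      (∫ x in (n : ℝ)..(n + 1), ((π ^ 2 * P x : ℝ) : ℂ) * F'' x) := by
    obtain ⟨K, hK⟩ := isCompact_Icc.exists_bound_of_continuousOn h3
    refine intervalIntegral.hasSum_integral_of_dominated_convergence
      (fun k _ => 1 / (k : ℝ) ^ 2 * K) ?_ ?_ ?_ ?_ ?_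
    · intro k
      refine (ContinuousOn.aestronglyMeasurable ?_ measurableSet_uIoc)
      rw [Set.uIoc_of_le hle]
      exact (Continuous.continuousOn (by fun_prop)).mul (h3.mono Set.Ioc_subset_Icc_self)
    · intro k
      refine ae_of_all _ fun x hx => ?_
      rw [Set.uIoc_of_le hle] at hx
      rw [norm_mul, Complex.norm_real, Real.norm_eq_abs, abs_mul, abs_of_nonneg (by positivity)]
      have hx' := Set.Ioc_subset_Icc_self hx
      have hKx := hK x hx'
      have : |Real.cos (2 * π * k * x)| ≤ 1 := Real.abs_cos_le_one _
      calc _ ≤ 1 / (k:ℝ) ^ 2 * 1 * K := by gcongr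
        _ = _ := by ring
    · exact ae_of_all _ fun x _ => (hasSum_zeta_two.summable).mul_right K
    · exact intervalIntegrable_const
    · refine ae_of_all _ fun x hx => ?_
      rw [Set.uIoc_of_le hle] at hx
      have h := hasSum_cos_bernoulli_two (x := x - n) ⟨by linarith [hx.1], by linarith [hx.2]⟩
      have h' := (Complex.hasSum_ofReal.2 h).mul_right (F'' x)
      refine h'.of_eq (fun k => ?_) rfl
      congr 3
      rw [show 2 * π * k * (x - n) = 2 * π * k * x - (k * n : ℕ) * (2 * π) by push_cast; ring,
        Real.cos_sub_nat_mul_two_pi]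
  have hs2 : HasSum (fun k : ℕ => 1 / (k : ℂ) ^ 2 * (F' (n + 1) - F' n))
      (π ^ 2 / 6 * (F' (n + 1) - F' n)) := by
    have h := (Complex.hasSum_ofReal.2 hasSum_zeta_two).mul_right (F' (n + 1) - F' n)
    refine h.of_eq (fun k => ?_) ?_ <;> push_cast <;> ring
  have hs3 := ((hs2.sub hs).mul_left (1 / (2 * π ^ 2 : ℂ)))
  have hπ : (π : ℂ) ≠ 0 := by exact_mod_cast Real.pi_ne_zero
  have hs4 : HasSum (fun k : ℕ => if k = 0 then 0 else 2 * ∫ x in (n : ℝ)..(n + 1),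
        ((Real.cos (2 * π * k * x) : ℝ) : ℂ) * F x)
      ((F n + F (n + 1)) / 2 - ∫ x in (n : ℝ)..(n + 1), F x) := by
    refine hs3.of_eq (fun k => ?_) ?_
    · have : ∀ x : ℝ, (((1 / (k : ℝ) ^ 2 * Real.cos (2 * π * k * x) : ℝ)) : ℂ) * F'' x =
          1 / (k : ℂ) ^ 2 * (((Real.cos (2 * π * k * x) : ℝ) : ℂ) * F'' x) := by
        intro x; push_cast; ring
      simp only [this, intervalIntegral.integral_const_mul, e2]
      split_ifs with hk
      · simp [hk]
      · have hk' : (k : ℂ) ≠ 0 := by exact_mod_cast hk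
        field_simp
        ring
    · have : ∀ x : ℝ, ((π ^ 2 * P x : ℝ) : ℂ) * F'' x = π ^ 2 * (((P x : ℝ) : ℂ) * F'' x) := by
        intro x; push_cast; ring
      simp only [this, intervalIntegral.integral_const_mul, e1]
      field_simp
      ring
  have hs5 := (hasSum_nat_add_iff' 1).2 hs4
  simpa using hs5

theorem hasSum_integral_cos (F F' F'' : ℝ → ℂ) {a b : ℕ} (hab : a ≤ b)
    (h1 : ∀ x ∈ Set.Icc (a : ℝ) b, HasDerivAt F (F' x) x)
    (h2 : ∀ x ∈ Set.Icc (a : ℝ) b, HasDerivAt F' (F'' x) x)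
    (h3 : ContinuousOn F'' (Set.Icc (a : ℝ) b)) :
    HasSum (fun k : ℕ => 2 * ∫ x in (a : ℝ)..b,
        ((Real.cos (2 * π * (k + 1 : ℕ) * x) : ℝ) : ℂ) * F x)
      (∑ n ∈ Ioc a b, F n - (F b - F a) / 2 - ∫ x in (a : ℝ)..b, F x) := by
  induction b, hab using Nat.le_induction with
  | base => simp [hasSum_zero]
  | succ b hab ih =>
    have hab' : (a : ℝ) ≤ b := by exact_mod_cast hab
    have hs1 : Set.Icc (a : ℝ) b ⊆ Set.Icc (a : ℝ) (b + 1 : ℕ) :=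
      Set.Icc_subset_Icc_right (by push_cast; linarith)
    have hs2 : Set.Icc (b : ℝ) (b + 1) ⊆ Set.Icc (a : ℝ) (b + 1 : ℕ) :=
      Set.Icc_subset_Icc hab' (by push_cast; linarith)
    have hc : ContinuousOn F (Set.Icc (a : ℝ) (b + 1 : ℕ)) :=
      fun x hx => (h1 x hx).continuousAt.continuousWithinAt
    have i1 : ∀ g : ℝ → ℝ, Continuous g →
        IntervalIntegrable (fun x => ((g x : ℝ) : ℂ) * F x) volume a b := fun g hg =>
      ContinuousOn.intervalIntegrable (by
        rw [Set.uIcc_of_le hab']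
        exact (Complex.continuous_ofReal.comp hg).continuousOn.mul (hc.mono hs1))
    have i2 : ∀ g : ℝ → ℝ, Continuous g →
        IntervalIntegrable (fun x => ((g x : ℝ) : ℂ) * F x) volume b (b + 1) := fun g hg =>
      ContinuousOn.intervalIntegrable (by
        rw [Set.uIcc_of_le (by linarith)]
        exact (Complex.continuous_ofReal.comp hg).continuousOn.mul (hc.mono hs2))
    have hF : ∫ x in (a : ℝ)..(b + 1 : ℕ), F x =
        (∫ x in (a : ℝ)..b, F x) + ∫ x in (b : ℝ)..(b + 1), F x := by
      have j1 := i1 (fun _ => 1) continuous_const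
      have j2 := i2 (fun _ => 1) continuous_const
      simp only [ofReal_one, one_mul] at j1 j2
      rw [intervalIntegral.integral_add_adjacent_intervals j1 j2]
      push_cast
      rfl
    have ih' := ih (fun x hx => h1 x (hs1 hx)) (fun x hx => h2 x (hs1 hx)) (h3.mono hs1)
    have hu := hasSum_integral_cos_unit F F' F'' b (fun x hx => h1 x (hs2 hx))
      (fun x hx => h2 x (hs2 hx)) (h3.mono hs2)
    refine (ih'.add hu).of_eq (fun k => ?_) ?_
    · have := intervalIntegral.integral_add_adjacent_intervals
        (i1 (fun x => Real.cos (2 * π * (k + 1 : ℕ) * x)) (by fun_prop))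
        (i2 (fun x => Real.cos (2 * π * (k + 1 : ℕ) * x)) (by fun_prop))
      rw [← mul_add, this]
      push_cast
      rfl
    · rw [hF, ← Finset.insert_Ioc_right_eq_Ioc_add_one hab, Finset.sum_insert (by simp)]
      push_cast
      ring

theorem norm_integral_mul_cis_le {φ φ' G G' : ℝ → ℝ} {a b K : ℝ} (hab : a ≤ b)
    (hφ : ∀ x ∈ Set.Icc a b, HasDerivAt φ (φ' x) x)
    (hG : ∀ x ∈ Set.Icc a b, HasDerivAt G (G' x) x)
    (hφc : ContinuousOn φ' (Set.Icc a b)) (hGc : ContinuousOn G' (Set.Icc a b))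
    (hs : (∀ x ∈ Set.Icc a b, 0 ≤ G' x) ∨ ∀ x ∈ Set.Icc a b, G' x ≤ 0)
    (hK : ∀ x ∈ Set.Icc a b, |G x| ≤ K) :
    ‖∫ x in a..b, ((G x * φ' x : ℝ) : ℂ) * cis (φ x)‖ ≤ 4 * K := by
  have hui := Set.uIcc_of_le hab
  have cφ : ContinuousOn φ (Set.Icc a b) := fun x hx => (hφ x hx).continuousAt.continuousWithinAt
  have ccis : ContinuousOn (fun x => cis (φ x)) (Set.Icc a b) := continuous_cis.comp_continuousOn cφ
  have iG : IntervalIntegrable G' volume a b := (hui ▸ hGc).intervalIntegrable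
  have iGc : IntervalIntegrable (fun x => ((G' x : ℝ) : ℂ)) volume a b := by
    refine ContinuousOn.intervalIntegrable ?_
    rw [hui]
    exact Complex.continuous_ofReal.comp_continuousOn hGc
  have iv : IntervalIntegrable (fun x => (φ' x : ℂ) * I * cis (φ x)) volume a b := by
    refine ContinuousOn.intervalIntegrable ?_
    rw [hui]
    exact ((Complex.continuous_ofReal.comp_continuousOn hφc).mul continuousOn_const).mul ccis
  have e := intervalIntegral.integral_mul_deriv_eq_deriv_mul (u := fun x => ((G x : ℝ) : ℂ))
    (v := fun x => cis (φ x)) (fun x hx => (hG x (hui ▸ hx)).ofReal_comp)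
    (fun x hx => hasDerivAt_cis (hφ x (hui ▸ hx))) iGc iv
  have e2 : ∫ x in a..b, ((G x * φ' x : ℝ) : ℂ) * cis (φ x) =
      -I * ∫ x in a..b, ((G x : ℝ) : ℂ) * ((φ' x : ℂ) * I * cis (φ x)) := by
    rw [← intervalIntegral.integral_const_mul]
    refine intervalIntegral.integral_congr fun x _ => ?_
    push_cast
    linear_combination ((G x : ℂ) * φ' x * cis (φ x)) * I_mul_I
  have ha := hK a ⟨le_rfl, hab⟩
  have hb := hK b ⟨hab, le_rfl⟩
  have hd : ∫ x in a..b, G' x = G b - G a :=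
    intervalIntegral.integral_eq_sub_of_hasDerivAt (fun x hx => hG x (hui ▸ hx)) iG
  have hI : ‖∫ x in a..b, ((G' x : ℝ) : ℂ) * cis (φ x)‖ ≤ 2 * K := by
    have h1 : ‖∫ x in a..b, ((G' x : ℝ) : ℂ) * cis (φ x)‖ ≤ ∫ x in a..b, |G' x| := by
      refine (intervalIntegral.norm_integral_le_integral_norm hab).trans (le_of_eq ?_)
      refine intervalIntegral.integral_congr fun x _ => ?_
      simp [norm_cis]
    refine h1.trans ?_
    rcases hs with hs | hs
    · rw [intervalIntegral.integral_congr (g := G') fun x hx => abs_of_nonneg (hs x (hui ▸ hx)), hd]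
      linarith [abs_le.1 ha, abs_le.1 hb]
    · rw [intervalIntegral.integral_congr (g := fun x => -G' x)
        fun x hx => abs_of_nonpos (hs x (hui ▸ hx)), intervalIntegral.integral_neg, hd]
      linarith [abs_le.1 ha, abs_le.1 hb]
  rw [e2, norm_mul, norm_neg, norm_I, one_mul, e]
  calc _ ≤ ‖((G b : ℝ) : ℂ) * cis (φ b)‖ + ‖((G a : ℝ) : ℂ) * cis (φ a)‖ + 2 * K :=
        (norm_sub_le _ _).trans (add_le_add (norm_sub_le _ _) hI)
    _ ≤ K + K + 2 * K := by
        simp only [norm_mul, norm_cis, mul_one, Complex.norm_real, Real.norm_eq_abs]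
        linarith
    _ = _ := by ring

theorem norm_integral_cis_le {φ L L' : ℝ → ℝ} {a b c δ : ℝ} (hab : a ≤ b) (hδ : 0 < δ)
    (hφ : ∀ x ∈ Set.Icc a b, HasDerivAt φ (L x + c) x)
    (hL : ∀ x ∈ Set.Icc a b, HasDerivAt L (L' x) x)
    (hLc : ContinuousOn L' (Set.Icc a b)) (hs : ∀ x ∈ Set.Icc a b, L' x ≤ 0)
    (h : ∀ x ∈ Set.Icc a b, δ ≤ |L x + c|) :
    ‖∫ x in a..b, cis (φ x)‖ ≤ 4 / δ := by
  have h0 : ∀ x ∈ Set.Icc a b, L x + c ≠ 0 := fun x hx h0 => by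
    have := h x hx
    rw [h0, abs_zero] at this
    linarith
  have cL : ContinuousOn (fun x => L x + c) (Set.Icc a b) :=
    fun x hx => ((hL x hx).add_const c).continuousAt.continuousWithinAt
  have hm := norm_integral_mul_cis_le (φ := φ) (φ' := fun x => L x + c) (G := fun x => (L x + c)⁻¹)
    (G' := fun x => -L' x / (L x + c) ^ 2) (K := 1 / δ) hab hφ
    (fun x hx => ((hL x hx).add_const c).inv (h0 x hx)) cL
    (hLc.neg.div (cL.pow 2) fun x hx => pow_ne_zero 2 (h0 x hx))
    (Or.inl fun x hx => div_nonneg (by linarith [hs x hx]) (by positivity))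
    (fun x hx => by
      rw [abs_inv, ← one_div]
      exact one_div_le_one_div_of_le hδ (h x hx))
  rw [intervalIntegral.integral_congr (g := fun x => cis (φ x)) fun x hx => by
    rw [Set.uIcc_of_le hab] at hx
    simp [inv_mul_cancel₀ (h0 x hx)]] at hm
  calc _ ≤ 4 * (1 / δ) := hm
    _ = _ := by ring

theorem norm_integral_mul_cis_le_of_deriv {φ L L' : ℝ → ℝ} {a b c K : ℝ} (hab : a ≤ b)
    (hφ : ∀ x ∈ Set.Icc a b, HasDerivAt φ (L x + c) x)
    (hL : ∀ x ∈ Set.Icc a b, HasDerivAt L (L' x) x)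
    (hLc : ContinuousOn L' (Set.Icc a b)) (hs : ∀ x ∈ Set.Icc a b, L' x ≤ 0)
    (h0 : ∀ x ∈ Set.Icc a b, L x + c ≠ 0) (hK : ∀ x ∈ Set.Icc a b, |L x / (L x + c)| ≤ K) :
    ‖∫ x in a..b, (L x : ℂ) * cis (φ x)‖ ≤ 4 * K := by
  have cL' : ContinuousOn (fun x => L x + c) (Set.Icc a b) :=
    fun x hx => ((hL x hx).add_const c).continuousAt.continuousWithinAt
  have hm := norm_integral_mul_cis_le (φ := φ) (φ' := fun x => L x + c) (G := fun x => L x / (L x + c))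
    (G' := fun x => c * L' x / (L x + c) ^ 2) (K := K) hab hφ
    (fun x hx => ((hL x hx).div ((hL x hx).add_const c) (h0 x hx)).congr_deriv (by ring)) cL'
    ((continuousOn_const.mul hLc).div (cL'.pow 2) fun x hx => pow_ne_zero 2 (h0 x hx))
    (by
      rcases le_total 0 c with hc | hc
      · exact Or.inr fun x hx => div_nonpos_of_nonpos_of_nonneg
          (mul_nonpos_of_nonneg_of_nonpos hc (hs x hx)) (by positivity)
      · exact Or.inl fun x hx => div_nonneg (mul_nonneg_of_nonpos_of_nonpos hc (hs x hx))
          (by positivity)) hK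
  rwa [intervalIntegral.integral_congr (g := fun x => (L x : ℂ) * cis (φ x)) fun x hx => by
    rw [Set.uIcc_of_le hab] at hx
    simp only [div_mul_cancel₀ _ (h0 x hx)]] at hm

theorem two_mul_cos_mul_cis (ω y : ℝ) :
    2 * (((Real.cos ω : ℝ) : ℂ) * cis y) = cis (y - ω) + cis (y + ω) := by
  rw [cis_sub, cis_add, conj_cis, cis_eq, cis_eq, cis_eq]
  simp only [Real.cos_neg, Real.sin_neg]
  push_cast
  ring

theorem two_mul_I_mul_sin_mul_cis (ω y : ℝ) :
    2 * I * (((Real.sin ω : ℝ) : ℂ) * cis y) = cis (y + ω) - cis (y - ω) := by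
  rw [cis_sub, cis_add, conj_cis, cis_eq, cis_eq, cis_eq]
  simp only [Real.cos_neg, Real.sin_neg]
  push_cast
  ring

theorem hasSum_telescope {x : ℝ} (hx : 0 < x) :
    HasSum (fun k : ℕ => x / ((x + k) * (x + k + 1))) 1 := by
  have h : ∀ k : ℕ, x / ((x + k) * (x + k + 1)) = x / (x + k) - x / (x + (k + 1 : ℕ)) := by
    intro k
    push_cast
    field_simp
    ring
  rw [hasSum_iff_tendsto_nat_of_nonneg (fun k => by positivity)]
  simp only [h, Finset.sum_range_sub']
  have h1 : Tendsto (fun n : ℕ => x / (x + n)) atTop (nhds 0) :=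
    tendsto_const_nhds.div_atTop (tendsto_atTop_add_const_left _ _ tendsto_natCast_atTop_atTop)
  have h2 := h1.const_sub (x / (x + (0 : ℕ)))
  simpa [hx.ne'] using h2

section Frequency

variable {f L L' : ℝ → ℝ} {a b l₁ l₂ : ℝ}

theorem integrable_cis_add (h1 : ∀ x ∈ Set.Icc a b, HasDerivAt f (L x) x) (hab : a ≤ b) (c : ℝ) :
    IntervalIntegrable (fun x => cis (f x + c * x)) volume a b := by
  refine ContinuousOn.intervalIntegrable ?_
  rw [Set.uIcc_of_le hab]
  refine continuous_cis.comp_continuousOn (ContinuousOn.add ?_ (by fun_prop))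
  exact fun x hx => (h1 x hx).continuousAt.continuousWithinAt

theorem two_mul_integral_cos (h1 : ∀ x ∈ Set.Icc a b, HasDerivAt f (L x) x) (hab : a ≤ b) (ω : ℝ) :
    2 * ∫ x in a..b, ((Real.cos (ω * x) : ℝ) : ℂ) * cis (f x) =
      (∫ x in a..b, cis (f x + -ω * x)) + ∫ x in a..b, cis (f x + ω * x) := by
  rw [← intervalIntegral.integral_const_mul, ← intervalIntegral.integral_add
    (integrable_cis_add h1 hab _) (integrable_cis_add h1 hab _)]
  refine intervalIntegral.integral_congr fun x _ => ?_
  simp only [two_mul_cos_mul_cis, neg_mul, ← sub_eq_add_neg]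

theorem norm_integral_cis_add_le (hab : a ≤ b) (hl : 0 < l₁)
    (h1 : ∀ x ∈ Set.Icc a b, HasDerivAt f (L x) x)
    (h2 : ∀ x ∈ Set.Icc a b, HasDerivAt L (L' x) x) (hc : ContinuousOn L' (Set.Icc a b))
    (hs : ∀ x ∈ Set.Icc a b, L' x ≤ 0) (hL : ∀ x ∈ Set.Icc a b, l₁ ≤ L x ∧ L x ≤ l₂)
    {ω : ℝ} (hω : 0 ≤ ω) :
    ‖∫ x in a..b, cis (f x + ω * x)‖ ≤ 4 / l₁ := by
  refine norm_integral_cis_le (c := ω) hab hl (fun x hx => ?_) h2 hc hs fun x hx => ?_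
  · exact (h1 x hx).add (((hasDerivAt_id x).const_mul ω).congr_deriv (mul_one _))
  · rw [abs_of_nonneg] <;> linarith [(hL x hx).1]

theorem norm_integral_cis_sub_le (hab : a ≤ b) (hl : 0 < l₁)
    (h1 : ∀ x ∈ Set.Icc a b, HasDerivAt f (L x) x)
    (h2 : ∀ x ∈ Set.Icc a b, HasDerivAt L (L' x) x) (hc : ContinuousOn L' (Set.Icc a b))
    (hs : ∀ x ∈ Set.Icc a b, L' x ≤ 0) (hL : ∀ x ∈ Set.Icc a b, l₁ ≤ L x ∧ L x ≤ l₂)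
    {ω ρ : ℝ} (hρ : 1 < ρ) (hω : ρ * ω ≤ l₁) :
    ‖∫ x in a..b, cis (f x + -ω * x)‖ ≤ 4 * (ρ / (ρ - 1)) / l₁ := by
  have hρ' : 0 < ρ - 1 := by linarith
  have e : 4 * (ρ / (ρ - 1)) / l₁ = 4 / (l₁ * ((ρ - 1) / ρ)) := by
    field_simp
  rw [e]
  have hw : ω ≤ l₁ / ρ := by rw [le_div_iff₀ (by linarith)]; linarith
  have hw' : l₁ * ((ρ - 1) / ρ) = l₁ - l₁ / ρ := by field_simp
  refine norm_integral_cis_le (c := -ω) hab (by positivity) (fun x hx => ?_) h2 hc hs fun x hx => ?_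
  · exact (h1 x hx).add (((hasDerivAt_id x).const_mul (-ω)).congr_deriv (mul_one _))
  · exact (le_abs_self _).trans' (by linarith [(hL x hx).1])

theorem norm_two_mul_integral_cos_le (hab : a ≤ b) (hl : 0 < l₁)
    (h1 : ∀ x ∈ Set.Icc a b, HasDerivAt f (L x) x)
    (h2 : ∀ x ∈ Set.Icc a b, HasDerivAt L (L' x) x) (hc : ContinuousOn L' (Set.Icc a b))
    (hs : ∀ x ∈ Set.Icc a b, L' x ≤ 0) (hL : ∀ x ∈ Set.Icc a b, l₁ ≤ L x ∧ L x ≤ l₂)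
    {ω ρ : ℝ} (hρ : 1 < ρ) (hω : ρ * l₂ ≤ ω)
    (ha : Real.sin (ω * a) = 0) (hb : Real.sin (ω * b) = 0) :
    ‖2 * ∫ x in a..b, ((Real.cos (ω * x) : ℝ) : ℂ) * cis (f x)‖ ≤ 8 * (ρ / (ρ - 1)) * l₂ / ω ^ 2 := by
  have hρ' : 0 < ρ - 1 := by linarith
  have hl2 : 0 < l₂ := by linarith [hL a ⟨le_rfl, hab⟩]
  have hω0 : 0 < ω := lt_of_lt_of_le (by positivity) hω
  have hlω : l₂ ≤ ω / ρ := by rw [le_div_iff₀ (by linarith)]; linarith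
  have hωl : ω * ((ρ - 1) / ρ) = ω - ω / ρ := by field_simp
  have hui := Set.uIcc_of_le hab
  have cf : ContinuousOn (fun x => cis (f x)) (Set.Icc a b) := continuous_cis.comp_continuousOn
    fun x hx => (h1 x hx).continuousAt.continuousWithinAt
  have cL : ContinuousOn L (Set.Icc a b) := fun x hx => (h2 x hx).continuousAt.continuousWithinAt
  have hwx : ∀ x : ℝ, HasDerivAt (fun x => ω * x) ω x := fun x =>
    ((hasDerivAt_id x).const_mul ω).congr_deriv (mul_one _)
  have e := intervalIntegral.integral_mul_deriv_eq_deriv_mul (a := a) (b := b)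
    (u := fun x => cis (f x)) (v := fun x => ((Real.sin (ω * x) : ℝ) : ℂ))
    (fun x hx => hasDerivAt_cis (h1 x (hui ▸ hx))) (fun x _ => ((hwx x).sin).ofReal_comp)
    (ContinuousOn.intervalIntegrable (by
      rw [hui]
      exact ((Complex.continuous_ofReal.comp_continuousOn cL).mul continuousOn_const).mul cf))
    (Continuous.intervalIntegrable (by fun_prop) _ _)
  simp only [ha, hb, ofReal_zero, mul_zero, sub_zero, zero_sub] at e
  have ii : ∀ c : ℝ, IntervalIntegrable (fun x => (L x : ℂ) * cis (f x + c * x)) volume a b := by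
    intro c
    refine ContinuousOn.intervalIntegrable ?_
    rw [hui]
    refine (Complex.continuous_ofReal.comp_continuousOn cL).mul (continuous_cis.comp_continuousOn
      (ContinuousOn.add (fun x hx => (h1 x hx).continuousAt.continuousWithinAt) (by fun_prop)))
  have e2 : 2 * ∫ x in a..b, ((Real.cos (ω * x) : ℝ) : ℂ) * cis (f x) =
      -(1 / ω : ℂ) * ((∫ x in a..b, (L x : ℂ) * cis (f x + ω * x)) -
        ∫ x in a..b, (L x : ℂ) * cis (f x + -ω * x)) := by
    have hωc : (ω : ℂ) ≠ 0 := by exact_mod_cast hω0.ne'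
    have e3 : ∫ x in a..b, ((Real.cos (ω * x) : ℝ) : ℂ) * cis (f x) = (1 / ω : ℂ) *
        ∫ x in a..b, cis (f x) * ((Real.cos (ω * x) * ω : ℝ) : ℂ) := by
      rw [← intervalIntegral.integral_const_mul]
      refine intervalIntegral.integral_congr fun x _ => ?_
      push_cast
      field_simp
    rw [e3, e, ← intervalIntegral.integral_sub (ii _) (ii _)]
    have : ∀ x : ℝ, (L x : ℂ) * cis (f x + ω * x) - (L x : ℂ) * cis (f x + -ω * x) =
        2 * ((L x : ℂ) * I * cis (f x) * ((Real.sin (ω * x) : ℝ) : ℂ)) := by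
      intro x
      rw [neg_mul, ← sub_eq_add_neg, ← mul_sub, ← two_mul_I_mul_sin_mul_cis]
      ring
    simp only [this, intervalIntegral.integral_const_mul]
    ring
  have b1 : ‖∫ x in a..b, (L x : ℂ) * cis (f x + ω * x)‖ ≤ 4 * ((ρ / (ρ - 1)) * l₂ / ω) := by
    refine norm_integral_mul_cis_le_of_deriv (c := ω) hab (fun x hx => (h1 x hx).add (hwx x))
      h2 hc hs (fun x hx => by linarith [hL x hx]) fun x hx => ?_
    have := hL x hx
    have hp : 1 ≤ ρ / (ρ - 1) := by rw [le_div_iff₀ hρ']; linarith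
    rw [abs_of_nonneg (div_nonneg (by linarith) (by linarith))]
    gcongr ?_ / ?_
    · nlinarith
    · linarith
  have b2 : ‖∫ x in a..b, (L x : ℂ) * cis (f x + -ω * x)‖ ≤ 4 * ((ρ / (ρ - 1)) * l₂ / ω) := by
    have hlt : ∀ x ∈ Set.Icc a b, L x + -ω ≤ -(ω * ((ρ - 1) / ρ)) := fun x hx => by
      linarith [hL x hx]
    have hpos : 0 < ω * ((ρ - 1) / ρ) := by positivity
    refine norm_integral_mul_cis_le_of_deriv (c := -ω) hab (fun x hx => (h1 x hx).add
      (((hasDerivAt_id x).const_mul (-ω)).congr_deriv (mul_one _)))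
      h2 hc hs (fun x hx => by linarith [hlt x hx]) fun x hx => ?_
    have := hL x hx
    have e4 : (ρ / (ρ - 1)) * l₂ / ω = l₂ / (ω * ((ρ - 1) / ρ)) := by field_simp
    rw [e4, abs_div, abs_of_nonneg (by linarith : (0:ℝ) ≤ L x), abs_of_nonpos (by linarith [hlt x hx])]
    gcongr ?_ / ?_
    · exact this.2
    · linarith [hlt x hx]
  rw [e2, norm_mul]
  have : ‖-(1 / ω : ℂ)‖ = 1 / ω := by
    rw [norm_neg, norm_div, norm_one, Complex.norm_real, Real.norm_eq_abs, abs_of_pos hω0]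
  rw [this]
  calc _ ≤ 1 / ω * (4 * ((ρ / (ρ - 1)) * l₂ / ω) + 4 * ((ρ / (ρ - 1)) * l₂ / ω)) := by
        gcongr
        exact (norm_sub_le _ _).trans (add_le_add b1 b2)
    _ = _ := by
        field_simp
        ring

end Frequency

/-- Truncated Poisson summation for an exponential sum with monotone phase derivative. -/
theorem poisson_truncated {ρ H : ℝ} (hρ : 1 < ρ) (hH : 1 ≤ H) :
    ∃ C > 0, ∀ (f L L' : ℝ → ℝ) (a b : ℕ) (l₁ l₂ : ℝ) (N : Finset ℕ), a ≤ b → 0 < l₁ → l₂ ≤ H * l₁ →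
      (∀ x ∈ Set.Icc (a : ℝ) b, HasDerivAt f (L x) x) →
      (∀ x ∈ Set.Icc (a : ℝ) b, HasDerivAt L (L' x) x) →
      ContinuousOn L' (Set.Icc (a : ℝ) b) → (∀ x ∈ Set.Icc (a : ℝ) b, L' x ≤ 0) →
      (∀ x ∈ Set.Icc (a : ℝ) b, l₁ ≤ L x ∧ L x ≤ l₂) →
      (∀ ν ∈ N, 1 ≤ ν ∧ (ν : ℝ) ≤ H * l₁) →
      (∀ ν : ℕ, 1 ≤ ν → ν ∉ N → ρ * (2 * π * ν) ≤ l₁ ∨ ρ * l₂ ≤ 2 * π * ν) →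
      ‖∑ n ∈ Ioc a b, cis (f n) - ∑ ν ∈ N, ∫ x in (a : ℝ)..b, cis (f x + -(2 * π * ν) * x)‖ ≤
        C * (1 + 1 / l₁) := by
  have hρ' : 0 < ρ - 1 := by linarith
  set c := ρ / (ρ - 1) with hcdef
  have hc1 : 1 ≤ c := by rw [hcdef, le_div_iff₀ hρ']; linarith
  set C₁ := 64 * c * (1 + H) ^ 2 with hC₁
  have hC₁0 : 0 < C₁ := by positivity
  refine ⟨C₁ + 5, by positivity, ?_⟩
  intro f L L' a b l₁ l₂ N hab hl hl2 h1 h2 hc hs hL hN hN'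
  have hab' : (a : ℝ) ≤ b := by exact_mod_cast hab
  have hl12 : l₁ ≤ l₂ := by linarith [hL a ⟨le_rfl, hab'⟩]
  have cL : ContinuousOn L (Set.Icc (a : ℝ) b) :=
    fun x hx => (h2 x hx).continuousAt.continuousWithinAt
  have cf : ContinuousOn (fun x => cis (f x)) (Set.Icc (a : ℝ) b) :=
    continuous_cis.comp_continuousOn fun x hx => (h1 x hx).continuousAt.continuousWithinAt
  have hsum := hasSum_integral_cos (fun x => cis (f x)) (fun x => (L x : ℂ) * I * cis (f x))
    (fun x => (L' x : ℂ) * I * cis (f x) + (L x : ℂ) * I * ((L x : ℂ) * I * cis (f x))) hab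
    (fun x hx => hasDerivAt_cis (h1 x hx))
    (fun x hx => (((h2 x hx).ofReal_comp).mul_const I).mul (hasDerivAt_cis (h1 x hx)))
    (by
      have c1 := Complex.continuous_ofReal.comp_continuousOn hc
      have c2 := Complex.continuous_ofReal.comp_continuousOn cL
      exact ((c1.mul continuousOn_const).mul cf).add ((c2.mul continuousOn_const).mul
        ((c2.mul continuousOn_const).mul cf)))
  set X : ℕ → ℂ := fun ν => ∫ x in (a : ℝ)..b, cis (f x + -(2 * π * ν) * x) with hX
  have hsumN : HasSum (fun k : ℕ => if k + 1 ∈ N then X (k + 1) else 0) (∑ ν ∈ N, X ν) := by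
    have hh : HasSum (fun ν : ℕ => if ν ∈ N then X ν else 0) (∑ ν ∈ N, X ν) := by
      have := hasSum_sum_of_ne_finset_zero (L := SummationFilter.unconditional ℕ) (f := fun ν : ℕ => if ν ∈ N then X ν else 0) (s := N)
        (fun ν hν => if_neg hν)
      rwa [Finset.sum_congr rfl fun ν hν => if_pos hν] at this
    have h0 : (0 : ℕ) ∉ N := fun h => by simpa using (hN 0 h).1
    have := (hasSum_nat_add_iff' 1).2 hh
    simpa [h0] using this
  have hbd : ∀ k : ℕ, ‖2 * (∫ x in (a : ℝ)..b, ((Real.cos (2 * π * (k + 1 : ℕ) * x) : ℝ) : ℂ) *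
      cis (f x)) - (if k + 1 ∈ N then X (k + 1) else 0)‖ ≤
      C₁ * (l₁ / ((l₁ + k) * (l₁ + k + 1))) := by
    intro k
    set ν : ℕ := k + 1 with hν
    have hν1 : 1 ≤ ν := by omega
    have hν1' : (1 : ℝ) ≤ ν := by exact_mod_cast hν1
    have hkν : (k : ℝ) + 1 = ν := by rw [hν]; push_cast; ring
    have hω : 0 ≤ 2 * π * (ν : ℝ) := by positivity
    have hplus := norm_integral_cis_add_le hab' hl h1 h2 hc hs hL hω
    have htwo := two_mul_integral_cos h1 hab' (2 * π * ν)
    -- lower bound of the majorant for frequencies of size `l₁`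
    have hmaj : ∀ K : ℝ, 0 < K → l₁ + ν ≤ K → l₁ / K ^ 2 ≤ l₁ / ((l₁ + k) * (l₁ + k + 1)) := by
      intro K hK h
      have hk0 : (0 : ℝ) ≤ k := Nat.cast_nonneg k
      gcongr
      rw [pow_two]
      gcongr <;> linarith
    by_cases hmem : ν ∈ N
    · rw [if_pos hmem, htwo, add_sub_cancel_left]
      refine hplus.trans ?_
      have h := hmaj ((1 + H) * l₁) (by positivity) (by linarith [(hN ν hmem).2])
      refine le_trans ?_ (mul_le_mul_of_nonneg_left h hC₁0.le)
      have : C₁ * (l₁ / ((1 + H) * l₁) ^ 2) = 64 * c / l₁ := by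
        rw [hC₁]; field_simp
      rw [this]
      gcongr
      linarith
    · rw [if_neg hmem, sub_zero]
      rcases hN' ν hν1 hmem with h | h
      · rw [htwo]
        have hminus := norm_integral_cis_sub_le hab' hl h1 h2 hc hs hL hρ h
        have hνl : (ν : ℝ) ≤ l₁ := by
          have := Real.pi_gt_three
          nlinarith [mul_nonneg (by linarith : (0:ℝ) ≤ ρ - 1) hω]
        have h := hmaj (2 * l₁) (by positivity) (by linarith)
        refine le_trans ?_ (mul_le_mul_of_nonneg_left h hC₁0.le)
        calc _ ≤ 4 * c / l₁ + 4 / l₁ := (norm_add_le _ _).trans (add_le_add hminus hplus)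
          _ = (4 * c + 4) * (1 / l₁) := by ring
          _ ≤ (16 * c * (1 + H) ^ 2) * (1 / l₁) := by
              gcongr
              nlinarith [mul_nonneg (by linarith : (0:ℝ) ≤ c) (by positivity : (0:ℝ) ≤ H ^ 2 + 2 * H)]
          _ = C₁ * (l₁ / (2 * l₁) ^ 2) := by
              rw [hC₁]
              field_simp
              ring
      · have hz : ∀ n : ℕ, Real.sin (2 * π * ν * n) = 0 := by
          intro n
          rw [show 2 * π * (ν : ℝ) * n = (2 * ν * n : ℕ) * π by push_cast; ring]
          exact Real.sin_nat_mul_pi _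
        have hbig := norm_two_mul_integral_cos_le hab' hl h1 h2 hc hs hL hρ h (hz a) (hz b)
        have hl7 : l₁ ≤ 7 * ν := by
          have := Real.pi_lt_d2
          nlinarith [mul_pos (by linarith : (0:ℝ) < ρ - 1) (by linarith : (0:ℝ) < l₂)]
        have hm := hmaj (8 * ν) (by positivity) (by linarith)
        refine le_trans ?_ (mul_le_mul_of_nonneg_left hm hC₁0.le)
        refine hbig.trans ?_
        have hp := Real.pi_gt_three
        calc 8 * c * l₂ / (2 * π * ν) ^ 2 = (8 / (2 * π) ^ 2) * c * l₂ / ν ^ 2 := by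
              field_simp
          _ ≤ 1 * c * (H * l₁) / ν ^ 2 := by
              have : 8 / (2 * π) ^ 2 ≤ 1 := by
                rw [div_le_one (by positivity)]
                nlinarith
              have hl0 : 0 ≤ l₂ := by linarith
              gcongr
          _ ≤ c * ((1 + H) ^ 2 * l₁) / ν ^ 2 := by
              rw [one_mul]
              gcongr
              nlinarith
          _ = C₁ * (l₁ / (8 * ν) ^ 2) := by
              rw [hC₁]
              field_simp
              ring
  have hfin : ‖(∑ n ∈ Ioc a b, cis (f n) - (cis (f b) - cis (f a)) / 2 -
      ∫ x in (a : ℝ)..b, cis (f x)) - ∑ ν ∈ N, X ν‖ ≤ C₁ := by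
    have hs' := hsum.sub hsumN
    have hM := (hasSum_telescope hl).mul_left C₁
    rw [mul_one] at hM
    have := tsum_of_norm_bounded hM hbd
    rwa [hs'.tsum_eq] at this
  have h0 : ‖∫ x in (a : ℝ)..b, cis (f x)‖ ≤ 4 / l₁ := by
    have := norm_integral_cis_add_le hab' hl h1 h2 hc hs hL le_rfl
    simpa using this
  have he : ‖(cis (f b) - cis (f a)) / 2‖ ≤ 1 := by
    rw [norm_div, Complex.norm_two, div_le_one (by norm_num)]
    exact (norm_sub_le _ _).trans (by rw [norm_cis, norm_cis]; norm_num)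
  have hsplit : ∑ n ∈ Ioc a b, cis (f n) - ∑ ν ∈ N, X ν =
      ((∑ n ∈ Ioc a b, cis (f n) - (cis (f b) - cis (f a)) / 2 -
      ∫ x in (a : ℝ)..b, cis (f x)) - ∑ ν ∈ N, X ν) + ((cis (f b) - cis (f a)) / 2 +
      ∫ x in (a : ℝ)..b, cis (f x)) := by ring
  rw [hsplit]
  calc _ ≤ C₁ + (1 + 4 / l₁) := (norm_add_le _ _).trans (add_le_add hfin
        ((norm_add_le _ _).trans (add_le_add he h0)))
    _ ≤ (C₁ + 5) * (1 + 1 / l₁) := by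
        have : 0 < 1 / l₁ := by positivity
        have e : 4 / l₁ = 4 * (1 / l₁) := by ring
        rw [e]
        nlinarith

theorem integral_cis_int_mul (k : ℤ) (a : ℕ) :
    ∫ x in (a : ℝ)..(a + 1), cis (2 * π * k * x) = if k = 0 then 1 else 0 := by
  split_ifs with hk
  · simp [hk, cis]
  · have hc : (2 * π * k * I : ℂ) ≠ 0 := by
      have := Real.pi_ne_zero
      simp [hk, this]
    have h := integral_exp_mul_complex (a := a) (b := a + 1) hc
    have e : ∀ x : ℝ, cis (2 * π * k * x) = Complex.exp (2 * π * k * I * x) := by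
      intro x
      rw [cis]
      congr 1
      push_cast
      ring
    simp only [e]
    rw [h]
    have e2 : Complex.exp (2 * π * k * I * ((a + 1 : ℝ) : ℂ)) =
        Complex.exp (2 * π * k * I * ((a : ℝ) : ℂ)) := by
      rw [show (2 * π * k * I * ((a + 1 : ℝ) : ℂ)) = 2 * π * k * I * ((a : ℝ) : ℂ) + k * (2 * π * I) by
        push_cast; ring, Complex.exp_add, Complex.exp_int_mul_two_pi_mul_I, mul_one]
    rw [e2, sub_self, zero_div]

theorem integral_norm_sq_sum_cis (N : Finset ℕ) (a : ℕ) :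
    ∫ x in (a : ℝ)..(a + 1), ‖∑ ν ∈ N, cis (-(2 * π * ν) * x)‖ ^ 2 = N.card := by
  have h : ∀ x : ℝ, ((‖∑ ν ∈ N, cis (-(2 * π * ν) * x)‖ ^ 2 : ℝ) : ℂ) =
      ∑ ν ∈ N, ∑ μ ∈ N, cis (2 * π * ((μ - ν : ℤ) : ℝ) * x) := by
    intro x
    push_cast
    rw [← Complex.mul_conj', map_sum, Finset.sum_mul_sum]
    refine Finset.sum_congr rfl fun ν _ => Finset.sum_congr rfl fun μ _ => ?_
    rw [← cis_sub]
    congr 1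
    ring
  have hc : ∫ x in (a : ℝ)..(a + 1), ((‖∑ ν ∈ N, cis (-(2 * π * ν) * x)‖ ^ 2 : ℝ) : ℂ) = N.card := by
    simp only [h]
    have hint : ∀ k : ℤ, IntervalIntegrable (fun x => cis (2 * π * k * x)) volume a (a + 1) :=
      fun k => (continuous_cis.comp (by fun_prop)).intervalIntegrable _ _
    have hint2 : ∀ ν ∈ N, IntervalIntegrable
        (fun x => ∑ μ ∈ N, cis (2 * π * ((μ - ν : ℤ) : ℝ) * x)) volume a (a + 1) := fun ν _ =>
      (continuous_finsetSum _ fun μ _ => continuous_cis.comp (by fun_prop)).intervalIntegrable _ _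
    rw [intervalIntegral.integral_finsetSum hint2]
    rw [Finset.sum_congr rfl fun ν hν => show _ = (1 : ℂ) from ?_]
    · simp
    · rw [intervalIntegral.integral_finsetSum fun μ _ => hint _]
      simp only [integral_cis_int_mul, sub_eq_zero, Nat.cast_inj]
      simp [hν]
  rw [intervalIntegral.integral_ofReal] at hc
  exact_mod_cast hc

theorem norm_sum_integral_cis_le {f : ℝ → ℝ} (hf : Continuous f) (N : Finset ℕ) (a : ℕ) {t : ℝ}
    (h1 : (a : ℝ) ≤ t) (h2 : t ≤ a + 1) :
    ‖∑ ν ∈ N, ∫ x in (a : ℝ)..t, cis (f x + -(2 * π * ν) * x)‖ ≤ √N.card := by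
  set D : ℝ → ℂ := fun x => ∑ ν ∈ N, cis (-(2 * π * ν) * x) with hD
  have cD : Continuous D := continuous_finsetSum _ fun ν _ => continuous_cis.comp (by fun_prop)
  have e : ∑ ν ∈ N, ∫ x in (a : ℝ)..t, cis (f x + -(2 * π * ν) * x) =
      ∫ x in (a : ℝ)..t, cis (f x) * D x := by
    have hi : ∀ ν ∈ N, IntervalIntegrable (fun x => cis (f x + -(2 * π * ν) * x)) volume a t :=
      fun ν _ => (continuous_cis.comp (by fun_prop)).intervalIntegrable _ _
    rw [← intervalIntegral.integral_finsetSum hi]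
    simp only [hD, Finset.mul_sum, cis_add]
  rw [e]
  rcases N.eq_empty_or_nonempty with rfl | hN
  · simp [hD]
  have hs : 0 < √(N.card : ℝ) := Real.sqrt_pos.2 (by exact_mod_cast hN.card_pos)
  set s := √(N.card : ℝ) with hsdef
  calc ‖∫ x in (a : ℝ)..t, cis (f x) * D x‖ ≤ ∫ x in (a : ℝ)..t, ‖D x‖ := by
        refine (intervalIntegral.norm_integral_le_integral_norm h1).trans (le_of_eq ?_)
        simp only [norm_mul, norm_cis, one_mul]
    _ ≤ ∫ x in (a : ℝ)..(a + 1), ‖D x‖ :=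
        intervalIntegral.integral_mono_interval le_rfl h1 h2
          (Eventually.of_forall fun x => norm_nonneg _) (cD.norm.intervalIntegrable _ _)
    _ ≤ ∫ x in (a : ℝ)..(a + 1), (1 / (2 * s) * ‖D x‖ ^ 2 + s / 2) := by
        refine intervalIntegral.integral_mono_on (by linarith) (cD.norm.intervalIntegrable _ _)
          (Continuous.intervalIntegrable (by fun_prop) _ _) fun x _ => ?_
        have : 1 / (2 * s) * ‖D x‖ ^ 2 + s / 2 - ‖D x‖ = 1 / (2 * s) * (‖D x‖ - s) ^ 2 := by
          field_simp
          ring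
        have : 0 ≤ 1 / (2 * s) * (‖D x‖ - s) ^ 2 := by positivity
        linarith
    _ = s := by
        rw [intervalIntegral.integral_add (Continuous.intervalIntegrable (by fun_prop) _ _)
          intervalIntegrable_const, intervalIntegral.integral_const_mul,
          integral_norm_sq_sum_cis]
        have : (N.card : ℝ) = s * s := (Real.mul_self_sqrt (Nat.cast_nonneg _)).symm
        rw [this, intervalIntegral.integral_const]
        simp only [add_sub_cancel_left, one_smul]
        field_simp
        ring

theorem poisson_rpow {β κ r : ℝ} (hβ : 0 < β) (hβ1 : β < 1) (hκ : κ * β = 1) (hr : 1 < r) :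
    ∃ C > 0, ∀ (A B m : ℕ) (N : Finset ℕ), 1 ≤ m → 1 ≤ A → (m : ℝ) * r ≤ (r - 1) * A → A ≤ B →
      (B : ℝ) ≤ r ^ 2 * A → (∀ ν ∈ N, 1 ≤ ν ∧ (ν : ℝ) ≤ m * (A : ℝ) ^ (β - 1)) →
      (∀ ν : ℕ, 1 ≤ ν → ν ∉ N → r ^ 4 * (2 * π * ν) ≤ m * (A : ℝ) ^ (β - 1) ∨
        r ^ 2 * (m * (A : ℝ) ^ (β - 1)) ≤ 2 * π * ν) →
      ‖∑ n ∈ Ioc (A / m) (B / m), cis (κ * ((m * n : ℕ) : ℝ) ^ β) -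
        ∑ ν ∈ N, ∫ x in ((A : ℝ) / m)..((B : ℝ) / m), cis (κ * (m * x) ^ β + -(2 * π * ν) * x)‖ ≤
        C * (1 + 1 / (m * (A : ℝ) ^ (β - 1)) + √(m * (A : ℝ) ^ (β - 1))) := by
  obtain ⟨C, hC, h⟩ := poisson_truncated hr (H := r ^ 3) (one_le_pow₀ hr.le)
  refine ⟨C * r ^ 2 + 2, by positivity, ?_⟩
  intro A B m N hm hA hmA hAB hBA hN hN'
  have hr0 : 0 < r := by linarith
  have hm0 : (0 : ℝ) < m := by exact_mod_cast hm
  have hA0 : (0 : ℝ) < A := by exact_mod_cast hA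
  set Λ := (m : ℝ) * (A : ℝ) ^ (β - 1) with hΛ
  have hΛ0 : 0 < Λ := by positivity
  set a := A / m with ha
  set b := B / m with hb
  have hab : a ≤ b := Nat.div_le_div_right hAB
  have ha1 : (a : ℝ) ≤ A / m := Nat.cast_div_le
  have hb1 : (b : ℝ) ≤ B / m := Nat.cast_div_le
  have ha2 : (A : ℝ) / m ≤ a + 1 := by
    rw [div_le_iff₀ hm0]
    have : A < m * (A / m + 1) := Nat.lt_mul_div_succ A hm
    have : (A : ℝ) < m * (a + 1) := by exact_mod_cast this
    linarith
  have hb2 : (B : ℝ) / m ≤ b + 1 := by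
    rw [div_le_iff₀ hm0]
    have : B < m * (B / m + 1) := Nat.lt_mul_div_succ B hm
    have : (B : ℝ) < m * (b + 1) := by exact_mod_cast this
    linarith
  have hlow : ∀ x ∈ Set.Icc (a : ℝ) b, (A : ℝ) / r ≤ m * x := by
    intro x hx
    have h1 : (A : ℝ) - m ≤ m * a := by
      rw [div_le_iff₀ hm0] at ha2
      linarith
    have h2 : (A : ℝ) / r ≤ A - m := by
      rw [div_le_iff₀ hr0]
      linarith
    nlinarith [hx.1]
  have hup : ∀ x ∈ Set.Icc (a : ℝ) b, m * x ≤ r ^ 2 * A := by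
    intro x hx
    have := (le_div_iff₀ hm0).1 (hx.2.trans hb1)
    linarith
  have hAr : 0 < (A : ℝ) / r := by positivity
  set f : ℝ → ℝ := fun x => κ * (m * x) ^ β with hf
  have hmx : ∀ x : ℝ, HasDerivAt (fun x => (m : ℝ) * x) m x := fun x =>
    ((hasDerivAt_id x).const_mul (m : ℝ)).congr_deriv (mul_one _)
  have d1 : ∀ x ∈ Set.Icc (a : ℝ) b, HasDerivAt f (m * (m * x) ^ (β - 1)) x := by
    intro x hx
    have hx0 : (m : ℝ) * x ≠ 0 := by linarith [hlow x hx]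
    refine (((hmx x).rpow_const (p := β) (Or.inl hx0)).const_mul κ).congr_deriv ?_
    linear_combination (m : ℝ) * (m * x) ^ (β - 1) * hκ
  have d2 : ∀ x ∈ Set.Icc (a : ℝ) b, HasDerivAt (fun x => (m : ℝ) * (m * x) ^ (β - 1))
      (m * (m * (β - 1) * (m * x) ^ (β - 1 - 1))) x := by
    intro x hx
    have hx0 : (m : ℝ) * x ≠ 0 := by linarith [hlow x hx]
    exact (((hmx x).rpow_const (p := β - 1) (Or.inl hx0)).const_mul (m : ℝ))
  have hpowr : ∀ n : ℕ, (r ^ n) ^ (1 - β) ≤ r ^ n := fun n => by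
    conv_rhs => rw [← Real.rpow_one (r ^ n)]
    exact Real.rpow_le_rpow_of_exponent_le (one_le_pow₀ hr.le) (by linarith)
  have e1 : (m : ℝ) * (r ^ 2 * A) ^ (β - 1) = Λ / (r ^ 2) ^ (1 - β) := by
    rw [Real.mul_rpow (by positivity) hA0.le, show β - 1 = -(1 - β) by ring,
      Real.rpow_neg (by positivity : (0:ℝ) ≤ r ^ 2), ← show β - 1 = -(1 - β) by ring, hΛ]
    field_simp
  have e2 : (m : ℝ) * ((A : ℝ) / r) ^ (β - 1) = Λ * r ^ (1 - β) := by
    rw [Real.div_rpow hA0.le hr0.le, hΛ, show β - 1 = -(1 - β) by ring, Real.rpow_neg hr0.le (1 - β)]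
    field_simp
  have hr1 : r ^ (1 - β) ≤ r := by simpa using hpowr 1
  have hl1 : Λ / r ^ 2 ≤ m * (r ^ 2 * A) ^ (β - 1) := by
    rw [e1]
    exact div_le_div_of_nonneg_left hΛ0.le (by positivity) (hpowr 2)
  have hl2 : m * ((A : ℝ) / r) ^ (β - 1) ≤ Λ * r := by
    rw [e2]
    gcongr
  have key := h f (fun x => m * (m * x) ^ (β - 1)) (fun x => m * (m * (β - 1) * (m * x) ^ (β - 1 - 1)))
    a b (Λ / r ^ 2) (Λ * r) N hab (by positivity) (le_of_eq (by field_simp)) d1 d2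
    (by
      refine continuousOn_const.mul (continuousOn_const.mul (ContinuousOn.rpow_const
        (by fun_prop) fun x hx => Or.inl ?_))
      linarith [hlow x hx])
    (fun x hx => by
      have : 0 ≤ (m * x) ^ (β - 1 - 1) := Real.rpow_nonneg (by linarith [hlow x hx]) _
      have : 0 ≤ m * (m * (1 - β) * (m * x) ^ (β - 1 - 1)) := by
        have : 0 ≤ 1 - β := by linarith
        positivity
      linarith)
    (fun x hx => by
      have hx0 : (0 : ℝ) < m * x := by linarith [hlow x hx]
      constructor
      · refine hl1.trans ?_
        gcongr ?_ * ?_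
        exact Real.rpow_le_rpow_of_nonpos hx0 (hup x hx) (by linarith)
      · refine le_trans ?_ hl2
        gcongr ?_ * ?_
        exact Real.rpow_le_rpow_of_nonpos hAr (hlow x hx) (by linarith))
    (fun ν hν => ⟨(hN ν hν).1, (hN ν hν).2.trans (by
      have : r ^ 3 * (Λ / r ^ 2) = Λ * r := by field_simp
      rw [this]
      nlinarith)⟩)
    (fun ν h1 h2 => by
      rcases hN' ν h1 h2 with h3 | h3
      · left
        rw [le_div_iff₀ (by positivity)]
        refine le_trans ?_ h3
        have : r ^ 3 ≤ r ^ 4 := pow_le_pow_right₀ hr.le (by norm_num)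
        have h0 : 0 ≤ 2 * π * (ν : ℝ) := by positivity
        nlinarith
      · right
        linarith)
  have cf : Continuous f := by
    refine continuous_const.mul (Continuous.rpow_const (by fun_prop) fun x => Or.inr hβ.le)
  have hE1 := norm_sum_integral_cis_le cf N a ha1 ha2
  have hE2 := norm_sum_integral_cis_le cf N b hb1 hb2
  have hsplit : ∑ ν ∈ N, ∫ x in ((A : ℝ) / m)..((B : ℝ) / m), cis (f x + -(2 * π * ν) * x) =
      ∑ ν ∈ N, (∫ x in (a : ℝ)..b, cis (f x + -(2 * π * ν) * x)) -
      ∑ ν ∈ N, (∫ x in (a : ℝ)..((A : ℝ) / m), cis (f x + -(2 * π * ν) * x)) +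
      ∑ ν ∈ N, ∫ x in (b : ℝ)..((B : ℝ) / m), cis (f x + -(2 * π * ν) * x) := by
    rw [← Finset.sum_sub_distrib, ← Finset.sum_add_distrib]
    refine Finset.sum_congr rfl fun ν _ => ?_
    have hi : ∀ u v : ℝ, IntervalIntegrable (fun x => cis (f x + -(2 * π * ν) * x)) volume u v :=
      fun u v => (continuous_cis.comp (by fun_prop)).intervalIntegrable _ _
    rw [← intervalIntegral.integral_add_adjacent_intervals (hi (A / m) a) (hi a (B / m)),
      ← intervalIntegral.integral_add_adjacent_intervals (hi a b) (hi b (B / m)),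
      intervalIntegral.integral_symm (a : ℝ) (A / m)]
    ring
  have hcard : √(N.card : ℝ) ≤ √Λ := by
    refine Real.sqrt_le_sqrt ?_
    have hsub : N ⊆ Icc 1 ⌊Λ⌋₊ := fun ν hν =>
      Finset.mem_Icc.2 ⟨(hN ν hν).1, Nat.le_floor (hN ν hν).2⟩
    have := Finset.card_le_card hsub
    rw [Nat.card_Icc, Nat.add_sub_cancel] at this
    exact (Nat.cast_le.2 this).trans (Nat.floor_le hΛ0.le)
  have e3 : ∀ n : ℕ, κ * ((m * n : ℕ) : ℝ) ^ β = f n := fun n => by simp [hf]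
  simp only [e3]
  rw [hsplit]
  have hS : 0 ≤ √Λ := Real.sqrt_nonneg _
  have hi : 0 < 1 / Λ := by positivity
  have hCr : C ≤ C * r ^ 2 := le_mul_of_one_le_right hC.le (one_le_pow₀ hr.le)
  calc _ = ‖(∑ n ∈ Ioc a b, cis (f n) - ∑ ν ∈ N, ∫ x in (a : ℝ)..b, cis (f x + -(2 * π * ν) * x)) +
        (∑ ν ∈ N, (∫ x in (a : ℝ)..((A : ℝ) / m), cis (f x + -(2 * π * ν) * x)) -
        ∑ ν ∈ N, ∫ x in (b : ℝ)..((B : ℝ) / m), cis (f x + -(2 * π * ν) * x))‖ := by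
        congr 1
        ring
    _ ≤ C * (1 + 1 / (Λ / r ^ 2)) + (√Λ + √Λ) :=
        (norm_add_le _ _).trans (add_le_add key ((norm_sub_le _ _).trans (add_le_add
          (hE1.trans hcard) (hE2.trans hcard))))
    _ = C + C * r ^ 2 * (1 / Λ) + 2 * √Λ := by
        field_simp
        ring
    _ ≤ (C * r ^ 2 + 2) * (1 + 1 / Λ + √Λ) := by
        nlinarith [mul_nonneg (by positivity : 0 ≤ C * r ^ 2) hS]

section StationaryPhase

variable {φ φ' φ'' : ℝ → ℝ} {δ : ℝ}

theorem integral_cis_eq_smoothed {a b Λ : ℝ} (hab : a ≤ b) (hΛ : 0 < Λ) (hδ : 0 < δ)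
    (h1 : ∀ u ∈ Set.Icc a b, HasDerivAt φ (φ' u) u)
    (h2 : ∀ u ∈ Set.Icc a b, HasDerivAt φ' (φ'' u) u)
    (hc : ContinuousOn φ'' (Set.Icc a b)) :
    ∫ u in a..b, cis (Λ * φ u) =
      -I * (1 / Λ : ℝ) * (((φ' b / (φ' b ^ 2 + δ ^ 2) : ℝ) : ℂ) * cis (Λ * φ b) -
        ((φ' a / (φ' a ^ 2 + δ ^ 2) : ℝ) : ℂ) * cis (Λ * φ a)) +
      (∫ u in a..b, ((δ ^ 2 / (φ' u ^ 2 + δ ^ 2) : ℝ) : ℂ) * cis (Λ * φ u)) +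
      I * ∫ u in a..b, ((φ'' u * (δ ^ 2 - φ' u ^ 2) / (φ' u ^ 2 + δ ^ 2) ^ 2 : ℝ) : ℂ) *
        ((1 / Λ : ℝ) * cis (Λ * φ u)) := by
  have hui := Set.uIcc_of_le hab
  have hd0 : ∀ u, φ' u ^ 2 + δ ^ 2 ≠ 0 := fun u => by positivity
  have c1 : ContinuousOn φ' (Set.Icc a b) := fun x hx => (h2 x hx).continuousAt.continuousWithinAt
  have c0 : ContinuousOn (fun u => cis (Λ * φ u)) (Set.Icc a b) :=
    continuous_cis.comp_continuousOn (continuousOn_const.mul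
      fun x hx => (h1 x hx).continuousAt.continuousWithinAt)
  have cd : ContinuousOn (fun u => φ' u ^ 2 + δ ^ 2) (Set.Icc a b) := (c1.pow 2).add continuousOn_const
  have cq : ContinuousOn (fun u => φ'' u * (δ ^ 2 - φ' u ^ 2) / (φ' u ^ 2 + δ ^ 2) ^ 2)
      (Set.Icc a b) :=
    (hc.mul (continuousOn_const.sub (c1.pow 2))).div (cd.pow 2) fun u _ => pow_ne_zero 2 (hd0 u)
  have cw : ContinuousOn (fun u => δ ^ 2 / (φ' u ^ 2 + δ ^ 2)) (Set.Icc a b) :=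
    continuousOn_const.div cd fun u _ => hd0 u
  have hq : ∀ u ∈ Set.Icc a b, HasDerivAt (fun u => φ' u / (φ' u ^ 2 + δ ^ 2))
      (φ'' u * (δ ^ 2 - φ' u ^ 2) / (φ' u ^ 2 + δ ^ 2) ^ 2) u := fun u hu => by
    refine ((h2 u hu).div (((h2 u hu).pow 2).add_const (δ ^ 2)) (hd0 u)).congr_deriv ?_
    congr 1
    push_cast
    simp only [Pi.pow_apply]
    ring
  have hcis : ∀ u ∈ Set.Icc a b, HasDerivAt (fun u => cis (Λ * φ u))
      (((Λ * φ' u : ℝ) : ℂ) * I * cis (Λ * φ u)) u := fun u hu =>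
    hasDerivAt_cis ((h1 u hu).const_mul Λ)
  have oc := fun {g : ℝ → ℝ} (hg : ContinuousOn g (Set.Icc a b)) =>
    Complex.continuous_ofReal.comp_continuousOn hg
  have iq : IntervalIntegrable (fun u => ((φ'' u * (δ ^ 2 - φ' u ^ 2) / (φ' u ^ 2 + δ ^ 2) ^ 2 : ℝ) : ℂ))
      volume a b := ContinuousOn.intervalIntegrable (hui ▸ oc cq)
  have ic : IntervalIntegrable (fun u => ((Λ * φ' u : ℝ) : ℂ) * I * cis (Λ * φ u)) volume a b :=
    ContinuousOn.intervalIntegrable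
      (hui ▸ ((oc (continuousOn_const.mul c1)).mul continuousOn_const).mul c0)
  have e := intervalIntegral.integral_mul_deriv_eq_deriv_mul (a := a) (b := b)
    (u := fun u => ((φ' u / (φ' u ^ 2 + δ ^ 2) : ℝ) : ℂ)) (v := fun u => cis (Λ * φ u))
    (fun u hu => (hq u (hui ▸ hu)).ofReal_comp) (fun u hu => hcis u (hui ▸ hu)) iq ic
  have i0 : IntervalIntegrable (fun u => cis (Λ * φ u)) volume a b :=
    ContinuousOn.intervalIntegrable (hui ▸ c0)
  have iw : IntervalIntegrable (fun u => ((δ ^ 2 / (φ' u ^ 2 + δ ^ 2) : ℝ) : ℂ) * cis (Λ * φ u))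
      volume a b := ContinuousOn.intervalIntegrable (hui ▸ (oc cw).mul c0)
  have hΛc : (Λ : ℂ) ≠ 0 := by exact_mod_cast hΛ.ne'
  have e2 : ∫ u in a..b, ((φ' u / (φ' u ^ 2 + δ ^ 2) : ℝ) : ℂ) *
      (((Λ * φ' u : ℝ) : ℂ) * I * cis (Λ * φ u)) = I * Λ * ((∫ u in a..b, cis (Λ * φ u)) -
        ∫ u in a..b, ((δ ^ 2 / (φ' u ^ 2 + δ ^ 2) : ℝ) : ℂ) * cis (Λ * φ u)) := by
    rw [← intervalIntegral.integral_sub i0 iw, ← intervalIntegral.integral_const_mul]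
    refine intervalIntegral.integral_congr fun u _ => ?_
    have : (φ' u : ℂ) ^ 2 + (δ : ℂ) ^ 2 ≠ 0 := by exact_mod_cast hd0 u
    push_cast
    field_simp
    ring
  rw [e2] at e
  have e3 : ∫ u in a..b, ((φ'' u * (δ ^ 2 - φ' u ^ 2) / (φ' u ^ 2 + δ ^ 2) ^ 2 : ℝ) : ℂ) *
        ((1 / Λ : ℝ) * cis (Λ * φ u)) = (1 / Λ : ℝ) * ∫ u in a..b,
        ((φ'' u * (δ ^ 2 - φ' u ^ 2) / (φ' u ^ 2 + δ ^ 2) ^ 2 : ℝ) : ℂ) * cis (Λ * φ u) := by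
    rw [← intervalIntegral.integral_const_mul]
    refine intervalIntegral.integral_congr fun u _ => ?_
    ring
  rw [e3]
  have hI := I_mul_I
  have e4 : ((1 / Λ : ℝ) : ℂ) * Λ = 1 := by
    push_cast
    field_simp
  linear_combination (-I * (1 / Λ : ℝ)) * e + (-(∫ u in a..b, cis (Λ * φ u)) +
    ∫ u in a..b, ((δ ^ 2 / (φ' u ^ 2 + δ ^ 2) : ℝ) : ℂ) * cis (Λ * φ u)) * (e4 + 0 * hI) +
    (((1 / Λ : ℝ) : ℂ) * Λ) * ((∫ u in a..b, cis (Λ * φ u)) -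
    ∫ u in a..b, ((δ ^ 2 / (φ' u ^ 2 + δ ^ 2) : ℝ) : ℂ) * cis (Λ * φ u)) * hI

theorem integral_inv_sq_add_sq_le {a b c : ℝ} (hab : a ≤ b) (hδ : 0 < δ) (hc0 : 0 < c)
    (h2 : ∀ u ∈ Set.Icc a b, HasDerivAt φ' (φ'' u) u) (hc : ContinuousOn φ'' (Set.Icc a b))
    (hlow : ∀ u ∈ Set.Icc a b, c ≤ -φ'' u) :
    ∫ u in a..b, 1 / (φ' u ^ 2 + δ ^ 2) ≤ π / (c * δ) := by
  have hui := Set.uIcc_of_le hab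
  have hd0 : ∀ u, 0 < φ' u ^ 2 + δ ^ 2 := fun u => by positivity
  have c1 : ContinuousOn φ' (Set.Icc a b) := fun x hx => (h2 x hx).continuousAt.continuousWithinAt
  have cd : ContinuousOn (fun u => φ' u ^ 2 + δ ^ 2) (Set.Icc a b) := (c1.pow 2).add continuousOn_const
  have i1 : IntervalIntegrable (fun u => 1 / (φ' u ^ 2 + δ ^ 2)) volume a b :=
    ContinuousOn.intervalIntegrable (hui ▸ continuousOn_const.div cd fun u _ => (hd0 u).ne')
  have i2 : IntervalIntegrable (fun u => φ'' u * δ / (φ' u ^ 2 + δ ^ 2)) volume a b :=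
    ContinuousOn.intervalIntegrable
      (hui ▸ (hc.mul continuousOn_const).div cd fun u _ => (hd0 u).ne')
  have hder : ∀ u ∈ Set.uIcc a b, HasDerivAt (fun u => Real.arctan (φ' u / δ))
      (φ'' u * δ / (φ' u ^ 2 + δ ^ 2)) u := fun u hu => by
    refine (((h2 u (hui ▸ hu)).div_const δ).arctan).congr_deriv ?_
    field_simp
    ring
  have hI := intervalIntegral.integral_eq_sub_of_hasDerivAt hder i2
  have hm : ∫ u in a..b, 1 / (φ' u ^ 2 + δ ^ 2) ≤
      ∫ u in a..b, -(1 / (c * δ)) * (φ'' u * δ / (φ' u ^ 2 + δ ^ 2)) := by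
    refine intervalIntegral.integral_mono_on hab i1 (i2.const_mul _) fun u hu => ?_
    have e : -(1 / (c * δ)) * (φ'' u * δ / (φ' u ^ 2 + δ ^ 2)) =
        (-φ'' u / c) / (φ' u ^ 2 + δ ^ 2) := by field_simp
    rw [e]
    have := hd0 u
    gcongr
    rw [le_div_iff₀ hc0]
    linarith [hlow u hu]
  rw [intervalIntegral.integral_const_mul, hI] at hm
  refine hm.trans ?_
  have h3 := Real.arctan_lt_pi_div_two (φ' a / δ)
  have h4 := Real.neg_pi_div_two_lt_arctan (φ' b / δ)
  have e : π / (c * δ) = 1 / (c * δ) * π := by ring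
  rw [e]
  have : 0 < 1 / (c * δ) := by positivity
  nlinarith

end StationaryPhase

theorem norm_sum_mul_integral_le {ι : Type*} (S : Finset ι) (c : ι → ℂ) (u₁ u₂ : ι → ℝ)
    (g : ι → ℝ → ℂ) (w v : ℝ → ℝ) {U₁ U₂ W : ℝ} (hU : U₁ ≤ U₂)
    (h1 : ∀ s ∈ S, U₁ ≤ u₁ s) (h12 : ∀ s ∈ S, u₁ s ≤ u₂ s) (h2 : ∀ s ∈ S, u₂ s ≤ U₂)
    (hg : ∀ s ∈ S, ContinuousOn (g s) (Set.Icc U₁ U₂)) (hw : ContinuousOn w (Set.Icc U₁ U₂))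
    (hv : ContinuousOn v (Set.Icc U₁ U₂)) (hwv : ∀ u ∈ Set.Icc U₁ U₂, |w u| ≤ v u)
    (hb : ∀ u ∈ Set.Icc U₁ U₂, ‖∑ s ∈ S, c s * (if u₁ s < u ∧ u ≤ u₂ s then g s u else 0)‖ ≤ W) :
    ‖∑ s ∈ S, c s * ∫ u in (u₁ s)..(u₂ s), (w u : ℂ) * g s u‖ ≤ (∫ u in U₁..U₂, v u) * W := by
  have hui := Set.uIcc_of_le hU
  have key : ∀ s ∈ S, ∫ u in (u₁ s)..(u₂ s), (w u : ℂ) * g s u =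
      ∫ u in U₁..U₂, (w u : ℂ) * (if u₁ s < u ∧ u ≤ u₂ s then g s u else 0) := by
    intro s hs
    rw [intervalIntegral.integral_of_le (h12 s hs), intervalIntegral.integral_of_le hU]
    have e : ∀ u, (w u : ℂ) * (if u₁ s < u ∧ u ≤ u₂ s then g s u else 0) =
        (Set.Ioc (u₁ s) (u₂ s)).indicator (fun u => (w u : ℂ) * g s u) u := by
      intro u
      simp only [Set.indicator, Set.mem_Ioc, mul_ite, mul_zero]
    simp only [e]
    rw [MeasureTheory.setIntegral_indicator measurableSet_Ioc, Set.inter_eq_self_of_subset_right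
      (Set.Ioc_subset_Ioc (h1 s hs) (h2 s hs))]
  have hint : ∀ s ∈ S, IntervalIntegrable
      (fun u => c s * ((w u : ℂ) * (if u₁ s < u ∧ u ≤ u₂ s then g s u else 0))) volume U₁ U₂ := by
    intro s hs
    refine IntervalIntegrable.const_mul ?_ _
    have e : (fun u => (w u : ℂ) * (if u₁ s < u ∧ u ≤ u₂ s then g s u else 0)) =
        (Set.Ioc (u₁ s) (u₂ s)).indicator (fun u => (w u : ℂ) * g s u) := by
      funext u
      simp only [Set.indicator, Set.mem_Ioc, mul_ite, mul_zero]
    rw [e]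
    have hc : ContinuousOn (fun u => (w u : ℂ) * g s u) (Set.Icc U₁ U₂) :=
      (Complex.continuous_ofReal.comp_continuousOn hw).mul (hg s hs)
    have hi : IntervalIntegrable (fun u => (w u : ℂ) * g s u) volume U₁ U₂ :=
      ContinuousOn.intervalIntegrable (hui ▸ hc)
    rw [intervalIntegrable_iff] at hi ⊢
    exact hi.indicator measurableSet_Ioc
  rw [Finset.sum_congr rfl fun s hs => by rw [key s hs, ← intervalIntegral.integral_const_mul],
    ← intervalIntegral.integral_finsetSum hint, ← intervalIntegral.integral_mul_const]
  refine intervalIntegral.norm_integral_le_of_norm_le hU ?_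
    (((hui ▸ hv : ContinuousOn v (Set.uIcc U₁ U₂)).intervalIntegrable).mul_const W)
  refine ae_of_all _ fun u hu => ?_
  have hu' := Set.Ioc_subset_Icc_self hu
  have e : ∑ s ∈ S, c s * ((w u : ℂ) * (if u₁ s < u ∧ u ≤ u₂ s then g s u else 0)) =
      (w u : ℂ) * ∑ s ∈ S, c s * (if u₁ s < u ∧ u ≤ u₂ s then g s u else 0) := by
    rw [Finset.mul_sum]
    exact Finset.sum_congr rfl fun s _ => by ring
  rw [e, norm_mul, Complex.norm_real, Real.norm_eq_abs]
  have hv0 := (abs_nonneg _).trans (hwv u hu')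
  exact mul_le_mul (hwv u hu') (hb u hu') (norm_nonneg _) hv0

/-- A weighted sum of oscillatory integrals with a common stationary point, estimated through the
integrand at each fixed point together with the boundary terms. -/
theorem norm_sum_integral_cis_smoothed_le {ι : Type*} (S : Finset ι) (c : ι → ℂ) (Λ u₁ u₂ : ι → ℝ)
    {φ φ' φ'' : ℝ → ℝ} {δ U₁ U₂ c₀ c₁ W₀ W₁ : ℝ} (hδ : 0 < δ) (hU : U₁ ≤ U₂) (hc₀ : 0 < c₀)
    (hd1 : ∀ u ∈ Set.Icc U₁ U₂, HasDerivAt φ (φ' u) u)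
    (hd2 : ∀ u ∈ Set.Icc U₁ U₂, HasDerivAt φ' (φ'' u) u)
    (hc : ContinuousOn φ'' (Set.Icc U₁ U₂))
    (hlow : ∀ u ∈ Set.Icc U₁ U₂, c₀ ≤ -φ'' u) (hup : ∀ u ∈ Set.Icc U₁ U₂, -φ'' u ≤ c₁)
    (hΛ : ∀ s ∈ S, 0 < Λ s)
    (h1 : ∀ s ∈ S, U₁ ≤ u₁ s) (h12 : ∀ s ∈ S, u₁ s ≤ u₂ s) (h2 : ∀ s ∈ S, u₂ s ≤ U₂)
    (hW₀ : ∀ u ∈ Set.Icc U₁ U₂,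
      ‖∑ s ∈ S, c s * (if u₁ s < u ∧ u ≤ u₂ s then cis (Λ s * φ u) else 0)‖ ≤ W₀)
    (hW₁ : ∀ u ∈ Set.Icc U₁ U₂,
      ‖∑ s ∈ S, c s * (if u₁ s < u ∧ u ≤ u₂ s then ((1 / Λ s : ℝ) : ℂ) * cis (Λ s * φ u) else 0)‖
        ≤ W₁) :
    ‖∑ s ∈ S, c s * ∫ u in (u₁ s)..(u₂ s), cis (Λ s * φ u)‖ ≤
      ∑ s ∈ S, ‖c s‖ / Λ s * (2 / (|φ' (u₁ s)| + δ) + 2 / (|φ' (u₂ s)| + δ)) +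
        π / c₀ * δ * W₀ + c₁ * π / (c₀ * δ) * W₁ := by
  have hd0 : ∀ u, 0 < φ' u ^ 2 + δ ^ 2 := fun u => by positivity
  have c1 : ContinuousOn φ' (Set.Icc U₁ U₂) :=
    fun x hx => (hd2 x hx).continuousAt.continuousWithinAt
  have cd : ContinuousOn (fun u => φ' u ^ 2 + δ ^ 2) (Set.Icc U₁ U₂) :=
    (c1.pow 2).add continuousOn_const
  have hW₀' : 0 ≤ W₀ := (norm_nonneg _).trans (hW₀ U₁ ⟨le_rfl, hU⟩)
  have hW₁' : 0 ≤ W₁ := (norm_nonneg _).trans (hW₁ U₁ ⟨le_rfl, hU⟩)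
  have hc1 : 0 < c₁ := hc₀.trans_le ((hlow U₁ ⟨le_rfl, hU⟩).trans (hup U₁ ⟨le_rfl, hU⟩))
  have hsub : ∀ s ∈ S, Set.Icc (u₁ s) (u₂ s) ⊆ Set.Icc U₁ U₂ := fun s hs =>
    Set.Icc_subset_Icc (h1 s hs) (h2 s hs)
  have ccis : ∀ s ∈ S, ContinuousOn (fun u => cis (Λ s * φ u)) (Set.Icc U₁ U₂) := fun s _ =>
    continuous_cis.comp_continuousOn (continuousOn_const.mul
      fun x hx => (hd1 x hx).continuousAt.continuousWithinAt)
  set w₀ : ℝ → ℝ := fun u => δ ^ 2 / (φ' u ^ 2 + δ ^ 2) with hw₀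
  set w₁ : ℝ → ℝ := fun u => φ'' u * (δ ^ 2 - φ' u ^ 2) / (φ' u ^ 2 + δ ^ 2) ^ 2 with hw₁
  have cinv : ∀ K : ℝ, ContinuousOn (fun u => K * (1 / (φ' u ^ 2 + δ ^ 2))) (Set.Icc U₁ U₂) :=
    fun K => continuousOn_const.mul (continuousOn_const.div cd fun u _ => (hd0 u).ne')
  have hInt := integral_inv_sq_add_sq_le hU hδ hc₀ hd2 hc hlow
  have B0 := norm_sum_mul_integral_le S c u₁ u₂ (fun s u => cis (Λ s * φ u)) w₀
    (fun u => δ ^ 2 * (1 / (φ' u ^ 2 + δ ^ 2))) hU h1 h12 h2 ccis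
    (continuousOn_const.div cd fun u _ => (hd0 u).ne') (cinv _)
    (fun u _ => by
      rw [hw₀, abs_of_nonneg (by positivity)]
      exact le_of_eq (by ring)) hW₀
  have B1 := norm_sum_mul_integral_le S c u₁ u₂ (fun s u => ((1 / Λ s : ℝ) : ℂ) * cis (Λ s * φ u)) w₁
    (fun u => c₁ * (1 / (φ' u ^ 2 + δ ^ 2))) hU h1 h12 h2
    (fun s hs => continuousOn_const.mul (ccis s hs))
    ((hc.mul (continuousOn_const.sub (c1.pow 2))).div (cd.pow 2)
      fun u _ => pow_ne_zero 2 (hd0 u).ne') (cinv _)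
    (fun u hu => by
      have hd := hd0 u
      rw [hw₁, abs_div, abs_of_nonneg (by positivity : 0 ≤ (φ' u ^ 2 + δ ^ 2) ^ 2), abs_mul]
      have h3 : |φ'' u| ≤ c₁ := by
        rw [abs_of_nonpos (by linarith [hlow u hu])]
        exact hup u hu
      have h4 : |δ ^ 2 - φ' u ^ 2| ≤ φ' u ^ 2 + δ ^ 2 := by
        rw [abs_le]
        constructor <;> nlinarith [sq_nonneg (φ' u), sq_nonneg δ]
      calc _ ≤ c₁ * (φ' u ^ 2 + δ ^ 2) / (φ' u ^ 2 + δ ^ 2) ^ 2 := by gcongr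
        _ = _ := by field_simp) hW₁
  rw [intervalIntegral.integral_const_mul] at B0 B1
  have hq : ∀ x : ℝ, |x / (x ^ 2 + δ ^ 2)| ≤ 2 / (|x| + δ) := by
    intro x
    have hx := abs_nonneg x
    rw [abs_div, abs_of_pos (by positivity : 0 < x ^ 2 + δ ^ 2),
      div_le_div_iff₀ (by positivity) (by positivity), ← sq_abs x]
    nlinarith [sq_nonneg (|x| - δ), sq_nonneg (|x|), sq_nonneg δ]
  set bd : ι → ℂ := fun s => -I * (1 / Λ s : ℝ) *
    (((φ' (u₂ s) / (φ' (u₂ s) ^ 2 + δ ^ 2) : ℝ) : ℂ) * cis (Λ s * φ (u₂ s)) -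
    ((φ' (u₁ s) / (φ' (u₁ s) ^ 2 + δ ^ 2) : ℝ) : ℂ) * cis (Λ s * φ (u₁ s))) with hbd
  have e : ∑ s ∈ S, c s * ∫ u in (u₁ s)..(u₂ s), cis (Λ s * φ u) = ∑ s ∈ S, c s * bd s +
      ∑ s ∈ S, c s * (∫ u in (u₁ s)..(u₂ s), (w₀ u : ℂ) * cis (Λ s * φ u)) +
      I * ∑ s ∈ S, c s * ∫ u in (u₁ s)..(u₂ s),
        (w₁ u : ℂ) * (((1 / Λ s : ℝ) : ℂ) * cis (Λ s * φ u)) := by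
    rw [Finset.mul_sum, ← Finset.sum_add_distrib, ← Finset.sum_add_distrib]
    refine Finset.sum_congr rfl fun s hs => ?_
    rw [integral_cis_eq_smoothed (h12 s hs) (hΛ s hs) hδ (fun u hu => hd1 u (hsub s hs hu))
      (fun u hu => hd2 u (hsub s hs hu)) (hc.mono (hsub s hs))]
    ring
  have hB : ‖∑ s ∈ S, c s * bd s‖ ≤
      ∑ s ∈ S, ‖c s‖ / Λ s * (2 / (|φ' (u₁ s)| + δ) + 2 / (|φ' (u₂ s)| + δ)) := by
    refine norm_sum_le_of_le _ fun s hs => ?_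
    have hΛs := hΛ s hs
    rw [norm_mul, hbd, norm_mul, norm_mul, norm_neg, norm_I, one_mul, Complex.norm_real,
      Real.norm_eq_abs, abs_of_pos (by positivity)]
    have : ‖c s‖ / Λ s * (2 / (|φ' (u₁ s)| + δ) + 2 / (|φ' (u₂ s)| + δ)) =
        ‖c s‖ * (1 / Λ s * (2 / (|φ' (u₂ s)| + δ) + 2 / (|φ' (u₁ s)| + δ))) := by ring
    rw [this]
    gcongr
    refine (norm_sub_le _ _).trans (add_le_add ?_ ?_)
    all_goals
      rw [norm_mul, norm_cis, mul_one, Complex.norm_real, Real.norm_eq_abs]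
      exact hq _
  rw [e]
  refine (norm_add₃_le).trans ?_
  rw [norm_mul, norm_I, one_mul]
  refine add_le_add (add_le_add hB (B0.trans ?_)) (B1.trans ?_)
  · refine mul_le_mul_of_nonneg_right ?_ hW₀'
    calc _ ≤ δ ^ 2 * (π / (c₀ * δ)) := mul_le_mul_of_nonneg_left hInt (by positivity)
      _ = _ := by field_simp
  · exact mul_le_mul_of_nonneg_right
      ((mul_le_mul_of_nonneg_left hInt hc1.le).trans (le_of_eq (by ring))) hW₁'

/-- Rescaling the integrals produced by Poisson summation to a common phase. -/
theorem integral_cis_substitution {β κ m ξ y a b : ℝ} (hm : 0 < m) (hy : 0 < y)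
    (hξ : y ^ (β - 1) = ξ / m) (ha : 0 ≤ a) (hab : a ≤ b) :
    ∫ x in (a / m)..(b / m), cis (κ * (m * x) ^ β + -ξ * x) =
      ((y / m : ℝ) : ℂ) * ∫ u in (a / y)..(b / y), cis (y ^ β * (κ * u ^ β - u)) := by
  have h := intervalIntegral.smul_integral_comp_mul_left
    (fun x => cis (κ * (m * x) ^ β + -ξ * x)) (y / m) (a := a / y) (b := b / y)
  have e1 : y / m * (a / y) = a / m := by field_simp
  have e2 : y / m * (b / y) = b / m := by field_simp
  rw [e1, e2] at h
  rw [← h, Complex.real_smul]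
  congr 1
  refine intervalIntegral.integral_congr fun u hu => ?_
  rw [Set.uIcc_of_le (by gcongr)] at hu
  have hu0 : 0 ≤ u := (by positivity : 0 ≤ a / y).trans hu.1
  have e3 : m * (y / m * u) = y * u := by field_simp
  have e4 : y ^ β = ξ / m * y := by
    rw [← hξ, ← Real.rpow_add_one hy.ne']
    congr 1
    ring
  change cis _ = cis _
  rw [e3, Real.mul_rpow hy.le hu0]
  congr 1
  have : ξ * (y / m * u) = y ^ β * u := by rw [e4]; ring
  linear_combination -this

theorem sum_inv_dist_add_le (N : Finset ℕ) {L x δ c : ℝ} (hδ : 0 < δ) (hx : 0 ≤ x)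
    (hxL : x ≤ L) (hc : 0 ≤ c) (hN : ∀ ν ∈ N, 1 ≤ ν ∧ (ν : ℝ) ≤ L ∧ L ≤ c * ν) :
    ∑ ν ∈ N, 1 / (|x - ν| + δ * ν) ≤ 2 * c / (δ * L) + 16 * √L := by
  classical
  rcases N.eq_empty_or_nonempty with rfl | ⟨ν₀, hν₀⟩
  · have hL : 0 ≤ L := hx.trans hxL
    simp only [Finset.sum_empty]
    positivity
  have hL1 : 1 ≤ L := by
    obtain ⟨h1, h2, -⟩ := hN ν₀ hν₀
    have : (1 : ℝ) ≤ ν₀ := by exact_mod_cast h1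
    linarith
  set n := ⌊x⌋₊ with hn
  have hn1 : (n : ℝ) ≤ x := Nat.floor_le hx
  have hn2 : x < n + 1 := Nat.lt_floor_add_one x
  have hterm : ∀ ν ∈ N, 1 / (|x - ν| + δ * ν) ≤
      (if ν = n then c / (δ * L) else 0) + (if ν = n + 1 then c / (δ * L) else 0) +
        2 * (if ν ≠ n then 1 / √|(ν : ℝ) - n| else 0) := by
    intro ν hν
    obtain ⟨h1, h2, h3⟩ := hN ν hν
    have hν1 : (1 : ℝ) ≤ ν := by exact_mod_cast h1
    have hc' : 0 ≤ c / (δ * L) := by positivity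
    have hdiag : 1 / (|x - ν| + δ * ν) ≤ c / (δ * L) := by
      rw [div_le_div_iff₀ (by positivity) (by positivity)]
      have := abs_nonneg (x - ν)
      nlinarith [mul_le_mul_of_nonneg_left h3 hδ.le, mul_nonneg hc this]
    rcases eq_or_ne ν n with h | h
    · simp only [h, if_true, ne_eq, not_true, if_false]
      rw [h] at hdiag
      simpa using hdiag
    · have hsq : 0 ≤ 1 / √|(ν : ℝ) - n| := by positivity
      rcases eq_or_ne ν (n + 1) with h' | h'
      · rw [if_neg h, if_pos h', if_pos h]
        linarith
      · rw [if_neg h, if_neg h', if_pos h]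
        have hd : (1 : ℝ) ≤ |(ν : ℝ) - n| ∧ |(ν : ℝ) - n| ≤ 2 * |x - ν| := by
          rcases lt_or_gt_of_ne h with hlt | hgt
          · have : (ν : ℝ) + 1 ≤ n := by exact_mod_cast hlt
            rw [abs_of_neg (by linarith), abs_of_pos (by linarith)]
            constructor <;> linarith
          · have h2 : n + 2 ≤ ν := by omega
            have : (n : ℝ) + 2 ≤ ν := by exact_mod_cast h2
            rw [abs_of_pos (by linarith), abs_of_neg (by linarith)]
            constructor <;> linarith
        have hs : √|(ν : ℝ) - n| ≤ |(ν : ℝ) - n| := by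
          rw [Real.sqrt_le_left (by positivity)]
          nlinarith [hd.1]
        have hs0 : 0 < √|(ν : ℝ) - n| := Real.sqrt_pos.2 (by linarith [hd.1])
        rw [zero_add, zero_add, mul_one_div, div_le_div_iff₀ (by nlinarith [hd.1, hd.2]) hs0]
        nlinarith [hd.1, hd.2, mul_pos hδ (by linarith : (0 : ℝ) < ν)]
  refine (Finset.sum_le_sum hterm).trans ?_
  rw [Finset.sum_add_distrib, Finset.sum_add_distrib, ← Finset.mul_sum]
  have hc' : 0 ≤ c / (δ * L) := by positivity
  have hsing : ∀ k : ℕ, ∑ ν ∈ N, (if ν = k then c / (δ * L) else 0) ≤ c / (δ * L) := by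
    intro k
    rw [Finset.sum_ite_eq']
    split_ifs
    · exact le_rfl
    · exact hc'
  have hQ := sum_inv_sqrt_dist_le N (⌊L⌋₊ + 1) n (fun k hk => by
    obtain ⟨h1, h2, h3⟩ := hN k hk
    have e1 : k ≤ ⌊L⌋₊ := Nat.le_floor h2
    have e2 : n ≤ ⌊L⌋₊ := Nat.floor_mono hxL
    omega)
  rw [Finset.sum_filter] at hQ
  have hQ2 : √((⌊L⌋₊ + 1 : ℕ) : ℝ) ≤ 2 * √L := by
    rw [Real.sqrt_le_left (by positivity), mul_pow, Real.sq_sqrt (by linarith)]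
    push_cast
    linarith [Nat.floor_le (by linarith : 0 ≤ L)]
  have h1 := hsing n
  have h2 := hsing (n + 1)
  have e : 2 * c / (δ * L) = c / (δ * L) + c / (δ * L) := by ring
  rw [e]
  linarith

set_option maxHeartbeats 1000000 in
theorem type_one_dyadic {β r φ₀ φ₁ e : ℝ} (hβ : 2 / 3 ≤ β) (hβ1 : β < 1) (hr : 1 ≤ r)
    (hφ₀ : 0 < φ₀) (he : 0 ≤ e) :
    ∃ C > 0, ∀ A q R V : ℕ, 1 ≤ A → 1 ≤ q → (q : ℝ) ≤ (A : ℝ) ^ (2 / 3 - β / 2) → 1 ≤ R →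
      (R : ℝ) ≤ 2 * (A : ℝ) ^ (1 - β / 2) → ∀ φ : ℝ, φ₀ ≤ φ → φ ≤ φ₁ → ∀ (a : ℕ → ℂ) (D : ℝ),
      0 ≤ D → (∀ m, R ≤ m → m < 2 * R → ‖a m‖ ≤ D) → ∀ P : ℕ → ℕ → Prop,
      ∀ _ : ∀ m n, Decidable (P m n),
      (∀ n m₁ m₂ m, 1 ≤ m₁ → P m₁ n → P m₂ n → m₁ ≤ m → m ≤ m₂ → P m n) →
      (∀ m n, P m n → (m : ℝ) * (A : ℝ) ^ (β - 1) < r ^ 4 * (2 * π * n) ∧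
        2 * π * n < r ^ 2 * (m * (A : ℝ) ^ (β - 1))) →
      ‖∑ m ∈ Ico R (2 * R), ∑ n ∈ Icc 1 V, a m * (if P m n then
        ((1 / m * (m / (2 * π * n)) ^ e : ℝ) : ℂ) *
          cis ((m / (2 * π * n)) ^ (β / (1 - β)) * φ) else 0)‖ ≤
        C * D * ((A : ℝ) ^ ((1 - β) * e) * (A : ℝ) ^ (β / 2) / √q) := by
  set γ := β / (1 - β) with hγ
  have hb : 0 < 1 - β := by linarith
  have hγ2 : 2 ≤ γ := by rw [hγ, le_div_iff₀ hb]; linarith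
  have hr0 : 0 < r := by linarith
  have hπ := Real.pi_pos
  have hr4 : 1 ≤ r ^ 4 := one_le_pow₀ hr
  have hr6 : 1 ≤ r ^ 6 := one_le_pow₀ hr
  have hrg : 1 ≤ (r ^ 4) ^ γ := Real.one_le_rpow hr4 (by linarith)
  set c : ℝ := 2 * r ^ 6 + 4 * π * r ^ 4 + 8 / φ₀ + 8 * |φ₁| * (r ^ 4) ^ γ * (2 * π * r ^ 4) with hc
  have hc0 : 0 ≤ 8 * |φ₁| * (r ^ 4) ^ γ * (2 * π * r ^ 4) := by positivity
  have hc1 : 1 ≤ c := by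
    have : 0 < 4 * π * r ^ 4 + 8 / φ₀ := by positivity
    linarith
  obtain ⟨C, hC, hbil⟩ := norm_bilinear_le (p := γ) (s := -γ) (c := c)
    (by have : 0 < γ * (γ - 1) := by apply mul_pos <;> linarith
        exact this.ne') (by linarith) hc1
  refine ⟨2 * r ^ 6 * (r ^ 4) ^ e + C * (r ^ 4) ^ e * 2 * 2 ^ e, by positivity, ?_⟩
  intro A q R V hA hq hqA hR hRA φ hφ hφ' a D hD ha P hdec hconv hP
  have hA1 : (1 : ℝ) ≤ A := by exact_mod_cast hA
  have hA0 : (0 : ℝ) < A := by linarith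
  have hq1 : (1 : ℝ) ≤ q := by exact_mod_cast hq
  have hR1 : (1 : ℝ) ≤ R := by exact_mod_cast hR
  have hR0 : (0 : ℝ) < R := by linarith
  set G : ℝ := (A : ℝ) ^ (1 - β) with hG
  set h : ℝ := (A : ℝ) ^ (β / 2) with hh
  have hG1 : 1 ≤ G := Real.one_le_rpow hA1 hb.le
  have hG0 : 0 < G := by linarith
  have hh1 : 1 ≤ h := Real.one_le_rpow hA1 (by linarith)
  have hh0 : 0 < h := by linarith
  have hGinv : (A : ℝ) ^ (β - 1) = 1 / G := by
    rw [hG, one_div, ← Real.rpow_neg hA0.le]; congr 1; ring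
  have hGe : (A : ℝ) ^ ((1 - β) * e) = G ^ e := by rw [hG, ← Real.rpow_mul hA0.le]
  have hGγ : G ^ γ = h ^ 2 := by
    rw [hG, hh, ← Real.rpow_mul hA0.le, ← Real.rpow_mul_natCast hA0.le]
    congr 1
    rw [hγ]; field_simp; norm_num
  have hRA' : (R : ℝ) ≤ 2 * (G * h) := by
    rw [hG, hh, ← Real.rpow_add hA0]; convert hRA using 3; ring
  have hqh : (q : ℝ) ≤ h := hqA.trans (Real.rpow_le_rpow_of_exponent_le hA1 (by linarith))
  have hq3 : (q : ℝ) ^ 3 ≤ G ^ 2 * h := by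
    have h1 : (q : ℝ) ^ 3 ≤ ((A : ℝ) ^ (2 / 3 - β / 2)) ^ 3 := by gcongr
    refine h1.trans (le_of_eq ?_)
    rw [hG, hh, ← Real.rpow_mul_natCast hA0.le, ← Real.rpow_mul_natCast hA0.le,
      ← Real.rpow_add hA0]
    congr 1
    push_cast; ring
  set L : ℝ := R / G with hL
  have hL0 : 0 < L := by positivity
  have hLh : L ≤ 2 * h := by rw [hL, div_le_iff₀ hG0]; linarith
  have hRL : (R : ℝ) = L * G := by rw [hL]; field_simp
  set N : ℝ := L / (2 * π * r ^ 4) with hN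
  have hN0 : 0 < N := by positivity
  have hNL : N ≤ L := div_le_self hL0.le (by nlinarith [Real.pi_gt_three])
  have hNR : R / (2 * π * N) = r ^ 4 * G := by rw [hN, hRL]; field_simp
  rw [hGe]
  simp only [hGinv] at hP
  have hPN : ∀ m n, R ≤ m → m < 2 * R → P m n → N ≤ n ∧ (n : ℝ) ≤ 2 * r ^ 6 * N := by
    intro m n hm hm' hp
    obtain ⟨h1, h2⟩ := hP m n hp
    have hm1 : (R : ℝ) ≤ m := by exact_mod_cast hm
    have hm2 : (m : ℝ) ≤ 2 * R := by exact_mod_cast hm'.le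
    constructor
    · rw [hN, div_le_iff₀ (by positivity), hL]
      have : (R : ℝ) / G ≤ m * (1 / G) := by
        rw [mul_one_div]
        exact div_le_div_of_nonneg_right hm1 hG0.le
      linarith
    · have h3 : r ^ 2 * (m * (1 / G)) ≤ r ^ 2 * (2 * L) := by
        refine mul_le_mul_of_nonneg_left ?_ (by positivity)
        rw [hL, mul_one_div, ← mul_div_assoc]
        exact div_le_div_of_nonneg_right hm2 hG0.le
      have h4 : 2 * r ^ 6 * N = r ^ 2 * (2 * L) / (2 * π) := by rw [hN]; field_simp
      rw [h4, le_div_iff₀ (by positivity)]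
      linarith
  have hfrac : ∀ m n, P m n → 0 < n ∧ (m : ℝ) / (2 * π * n) ≤ r ^ 4 * G := by
    intro m n hp
    obtain ⟨h1, -⟩ := hP m n hp
    rcases Nat.eq_zero_or_pos n with rfl | hn
    · have : (0 : ℝ) ≤ m * (1 / G) := by positivity
      simp at h1
      simp at this
      linarith
    refine ⟨hn, ?_⟩
    have hn' : (0 : ℝ) < n := by exact_mod_cast hn
    rw [div_le_iff₀ (by positivity)]
    have h5 : (m : ℝ) = G * (m * (1 / G)) := by field_simp
    rw [h5, mul_comm (r ^ 4), mul_assoc]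
    exact mul_le_mul_of_nonneg_left h1.le hG0.le
  set U : Finset ℕ := (Icc 1 V).filter fun n => N ≤ n ∧ (n : ℝ) ≤ 2 * r ^ 6 * N with hU
  have hred : ∀ m ∈ Ico R (2 * R), ∀ F : ℕ → ℂ, ∑ n ∈ Icc 1 V, a m * (if P m n then F n else 0) =
      ∑ n ∈ U, a m * (if P m n then F n else 0) := by
    intro m hm F
    rw [Finset.mem_Ico] at hm
    refine (Finset.sum_subset (Finset.filter_subset _ _) fun n hn hnU => ?_).symm
    rw [if_neg, mul_zero]
    intro hp
    exact hnU (Finset.mem_filter.2 ⟨hn, hPN m n hm.1 hm.2 hp⟩)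
  rw [Finset.sum_congr rfl fun m hm => hred m hm _]
  have hcard : (U.card : ℝ) ≤ 2 * r ^ 6 * N := by
    have h1 : U ⊆ Icc 1 ⌊2 * r ^ 6 * N⌋₊ := by
      intro n hn
      simp only [hU, Finset.mem_filter, Finset.mem_Icc] at hn
      exact Finset.mem_Icc.2 ⟨hn.1.1, Nat.le_floor hn.2.2⟩
    have h2 := Finset.card_le_card h1
    rw [Nat.card_Icc, Nat.add_sub_cancel] at h2
    exact (by exact_mod_cast h2 : (U.card : ℝ) ≤ ⌊2 * r ^ 6 * N⌋₊).trans (Nat.floor_le (by positivity))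
  have hsq : 0 < √(q : ℝ) := Real.sqrt_pos.2 (by linarith)
  have hGe0 : 0 < G ^ e := by positivity
  rcases le_or_gt ((q : ℝ) * L ^ 2) (h ^ 2) with hcase | hcase
  · have hLq : L ≤ h / √q := by
      rw [le_div_iff₀ hsq]
      refine le_of_sq_le_sq ?_ hh0.le
      rw [mul_pow, Real.sq_sqrt (by linarith)]
      linarith
    have hb1 : ‖∑ m ∈ Ico R (2 * R), ∑ n ∈ U, a m * (if P m n then
        ((1 / m * (m / (2 * π * n)) ^ e : ℝ) : ℂ) *
          cis ((m / (2 * π * n)) ^ γ * φ) else 0)‖ ≤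
        ∑ m ∈ Ico R (2 * R), ∑ n ∈ U, D * (1 / R * ((r ^ 4) ^ e * G ^ e)) := by
      refine norm_sum_le_of_le _ fun m hm => norm_sum_le_of_le _ fun n _ => ?_
      rw [Finset.mem_Ico] at hm
      rw [norm_mul]
      have hm1 : (R : ℝ) ≤ m := by exact_mod_cast hm.1
      refine mul_le_mul (ha m hm.1 hm.2) ?_ (norm_nonneg _) hD
      split_ifs with hp
      · obtain ⟨hn, hf⟩ := hfrac m n hp
        rw [norm_mul, norm_cis, mul_one, Complex.norm_real, Real.norm_eq_abs,
          abs_of_nonneg (by positivity), ← Real.mul_rpow (by positivity) hG0.le]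
        gcongr
      · rw [norm_zero]; positivity
    refine hb1.trans ?_
    rw [Finset.sum_const, Finset.sum_const, Nat.card_Ico, nsmul_eq_mul, nsmul_eq_mul]
    have e1 : ((2 * R - R : ℕ) : ℝ) = R := by congr 1; omega
    rw [e1]
    calc (R : ℝ) * (U.card * (D * (1 / R * ((r ^ 4) ^ e * G ^ e))))
        = U.card * (D * ((r ^ 4) ^ e * G ^ e)) := by
          rw [show (R : ℝ) * (U.card * (D * (1 / R * ((r ^ 4) ^ e * G ^ e)))) =
            U.card * (D * ((r ^ 4) ^ e * G ^ e)) * (R * (1 / R)) by ring,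
            mul_one_div_cancel hR0.ne', mul_one]
      _ ≤ 2 * r ^ 6 * (h / √q) * (D * ((r ^ 4) ^ e * G ^ e)) := by
          gcongr
          exact hcard.trans (by gcongr; exact hNL.trans hLq)
      _ = 2 * r ^ 6 * (r ^ 4) ^ e * D * (G ^ e * h / √q) := by ring
      _ ≤ _ := by
          gcongr
          have : 0 < C * (r ^ 4) ^ e * 2 * 2 ^ e := by positivity
          linarith
  · set x : ℝ := q * L ^ 2 / h ^ 2 with hx
    have hx1 : 1 < x := by rw [hx, lt_div_iff₀ (by positivity)]; linarith
    set Q := ⌊x⌋₊ with hQ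
    have hQ1 : 1 ≤ Q := Nat.le_floor (by rw [Nat.cast_one]; exact hx1.le)
    have hQx : (Q : ℝ) ≤ x := Nat.floor_le (by linarith)
    have hQ2 : x ≤ 2 * Q := by
      have h1 := Nat.lt_floor_add_one x
      have h2 : (1 : ℝ) ≤ Q := by exact_mod_cast hQ1
      linarith
    set θ : ℝ := φ * (2 * π) ^ (-γ) with hθ
    have hφ0 : 0 < φ := by linarith
    have hθ0 : 0 < θ := by positivity
    have hΘ : |θ| * (R : ℝ) ^ γ * N ^ (-γ) = φ * (r ^ 4) ^ γ * h ^ 2 := by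
      rw [abs_of_pos hθ0, hθ, ← hGγ, mul_assoc φ ((r ^ 4) ^ γ),
        ← Real.mul_rpow (by positivity) hG0.le, ← hNR,
        Real.div_rpow hR0.le (by positivity), Real.mul_rpow (by positivity) hN0.le,
        Real.rpow_neg (by positivity), Real.rpow_neg hN0.le]
      field_simp
    have hφabs : φ ≤ |φ₁| := hφ'.trans (le_abs_self _)
    have hx2 : x ≤ 2 * L := by
      rw [hx, div_le_iff₀ (by positivity)]
      calc q * L ^ 2 = q * L * L := by ring
        _ ≤ h * (2 * h) * L := by gcongr
        _ = _ := by ring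
    have k1 : (Q : ℝ) ≤ c * N := by
      refine (hQx.trans hx2).trans ?_
      have : 4 * π * r ^ 4 ≤ c := by
        have : 0 < 2 * r ^ 6 + 8 / φ₀ := by positivity
        linarith
      calc 2 * L = 4 * π * r ^ 4 * N := by rw [hN]; field_simp; norm_num
        _ ≤ _ := by gcongr
    have k2 : (Q : ℝ) * N ≤ c * (|θ| * (R : ℝ) ^ γ * N ^ (-γ)) := by
      rw [hΘ]
      have h1 : (Q : ℝ) * N ≤ 8 * h ^ 2 := by
        calc (Q : ℝ) * N ≤ (2 * L) * L := mul_le_mul (hQx.trans hx2) hNL hN0.le (by positivity)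
          _ ≤ 2 * (2 * h) * (2 * h) := by gcongr
          _ = _ := by ring
      have h2 : 8 / φ₀ ≤ c := by
        have : 0 < 2 * r ^ 6 + 4 * π * r ^ 4 := by positivity
        linarith
      calc (Q : ℝ) * N ≤ 8 * h ^ 2 := h1
        _ = 8 / φ₀ * (φ₀ * 1 * h ^ 2) := by field_simp
        _ ≤ _ := by gcongr
    have k3 : |θ| * (R : ℝ) ^ γ * N ^ (-γ) * (Q : ℝ) ^ 3 ≤ c * (R : ℝ) ^ 2 * N := by
      rw [hΘ]
      have h2 : 8 * |φ₁| * (r ^ 4) ^ γ * (2 * π * r ^ 4) ≤ c := by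
        have : 0 < 2 * r ^ 6 + 4 * π * r ^ 4 + 8 / φ₀ := by positivity
        linarith
      have h3 : h ^ 2 * (Q : ℝ) ^ 3 ≤ 8 * (R : ℝ) ^ 2 * L := by
        calc h ^ 2 * (Q : ℝ) ^ 3 ≤ h ^ 2 * x ^ 3 := by gcongr
          _ = (q : ℝ) ^ 3 * L ^ 3 * L ^ 3 / h ^ 4 := by rw [hx]; field_simp
          _ ≤ (G ^ 2 * h) * (2 * h) ^ 3 * L ^ 3 / h ^ 4 := by gcongr
          _ = _ := by rw [hRL]; field_simp; norm_num
      calc φ * (r ^ 4) ^ γ * h ^ 2 * (Q : ℝ) ^ 3 = φ * (r ^ 4) ^ γ * (h ^ 2 * (Q : ℝ) ^ 3) := by ring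
        _ ≤ |φ₁| * (r ^ 4) ^ γ * (8 * (R : ℝ) ^ 2 * L) := by gcongr
        _ = 8 * |φ₁| * (r ^ 4) ^ γ * (2 * π * r ^ 4) * (R : ℝ) ^ 2 * N := by rw [hN]; field_simp
        _ ≤ _ := by gcongr
    have hcN : 2 * r ^ 6 ≤ c := by
      have : 0 < 4 * π * r ^ 4 + 8 / φ₀ := by positivity
      linarith
    have hc2 : 2 ≤ c := by linarith
    have key := hbil R N θ hR1 hN0 hθ0.ne' Q hQ1 k1 k2 k3 R (2 * R) (fun m h1 h2 => by
        have h3 : (m : ℝ) ≤ 2 * R := by exact_mod_cast h2.le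
        exact ⟨by exact_mod_cast h1, h3.trans (by gcongr)⟩) U (fun n hn => by
        simp only [hU, Finset.mem_filter] at hn
        exact ⟨hn.2.1, hn.2.2.trans (by gcongr)⟩) P hdec
      (fun n _ m₁ m₂ m h1 _ => hconv n m₁ m₂ m (hR.trans h1))
      (fun m => a m * ((1 / m * (m / R) ^ e : ℝ) : ℂ)) (fun n => ((R / (2 * π * n)) ^ e : ℝ))
      ((r ^ 4) ^ e * G ^ e) (by positivity) (fun n hn => by
        simp only [hU, Finset.mem_filter] at hn
        have hn0 : (0 : ℝ) < n := hN0.trans_le hn.2.1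
        rw [Complex.norm_real, Real.norm_eq_abs, abs_of_nonneg (by positivity),
          ← Real.mul_rpow (by positivity) hG0.le, ← hNR]
        have := hn.2.1
        gcongr)
    have hsame : ∑ m ∈ Ico R (2 * R), ∑ n ∈ U, a m * (if P m n then
        ((1 / m * (m / (2 * π * n)) ^ e : ℝ) : ℂ) *
          cis ((m / (2 * π * n)) ^ γ * φ) else 0) =
        ∑ m ∈ Ico R (2 * R), ∑ n ∈ U, a m * ((1 / m * (m / R) ^ e : ℝ) : ℂ) *
          ((R / (2 * π * n)) ^ e : ℝ) * (if P m n then cis (θ * (m : ℝ) ^ γ * (n : ℝ) ^ (-γ)) else 0) := by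
      refine Finset.sum_congr rfl fun m hm => Finset.sum_congr rfl fun n hn => ?_
      split_ifs with hp
      · rw [Finset.mem_Ico] at hm
        have hn0 : (0 : ℝ) < n := by exact_mod_cast (hfrac m n hp).1
        have hm0 : (0 : ℝ) < m := by
          have : (R : ℝ) ≤ m := by exact_mod_cast hm.1
          linarith
        have e1 : ((m : ℝ) / (2 * π * n)) ^ e = (m / R) ^ e * (R / (2 * π * n)) ^ e := by
          rw [← Real.mul_rpow (by positivity) (by positivity)]
          congr 1
          field_simp
        have e2 : ((m : ℝ) / (2 * π * n)) ^ γ * φ = θ * (m : ℝ) ^ γ * (n : ℝ) ^ (-γ) := by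
          rw [Real.div_rpow hm0.le (by positivity), Real.mul_rpow (by positivity) hn0.le, hθ,
            Real.rpow_neg (by positivity), Real.rpow_neg hn0.le]
          field_simp
        rw [e1, e2]
        push_cast
        ring
      · simp
    rw [hsame]
    refine key.trans ?_
    have hsum : √(∑ m ∈ Ico R (2 * R), ‖a m * ((1 / m * (m / R) ^ e : ℝ) : ℂ)‖ ^ 2) ≤
        D * 2 ^ e / √R := by
      rw [Real.sqrt_le_left (by positivity), div_pow, Real.sq_sqrt hR0.le]
      have h1 : ∑ m ∈ Ico R (2 * R), ‖a m * ((1 / m * (m / R) ^ e : ℝ) : ℂ)‖ ^ 2 ≤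
          ∑ m ∈ Ico R (2 * R), (D * (1 / R * 2 ^ e)) ^ 2 := by
        refine Finset.sum_le_sum fun m hm => ?_
        rw [Finset.mem_Ico] at hm
        have hm1 : (R : ℝ) ≤ m := by exact_mod_cast hm.1
        have hm2 : (m : ℝ) ≤ 2 * R := by exact_mod_cast hm.2.le
        have hm3 : (m : ℝ) / R ≤ 2 := by rw [div_le_iff₀ hR0]; linarith
        rw [norm_mul, Complex.norm_real, Real.norm_eq_abs, abs_of_nonneg (by positivity)]
        have := ha m hm.1 hm.2
        gcongr
      refine h1.trans (le_of_eq ?_)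
      rw [Finset.sum_const, Nat.card_Ico, nsmul_eq_mul]
      have e1 : ((2 * R - R : ℕ) : ℝ) = R := by congr 1; omega
      rw [e1]
      field_simp
    have hNQ : N * √(R / Q) ≤ 2 * (h / √q) * √R := by
      have hQ0 : (0 : ℝ) < Q := by exact_mod_cast hQ1
      refine le_of_sq_le_sq ?_ (by positivity)
      have h0 : (2 * (h / √q) * √R) ^ 2 = 2 ^ 2 * (h ^ 2 / q) * R := by
        rw [mul_pow, mul_pow 2, div_pow, Real.sq_sqrt (by linarith), Real.sq_sqrt hR0.le]
      rw [h0, mul_pow N, Real.sq_sqrt (by positivity)]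
      have h1 : (q : ℝ) * L ^ 2 ≤ 2 * Q * h ^ 2 := by
        rw [hx, div_le_iff₀ (by positivity)] at hQ2
        exact hQ2
      have h2 : N ^ 2 ≤ L ^ 2 := by gcongr
      rw [← mul_div_assoc, div_le_iff₀ hQ0]
      have h3 : N ^ 2 ≤ 2 ^ 2 * (h ^ 2 / q) * Q := by
        rw [← mul_div_assoc, div_mul_eq_mul_div, le_div_iff₀ (by linarith)]
        have h4 : 0 ≤ Q * h ^ 2 := by positivity
        calc N ^ 2 * q ≤ L ^ 2 * q := mul_le_mul_of_nonneg_right h2 (Nat.cast_nonneg q)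
          _ ≤ 2 ^ 2 * h ^ 2 * Q := by linarith
      calc N ^ 2 * R ≤ 2 ^ 2 * (h ^ 2 / q) * Q * R := mul_le_mul_of_nonneg_right h3 hR0.le
        _ = _ := by ring
    calc C * ((r ^ 4) ^ e * G ^ e) * N * √(R / Q) *
          √(∑ m ∈ Ico R (2 * R), ‖a m * ((1 / m * (m / R) ^ e : ℝ) : ℂ)‖ ^ 2)
        = C * ((r ^ 4) ^ e * G ^ e) * (N * √(R / Q)) *
          √(∑ m ∈ Ico R (2 * R), ‖a m * ((1 / m * (m / R) ^ e : ℝ) : ℂ)‖ ^ 2) := by ring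
      _ ≤ C * ((r ^ 4) ^ e * G ^ e) * (2 * (h / √q) * √R) * (D * 2 ^ e / √R) := by gcongr
      _ = C * (r ^ 4) ^ e * 2 * 2 ^ e * D * (G ^ e * h / √q) := by
          have : 0 < √(R : ℝ) := Real.sqrt_pos.2 hR0
          field_simp
      _ ≤ _ := by
          gcongr
          have : 0 < 2 * r ^ 6 * (r ^ 4) ^ e := by positivity
          linarith

theorem norm_sum_Icc_le_of_dyadic (F : ℕ → ℂ) (M : ℕ) {W : ℝ} (hW : 0 ≤ W)
    (h : ∀ R, 1 ≤ R → R ≤ M → ‖∑ m ∈ Ico R (2 * R), (if m ≤ M then F m else 0)‖ ≤ W) :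
    ‖∑ m ∈ Icc 1 M, F m‖ ≤ (Nat.log 2 M + 1 : ℕ) * W := by
  rw [← Finset.sum_fiberwise_of_maps_to (t := Finset.range (Nat.log 2 M + 1)) (g := Nat.log 2)
    fun n hn => by
      rw [Finset.mem_range, Nat.lt_succ_iff]
      exact Nat.log_mono_right (Finset.mem_Icc.1 hn).2]
  calc _ ≤ ∑ j ∈ Finset.range (Nat.log 2 M + 1), W := by
        refine norm_sum_le_of_le _ fun j _ => ?_
        have e : ∑ m ∈ (Icc 1 M).filter (fun m => Nat.log 2 m = j), F m =
            ∑ m ∈ Ico (2 ^ j) (2 * 2 ^ j), (if m ≤ M then F m else 0) := by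
          rw [← Finset.sum_filter]
          refine Finset.sum_congr ?_ fun _ _ => rfl
          ext m
          simp only [Finset.mem_filter, Finset.mem_Icc, Finset.mem_Ico]
          have hp : 1 ≤ 2 ^ j := Nat.one_le_two_pow
          constructor
          · rintro ⟨⟨h1, h2⟩, h3⟩
            have := (Nat.log_eq_iff (b := 2) (m := j) (n := m)
              (Or.inr ⟨by norm_num, by omega⟩)).1 h3
            rw [pow_succ] at this
            omega
          · rintro ⟨⟨h1, h2⟩, h3⟩
            refine ⟨⟨by omega, h3⟩, (Nat.log_eq_iff (b := 2) (m := j) (n := m)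
              (Or.inr ⟨by norm_num, by omega⟩)).2 ⟨h1, ?_⟩⟩
            rw [pow_succ]
            omega
        rw [e]
        rcases le_or_gt (2 ^ j) M with hj | hj
        · exact h _ Nat.one_le_two_pow hj
        · rw [Finset.sum_eq_zero, norm_zero]
          · exact hW
          · intro m hm
            rw [Finset.mem_Ico] at hm
            rw [if_neg (by omega)]
    _ = _ := by rw [Finset.sum_const, Finset.card_range, nsmul_eq_mul]

theorem sum_Icc_inv_le_log_two (M : ℕ) :
    ∑ m ∈ Icc 1 M, 1 / (m : ℝ) ≤ (Nat.log 2 M + 1 : ℕ) := by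
  have h := norm_sum_Icc_le_of_dyadic (fun m => ((1 / (m : ℝ) : ℝ) : ℂ)) M zero_le_one
    fun R hR _ => by
      have hR0 : (0 : ℝ) < R := by exact_mod_cast hR
      calc _ ≤ ∑ m ∈ Ico R (2 * R), 1 / (R : ℝ) := by
            refine norm_sum_le_of_le _ fun m hm => ?_
            rw [Finset.mem_Ico] at hm
            have hm1 : (R : ℝ) ≤ m := by exact_mod_cast hm.1
            split_ifs
            · rw [Complex.norm_real, Real.norm_eq_abs, abs_of_nonneg (by positivity)]
              gcongr
            · rw [norm_zero]; positivity
        _ = 1 := by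
            rw [Finset.sum_const, Nat.card_Ico, nsmul_eq_mul]
            have e1 : ((2 * R - R : ℕ) : ℝ) = R := by congr 1; omega
            rw [e1, mul_one_div_cancel hR0.ne']
  rw [mul_one, ← Complex.ofReal_sum, Complex.norm_real, Real.norm_eq_abs,
    abs_of_nonneg (Finset.sum_nonneg fun m _ => by positivity)] at h
  exact h

theorem type_one_frequency_le {β r φ₀ φ₁ e : ℝ} (hβ : 2 / 3 ≤ β) (hβ1 : β < 1) (hr : 1 ≤ r)
    (hφ₀ : 0 < φ₀) (he : 0 ≤ e) :
    ∃ C > 0, ∀ A q M V : ℕ, 1 ≤ A → 1 ≤ q → (q : ℝ) ≤ (A : ℝ) ^ (2 / 3 - β / 2) →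
      (M : ℝ) ≤ 2 * (A : ℝ) ^ (1 - β / 2) → ∀ φ : ℝ, φ₀ ≤ φ → φ ≤ φ₁ → ∀ (a : ℕ → ℂ) (D : ℝ),
      0 ≤ D → (∀ m, 1 ≤ m → m ≤ M → ‖a m‖ ≤ D) → ∀ P : ℕ → ℕ → Prop,
      ∀ _ : ∀ m n, Decidable (P m n),
      (∀ n m₁ m₂ m, 1 ≤ m₁ → P m₁ n → P m₂ n → m₁ ≤ m → m ≤ m₂ → P m n) →
      (∀ m n, P m n → (m : ℝ) * (A : ℝ) ^ (β - 1) < r ^ 4 * (2 * π * n) ∧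
        2 * π * n < r ^ 2 * (m * (A : ℝ) ^ (β - 1))) →
      ‖∑ m ∈ Icc 1 M, ∑ n ∈ Icc 1 V, a m * (if P m n then
        ((1 / m * (m / (2 * π * n)) ^ e : ℝ) : ℂ) *
          cis ((m / (2 * π * n)) ^ (β / (1 - β)) * φ) else 0)‖ ≤
        (Nat.log 2 M + 1 : ℕ) * (C * D * ((A : ℝ) ^ ((1 - β) * e) * (A : ℝ) ^ (β / 2) / √q)) := by
  obtain ⟨C, hC, h⟩ := type_one_dyadic (φ₁ := φ₁) hβ hβ1 hr hφ₀ he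
  refine ⟨C, hC, ?_⟩
  intro A q M V hA hq hqA hMA φ hφ hφ' a D hD ha P hdec hconv hP
  refine norm_sum_Icc_le_of_dyadic _ M (by positivity) fun R hR hRM => ?_
  have hRM' : (R : ℝ) ≤ M := by exact_mod_cast hRM
  have key := h A q R V hA hq hqA hR (hRM'.trans hMA) φ hφ hφ'
    (fun m => if m ≤ M then a m else 0) D hD (fun m h1 _ => by
      split_ifs with h3
      · exact ha m (hR.trans h1) h3
      · rwa [norm_zero]) P hdec hconv hP
  refine le_of_eq_of_le (congrArg _ (Finset.sum_congr rfl fun m _ => ?_)) key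
  split_ifs with h3
  · rfl
  · simp

theorem hasDerivAt_phase {β κ u : ℝ} (hκ : κ * β = 1) (hu : 0 < u) :
    HasDerivAt (fun u : ℝ => κ * u ^ β - u) (u ^ (β - 1) - 1) u := by
  refine (((Real.hasDerivAt_rpow_const (p := β) (Or.inl hu.ne')).const_mul κ).sub
    (hasDerivAt_id u)).congr_deriv ?_
  rw [← mul_assoc, hκ, one_mul]

theorem hasDerivAt_phase_deriv {β u : ℝ} (hu : 0 < u) :
    HasDerivAt (fun u : ℝ => u ^ (β - 1) - 1) ((β - 1) * u ^ (β - 2)) u := by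
  refine ((Real.hasDerivAt_rpow_const (p := β - 1) (Or.inl hu.ne')).sub_const 1).congr_deriv ?_
  rw [show β - 1 - 1 = β - 2 by ring]

/-- The boundary weight at an endpoint `X / y`, expressed through the distance from the frequency
`ν` to the phase derivative at the endpoint. -/
theorem phase_boundary_le {β m ν X y δ : ℝ} (hν : 0 < ν) (hX : 0 < X)
    (hy : 0 < y) (hδ : 0 < δ) (hξ : y ^ (1 - β) = m / (2 * π * ν)) :
    1 / ν * (2 / (|(X / y) ^ (β - 1) - 1| + δ)) =
      2 * (1 / (|m * X ^ (β - 1) / (2 * π) - ν| + δ * ν)) := by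
  have hπ := Real.pi_pos
  have e : (X / y) ^ (β - 1) - 1 = (m * X ^ (β - 1) / (2 * π) - ν) / ν := by
    rw [Real.div_rpow hX.le hy.le, show y ^ (β - 1) = (y ^ (1 - β))⁻¹ by
      rw [← Real.rpow_neg hy.le]; congr 1; ring, hξ]
    field_simp
  rw [e, abs_div, abs_of_pos hν]
  have h := abs_nonneg (m * X ^ (β - 1) / (2 * π) - ν)
  have h1 : 0 < |m * X ^ (β - 1) / (2 * π) - ν| + δ * ν := by positivity
  have h2 : 0 < |m * X ^ (β - 1) / (2 * π) - ν| / ν + δ := by positivity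
  field_simp

theorem phase_mem_Icc {β κ r E u : ℝ} (hβ : 0 < β) (hb : 0 ≤ 1 - β) (hE : E * (1 - β) = 1)
    (hr : 1 ≤ r) (hκ : r ^ 4 < κ) (hu : u ∈ Set.Icc ((r ^ 4) ^ (-E)) ((r ^ 4) ^ E)) :
    ((r ^ 4) ^ (-E)) ^ β * (κ - r ^ 4) ≤ κ * u ^ β - u ∧
      κ * u ^ β - u ≤ κ * ((r ^ 4) ^ E) ^ β := by
  have hr4 : 1 ≤ r ^ 4 := one_le_pow₀ hr
  have hU : 0 < (r ^ 4) ^ (-E) := by positivity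
  have hu0 : 0 < u := hU.trans_le hu.1
  constructor
  · have e : κ * u ^ β - u = u ^ β * (κ - u ^ (1 - β)) := by
      rw [mul_sub, ← Real.rpow_add hu0]
      rw [show β + (1 - β) = 1 by ring, Real.rpow_one, mul_comm]
    have h1 : u ^ (1 - β) ≤ r ^ 4 := by
      calc u ^ (1 - β) ≤ ((r ^ 4) ^ E) ^ (1 - β) := by gcongr; exact hu.2
        _ = r ^ 4 := by rw [← Real.rpow_mul (by positivity), hE, Real.rpow_one]
    rw [e]
    have := hu.1
    gcongr
  · have h1 : u ^ β ≤ ((r ^ 4) ^ E) ^ β := by gcongr; exact hu.2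
    have h2 : 0 ≤ κ := by linarith
    nlinarith

/-- The frequencies which are close to the range of the phase derivative. -/
noncomputable def saddleFreqs (β r : ℝ) (A M m : ℕ) : Finset ℕ :=
  (Icc 1 M).filter fun ν => (m : ℝ) * (A : ℝ) ^ (β - 1) < r ^ 4 * (2 * π * ν) ∧
    2 * π * ν < r ^ 2 * (m * (A : ℝ) ^ (β - 1))

theorem mem_saddleFreqs {β r : ℝ} {A M m ν : ℕ} : ν ∈ saddleFreqs β r A M m ↔
    (1 ≤ ν ∧ ν ≤ M) ∧ (m : ℝ) * (A : ℝ) ^ (β - 1) < r ^ 4 * (2 * π * ν) ∧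
      2 * π * ν < r ^ 2 * (m * (A : ℝ) ^ (β - 1)) := by
  rw [saddleFreqs, Finset.mem_filter, Finset.mem_Icc]

/-- Location of the rescaled stationary point `t ^ E`, where `t = m / (2πν)`. -/
theorem saddle_bounds {β r E A B m ν : ℝ} (hE : E * (1 - β) = 1) (hE1 : 1 ≤ E) (hr : 1 ≤ r)
    (hA : 0 < A) (hAB : A ≤ B) (hB : B ≤ r ^ 2 * A) (hm : 0 < m) (hν : 0 < ν)
    (h1 : m * A ^ (β - 1) < r ^ 4 * (2 * π * ν)) (h2 : 2 * π * ν < r ^ 2 * (m * A ^ (β - 1))) :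
    (r ^ 4) ^ (-E) ≤ A / (m / (2 * π * ν)) ^ E ∧
      A / (m / (2 * π * ν)) ^ E ≤ B / (m / (2 * π * ν)) ^ E ∧
      B / (m / (2 * π * ν)) ^ E ≤ (r ^ 4) ^ E := by
  have hπ := Real.pi_pos
  have hr0 : 0 < r := by linarith
  have ht : 0 < m / (2 * π * ν) := by positivity
  set t := m / (2 * π * ν) with htdef
  have hmt : m = t * (2 * π * ν) := by rw [htdef]; field_simp
  have hG : A ^ (β - 1) * A ^ (1 - β) = 1 := by
    rw [← Real.rpow_add hA]; simp
  have hG0 : 0 < A ^ (1 - β) := by positivity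
  have hGE : (A ^ (1 - β)) ^ E = A := by
    rw [← Real.rpow_mul hA.le, mul_comm, hE, Real.rpow_one]
  have t1 : t ≤ r ^ 4 * A ^ (1 - β) := by
    have : t * A ^ (β - 1) ≤ r ^ 4 := by
      rw [hmt] at h1
      have h3 : (t * A ^ (β - 1)) * (2 * π * ν) < r ^ 4 * (2 * π * ν) := by linarith
      exact (lt_of_mul_lt_mul_right h3 (by positivity)).le
    calc t = t * A ^ (β - 1) * A ^ (1 - β) := by rw [mul_assoc, hG, mul_one]
      _ ≤ _ := by gcongr
  have t2 : A ^ (1 - β) ≤ r ^ 2 * t := by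
    have : 1 ≤ r ^ 2 * t * A ^ (β - 1) := by
      rw [hmt] at h2
      have h3 : 1 * (2 * π * ν) < (r ^ 2 * t * A ^ (β - 1)) * (2 * π * ν) := by linarith
      exact (lt_of_mul_lt_mul_right h3 (by positivity)).le
    calc A ^ (1 - β) = 1 * A ^ (1 - β) := by ring
      _ ≤ r ^ 2 * t * A ^ (β - 1) * A ^ (1 - β) := by gcongr
      _ = _ := by rw [mul_assoc (r ^ 2 * t), hG, mul_one]
  have y1 : t ^ E ≤ (r ^ 4) ^ E * A := by
    calc t ^ E ≤ (r ^ 4 * A ^ (1 - β)) ^ E := by gcongr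
      _ = _ := by rw [Real.mul_rpow (by positivity) hG0.le, hGE]
  have y2 : A ≤ (r ^ 2) ^ E * t ^ E := by
    calc A = (A ^ (1 - β)) ^ E := hGE.symm
      _ ≤ (r ^ 2 * t) ^ E := by gcongr
      _ = _ := by rw [Real.mul_rpow (by positivity) ht.le]
  have hy0 : 0 < t ^ E := by positivity
  refine ⟨?_, by gcongr, ?_⟩
  · rw [le_div_iff₀ hy0, Real.rpow_neg (by positivity), inv_mul_le_iff₀ (by positivity)]
    exact y1
  · rw [div_le_iff₀ hy0]
    have h5 : r ^ 2 ≤ (r ^ 2) ^ E := by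
      calc r ^ 2 = (r ^ 2) ^ (1 : ℝ) := (Real.rpow_one _).symm
        _ ≤ _ := Real.rpow_le_rpow_of_exponent_le (one_le_pow₀ hr) hE1
    have h6 : (r ^ 4) ^ E = (r ^ 2) ^ E * (r ^ 2) ^ E := by
      rw [← Real.mul_rpow (by positivity) (by positivity)]; ring_nf
    calc B ≤ r ^ 2 * A := hB
      _ ≤ (r ^ 2) ^ E * ((r ^ 2) ^ E * t ^ E) := by gcongr
      _ = _ := by rw [h6]; ring

theorem saddle_boundary_sum_le {β r A X δ : ℝ} {m : ℕ} (N : Finset ℕ) (hm : 1 ≤ m)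
    (hβ : β < 1) (hr : 1 ≤ r) (hr2 : r ^ 2 ≤ 2 * π)
    (hA : 0 < A) (hX : A ≤ X) (hδ : 0 < δ) (hN : ∀ ν ∈ N, 1 ≤ ν ∧
      (m : ℝ) * A ^ (β - 1) < r ^ 4 * (2 * π * ν) ∧ 2 * π * ν < r ^ 2 * (m * A ^ (β - 1))) :
    ∑ ν ∈ N, 1 / (|m * X ^ (β - 1) / (2 * π) - ν| + δ * ν) ≤
      2 * (r ^ 4 * (2 * π)) / (δ * (m * A ^ (β - 1))) + 16 * √(m * A ^ (β - 1)) := by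
  have hπ := Real.pi_pos
  have hm0 : (0 : ℝ) < m := by exact_mod_cast hm
  have hX0 : 0 < X := hA.trans_le hX
  refine sum_inv_dist_add_le N hδ (by positivity) ?_ (by positivity) fun ν hν => ?_
  · have h1 : X ^ (β - 1) ≤ A ^ (β - 1) :=
      Real.rpow_le_rpow_of_nonpos hA hX (by linarith)
    calc m * X ^ (β - 1) / (2 * π) ≤ m * X ^ (β - 1) :=
          div_le_self (by positivity) (by linarith [Real.pi_gt_three])
      _ ≤ _ := by gcongr
  · obtain ⟨h1, h2, h3⟩ := hN ν hν
    refine ⟨h1, ?_, by linarith⟩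
    have hL : 0 ≤ (m : ℝ) * A ^ (β - 1) := by positivity
    have h4 : 2 * π * ν ≤ 2 * π * (m * A ^ (β - 1)) := by nlinarith
    exact le_of_mul_le_mul_left h4 (by positivity)

set_option maxHeartbeats 2000000 in
theorem type_one_integral_le {β κ r : ℝ} (hβ : 2 / 3 ≤ β) (hβ1 : β < 1) (hκ : κ * β = 1)
    (hr : 1 < r) (hrκ : r ^ 4 < κ) (hr2 : r ^ 2 ≤ 2 * π) :
    ∃ C > 0, ∀ A B M q : ℕ, 1 ≤ A → A ≤ B → (B : ℝ) ≤ r ^ 2 * A →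
      (M : ℝ) ≤ 2 * (A : ℝ) ^ (1 - β / 2) → 1 ≤ q → (q : ℝ) ≤ (A : ℝ) ^ (2 / 3 - β / 2) →
      ∀ (a : ℕ → ℂ) (D : ℝ), 0 ≤ D → (∀ m, 1 ≤ m → m ≤ M → ‖a m‖ ≤ D) →
      ‖∑ m ∈ Icc 1 M, ∑ ν ∈ saddleFreqs β r A M m, a m *
        ∫ x in ((A : ℝ) / m)..((B : ℝ) / m), cis (κ * (m * x) ^ β + -(2 * π * ν) * x)‖ ≤
        C * D * (A / √q) * (Nat.log 2 M + 1 : ℕ) +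
          ∑ m ∈ Icc 1 M, D * (C * ((A : ℝ) ^ (β / 2) / (m * (A : ℝ) ^ (β - 1)) +
            √(m * (A : ℝ) ^ (β - 1)))) := by
  have hπ := Real.pi_pos
  have hβ0 : 0 < β := by linarith
  have hb : 0 < 1 - β := by linarith
  set E : ℝ := 1 / (1 - β) with hEdef
  have hE : E * (1 - β) = 1 := by rw [hEdef]; field_simp
  have hE1 : 1 ≤ E := by rw [hEdef, le_div_iff₀ hb]; linarith
  have hE0 : 0 < E := by linarith
  set γ : ℝ := β / (1 - β) with hγdef
  have hγE : E * β = γ := by rw [hEdef, hγdef]; ring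
  have hEγ : E - γ = 1 := by rw [hEdef, hγdef]; field_simp
  have hr0 : 0 < r := by linarith
  set U₁ : ℝ := (r ^ 4) ^ (-E) with hU₁
  set U₂ : ℝ := (r ^ 4) ^ E with hU₂
  have hU₁0 : 0 < U₁ := by positivity
  have hU₁₂ : U₁ ≤ U₂ := Real.rpow_le_rpow_of_exponent_le (one_le_pow₀ hr.le) (by linarith)
  have hφ₀ : 0 < U₁ ^ β * (κ - r ^ 4) := mul_pos (by positivity) (by linarith)
  obtain ⟨C₀, hC₀, hW₀⟩ := type_one_frequency_le (φ₁ := κ * U₂ ^ β) hβ hβ1 hr.le hφ₀ hE0.le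
  obtain ⟨C₁, hC₁, hW₁⟩ := type_one_frequency_le (φ₁ := κ * U₂ ^ β) hβ hβ1 hr.le hφ₀ zero_le_one
  set c₀ : ℝ := (1 - β) * U₂ ^ (β - 2) with hc₀
  set c₁ : ℝ := (1 - β) * U₁ ^ (β - 2) with hc₁
  have hU₂0 : 0 < U₂ := hU₁0.trans_le hU₁₂
  have hc₀0 : 0 < c₀ := by positivity
  have hc₁0 : 0 < c₁ := by positivity
  set K : ℝ := 2 * (2 * (r ^ 4 * (2 * π))) + 2 * (2 * (r ^ 4 * (2 * π))) + 64 with hK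
  refine ⟨π / c₀ * C₀ + c₁ * π / c₀ * C₁ + K, by positivity, ?_⟩
  intro A B M q hA hAB hBA hMA hq hqA a D hD ha
  have hA1 : (1 : ℝ) ≤ A := by exact_mod_cast hA
  have hA0 : (0 : ℝ) < A := by linarith
  have hAB' : (A : ℝ) ≤ B := by exact_mod_cast hAB
  set h : ℝ := (A : ℝ) ^ (β / 2) with hh
  have hh0 : 0 < h := by positivity
  have hhh : h * h = (A : ℝ) ^ β := by rw [hh, ← Real.rpow_add hA0]; congr 1; ring
  set S : Finset (Σ _ : ℕ, ℕ) := (Icc 1 M).sigma fun m => saddleFreqs β r A M m with hS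
  have hmem : ∀ s ∈ S, (1 ≤ s.1 ∧ s.1 ≤ M) ∧ 1 ≤ s.2 ∧
      (s.1 : ℝ) * (A : ℝ) ^ (β - 1) < r ^ 4 * (2 * π * s.2) ∧
      2 * π * s.2 < r ^ 2 * (s.1 * (A : ℝ) ^ (β - 1)) := by
    intro s hs
    rw [hS, Finset.mem_sigma, Finset.mem_Icc, mem_saddleFreqs] at hs
    exact ⟨hs.1, hs.2.1.1, hs.2.2⟩
  set t : (Σ _ : ℕ, ℕ) → ℝ := fun s => s.1 / (2 * π * s.2) with ht
  have hpos : ∀ s ∈ S, (0 : ℝ) < s.1 ∧ (0 : ℝ) < s.2 ∧ 0 < t s := by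
    intro s hs
    obtain ⟨⟨h1, -⟩, h2, -⟩ := hmem s hs
    have h3 : (0 : ℝ) < s.1 := by exact_mod_cast h1
    have h4 : (0 : ℝ) < s.2 := by exact_mod_cast h2
    exact ⟨h3, h4, by rw [ht]; positivity⟩
  have hbd : ∀ s ∈ S, U₁ ≤ A / t s ^ E ∧ A / t s ^ E ≤ B / t s ^ E ∧ B / t s ^ E ≤ U₂ := by
    intro s hs
    obtain ⟨-, -, h1, h2⟩ := hmem s hs
    obtain ⟨h3, h4, -⟩ := hpos s hs
    exact saddle_bounds hE hE1 hr.le hA0 hAB' hBA h3 h4 h1 h2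
  set c : (Σ _ : ℕ, ℕ) → ℂ := fun s => a s.1 * ((t s ^ E / s.1 : ℝ) : ℂ) with hc
  have hrw : ∑ m ∈ Icc 1 M, ∑ ν ∈ saddleFreqs β r A M m, a m *
      (∫ x in ((A : ℝ) / m)..((B : ℝ) / m), cis (κ * (m * x) ^ β + -(2 * π * ν) * x)) =
      ∑ s ∈ S, c s * ∫ u in (A / t s ^ E)..(B / t s ^ E), cis (t s ^ γ * (κ * u ^ β - u)) := by
    rw [hS, Finset.sum_sigma']
    refine Finset.sum_congr rfl fun s hs => ?_
    obtain ⟨h3, h4, h5⟩ := hpos s hs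
    have hξ : (t s ^ E) ^ (β - 1) = 2 * π * s.2 / s.1 := by
      rw [← Real.rpow_mul h5.le, show E * (β - 1) = -1 by linarith, Real.rpow_neg_one, ht,
        inv_div]
    rw [integral_cis_substitution h3 (by positivity) hξ hA0.le hAB', ← mul_assoc]
    simp only [← Real.rpow_mul h5.le, hγE, hc]
  rw [hrw]
  -- the two families of exponential sums at a fixed point
  have hconv : ∀ u : ℝ, ∀ n m₁ m₂ m : ℕ, 1 ≤ m₁ →
      (((m₁ : ℝ) * (A : ℝ) ^ (β - 1) < r ^ 4 * (2 * π * n) ∧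
        2 * π * n < r ^ 2 * (m₁ * (A : ℝ) ^ (β - 1))) ∧
        A / (m₁ / (2 * π * n) : ℝ) ^ E < u ∧ u ≤ B / (m₁ / (2 * π * n) : ℝ) ^ E) →
      (((m₂ : ℝ) * (A : ℝ) ^ (β - 1) < r ^ 4 * (2 * π * n) ∧
        2 * π * n < r ^ 2 * (m₂ * (A : ℝ) ^ (β - 1))) ∧
        A / (m₂ / (2 * π * n) : ℝ) ^ E < u ∧ u ≤ B / (m₂ / (2 * π * n) : ℝ) ^ E) →
      m₁ ≤ m → m ≤ m₂ →
      (((m : ℝ) * (A : ℝ) ^ (β - 1) < r ^ 4 * (2 * π * n) ∧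
        2 * π * n < r ^ 2 * (m * (A : ℝ) ^ (β - 1))) ∧
        A / (m / (2 * π * n) : ℝ) ^ E < u ∧ u ≤ B / (m / (2 * π * n) : ℝ) ^ E) := by
    intro u n m₁ m₂ m hm₁ p₁ p₂ h1 h2
    have h1' : (m₁ : ℝ) ≤ m := by exact_mod_cast h1
    have h2' : (m : ℝ) ≤ m₂ := by exact_mod_cast h2
    have hm₁' : (0 : ℝ) < m₁ := by exact_mod_cast hm₁
    have hm' : (0 : ℝ) < m := by linarith
    have hX : 0 < (A : ℝ) ^ (β - 1) := by positivity
    have hn : (0 : ℝ) < n := by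
      have : 0 < r ^ 4 * (2 * π * n) := lt_of_le_of_lt (by positivity) p₁.1.1
      by_contra hneg
      have : r ^ 4 * (2 * π * n) ≤ 0 := mul_nonpos_of_nonneg_of_nonpos (by positivity)
        (mul_nonpos_of_nonneg_of_nonpos (by positivity) (not_lt.1 hneg))
      linarith
    refine ⟨⟨lt_of_le_of_lt ?_ p₂.1.1, lt_of_lt_of_le p₁.1.2 ?_⟩, lt_of_le_of_lt ?_ p₁.2.1,
      le_trans p₂.2.2 ?_⟩ <;> gcongr
  have hsums : ∀ (e : ℝ) (g : (Σ _ : ℕ, ℕ) → ℝ → ℂ) (u : ℝ) (dec : ∀ m n : ℕ, Decidable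
      (((m : ℝ) * (A : ℝ) ^ (β - 1) < r ^ 4 * (2 * π * n) ∧
        2 * π * n < r ^ 2 * (m * (A : ℝ) ^ (β - 1))) ∧
        A / (m / (2 * π * n) : ℝ) ^ E < u ∧ u ≤ B / (m / (2 * π * n) : ℝ) ^ E)),
      (∀ s ∈ S, c s * g s u = a s.1 * (((1 / s.1 * t s ^ e : ℝ) : ℂ) *
        cis (t s ^ γ * (κ * u ^ β - u)))) →
      ∑ s ∈ S, c s * (if A / t s ^ E < u ∧ u ≤ B / t s ^ E then g s u else 0) =
      ∑ m ∈ Icc 1 M, ∑ n ∈ Icc 1 M, a m *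
        (if ((m : ℝ) * (A : ℝ) ^ (β - 1) < r ^ 4 * (2 * π * n) ∧
        2 * π * n < r ^ 2 * (m * (A : ℝ) ^ (β - 1))) ∧
        A / (m / (2 * π * n) : ℝ) ^ E < u ∧ u ≤ B / (m / (2 * π * n) : ℝ) ^ E then
        ((1 / m * (m / (2 * π * n)) ^ e : ℝ) : ℂ) *
          cis ((m / (2 * π * n)) ^ γ * (κ * u ^ β - u)) else 0) := by
    intro e g u dec hg
    rw [hS, Finset.sum_sigma]
    refine Finset.sum_congr rfl fun m hm => ?_
    rw [saddleFreqs, Finset.sum_filter]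
    refine Finset.sum_congr rfl fun n hn => ?_
    by_cases p : (m : ℝ) * (A : ℝ) ^ (β - 1) < r ^ 4 * (2 * π * n) ∧
        2 * π * n < r ^ 2 * (m * (A : ℝ) ^ (β - 1))
    · have hs : (⟨m, n⟩ : Σ _ : ℕ, ℕ) ∈ S := by
        rw [hS, Finset.mem_sigma]
        exact ⟨hm, mem_saddleFreqs.2 ⟨Finset.mem_Icc.1 hn, p⟩⟩
      have hg' := hg _ hs
      by_cases p' : A / (m / (2 * π * n) : ℝ) ^ E < u ∧ u ≤ B / (m / (2 * π * n) : ℝ) ^ E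
      · rw [if_pos p, if_pos p', if_pos ⟨p, p'⟩]
        exact hg'
      · rw [if_pos p, if_neg p', if_neg fun hh => p' hh.2, mul_zero, mul_zero]
    · rw [if_neg p, if_neg fun hh => p hh.1, mul_zero]
  have hg0 : ∀ u : ℝ, ∀ s ∈ S, c s * cis (t s ^ γ * (κ * u ^ β - u)) =
      a s.1 * (((1 / s.1 * t s ^ E : ℝ) : ℂ) * cis (t s ^ γ * (κ * u ^ β - u))) := by
    intro u s _
    change a s.1 * ((t s ^ E / s.1 : ℝ) : ℂ) * _ = _
    rw [show t s ^ E / s.1 = 1 / s.1 * t s ^ E by ring, mul_assoc]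
  have hg1 : ∀ u : ℝ, ∀ s ∈ S, c s * (((1 / t s ^ γ : ℝ) : ℂ) * cis (t s ^ γ * (κ * u ^ β - u))) =
      a s.1 * (((1 / s.1 * t s ^ (1 : ℝ) : ℝ) : ℂ) * cis (t s ^ γ * (κ * u ^ β - u))) := by
    intro u s hs
    have h5 := (hpos s hs).2.2
    have e1 : t s ^ (1 : ℝ) = t s ^ E * (1 / t s ^ γ) := by
      calc t s ^ (1 : ℝ) = t s ^ (E - γ) := by rw [hEγ]
        _ = _ := by rw [Real.rpow_sub h5, div_eq_mul_one_div]
    change a s.1 * ((t s ^ E / s.1 : ℝ) : ℂ) * _ = _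
    rw [e1, show 1 / s.1 * (t s ^ E * (1 / t s ^ γ)) = t s ^ E / s.1 * (1 / t s ^ γ) by ring,
      Complex.ofReal_mul (t s ^ E / s.1), mul_assoc, mul_assoc]
  have key := norm_sum_integral_cis_smoothed_le S c (fun s => t s ^ γ) (fun s => A / t s ^ E)
    (fun s => B / t s ^ E) (φ := fun u => κ * u ^ β - u) (φ' := fun u => u ^ (β - 1) - 1)
    (φ'' := fun u => (β - 1) * u ^ (β - 2)) (δ := 1 / h) (U₁ := U₁) (U₂ := U₂) (c₀ := c₀) (c₁ := c₁)
    (W₀ := (Nat.log 2 M + 1 : ℕ) * (C₀ * D * ((A : ℝ) ^ ((1 - β) * E) * h / √q)))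
    (W₁ := (Nat.log 2 M + 1 : ℕ) * (C₁ * D * ((A : ℝ) ^ ((1 - β) * 1) * h / √q)))
    (by positivity) hU₁₂ hc₀0
    (fun u hu => hasDerivAt_phase hκ (hU₁0.trans_le hu.1))
    (fun u hu => hasDerivAt_phase_deriv (hU₁0.trans_le hu.1))
    (continuousOn_const.mul (ContinuousOn.rpow_const continuousOn_id
      fun u hu => Or.inl (hU₁0.trans_le hu.1).ne'))
    (fun u hu => by
      have : U₂ ^ (β - 2) ≤ u ^ (β - 2) :=
        Real.rpow_le_rpow_of_nonpos (hU₁0.trans_le hu.1) hu.2 (by linarith)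
      rw [hc₀]
      linarith [mul_le_mul_of_nonneg_left this hb.le])
    (fun u hu => by
      have : u ^ (β - 2) ≤ U₁ ^ (β - 2) :=
        Real.rpow_le_rpow_of_nonpos hU₁0 hu.1 (by linarith)
      rw [hc₁]
      linarith [mul_le_mul_of_nonneg_left this hb.le])
    (fun s hs => Real.rpow_pos_of_pos (hpos s hs).2.2 _)
    (fun s hs => (hbd s hs).1) (fun s hs => (hbd s hs).2.1) (fun s hs => (hbd s hs).2.2)
    (fun u hu => by
      obtain ⟨f1, f2⟩ := phase_mem_Icc hβ0 hb.le hE hr.le hrκ hu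
      rw [hsums E (fun s u => cis (t s ^ γ * (κ * u ^ β - u))) u
        (fun m n => Classical.propDecidable _) (hg0 u)]
      exact hW₀ A q M M hA hq hqA hMA _ f1 f2 a D hD ha _ _ (hconv u) fun m n p => p.1)
    (fun u hu => by
      obtain ⟨f1, f2⟩ := phase_mem_Icc hβ0 hb.le hE hr.le hrκ hu
      rw [hsums 1 (fun s u => ((1 / t s ^ γ : ℝ) : ℂ) * cis (t s ^ γ * (κ * u ^ β - u))) u
        (fun m n => Classical.propDecidable _) (hg1 u)]
      exact hW₁ A q M M hA hq hqA hMA _ f1 f2 a D hD ha _ _ (hconv u) fun m n p => p.1)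
  refine key.trans ?_
  set LM : ℝ := ((Nat.log 2 M + 1 : ℕ) : ℝ) with hLM
  have hLM0 : 0 ≤ LM := Nat.cast_nonneg _
  have e0 : (A : ℝ) ^ ((1 - β) * E) = A := by rw [mul_comm, hE, Real.rpow_one]
  have e1 : (A : ℝ) ^ ((1 - β) * 1) * (h * h) = A := by
    rw [hhh, ← Real.rpow_add hA0]; ring_nf; rw [Real.rpow_one]
  have hsq : 0 < √(q : ℝ) := Real.sqrt_pos.2 (by exact_mod_cast hq)
  have b0 : π / c₀ * (1 / h) * (LM * (C₀ * D * ((A : ℝ) ^ ((1 - β) * E) * h / √q))) =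
      π / c₀ * C₀ * (D * (A / √q) * LM) := by
    rw [e0]; field_simp
  have b1 : c₁ * π / (c₀ * (1 / h)) * (LM * (C₁ * D * ((A : ℝ) ^ ((1 - β) * 1) * h / √q))) =
      c₁ * π / c₀ * C₁ * (D * (A / √q) * LM) := by
    calc _ = c₁ * π / c₀ * C₁ * (D * ((A : ℝ) ^ ((1 - β) * 1) * (h * h) / √q) * LM) := by
          field_simp
      _ = _ := by rw [e1]
  have b2 : ∑ s ∈ S, ‖c s‖ / t s ^ γ * (2 / (|(A / t s ^ E) ^ (β - 1) - 1| + 1 / h) +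
      2 / (|(B / t s ^ E) ^ (β - 1) - 1| + 1 / h)) ≤
      ∑ m ∈ Icc 1 M, D * (K * (h / (m * (A : ℝ) ^ (β - 1)) + √(m * (A : ℝ) ^ (β - 1)))) := by
    calc _ ≤ ∑ s ∈ S, D * (2 * (1 / (|s.1 * (A : ℝ) ^ (β - 1) / (2 * π) - s.2| + 1 / h * s.2)) +
          2 * (1 / (|s.1 * (B : ℝ) ^ (β - 1) / (2 * π) - s.2| + 1 / h * s.2))) := by
          refine Finset.sum_le_sum fun s hs => ?_
          obtain ⟨h3, h4, h5⟩ := hpos s hs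
          have hξ : (t s ^ E) ^ (1 - β) = s.1 / (2 * π * s.2) := by
            rw [← Real.rpow_mul h5.le, hE, Real.rpow_one]
          have hB0 : (0 : ℝ) < B := by linarith
          rw [← phase_boundary_le h4 hA0 (by positivity) (by positivity) hξ,
            ← phase_boundary_le h4 hB0 (by positivity) (by positivity) hξ, ← mul_add, ← mul_assoc]
          refine mul_le_mul_of_nonneg_right ?_ (by positivity)
          have e2 : t s ^ E = t s * t s ^ γ := by
            rw [← Real.rpow_one_add' h5.le (by rw [← hEγ]; linarith)]
            congr 1
            linarith
          have e3 : ‖c s‖ / t s ^ γ = ‖a s.1‖ * (1 / (2 * π * s.2)) := by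
            have h6 : 0 < t s ^ γ := by positivity
            rw [hc, norm_mul, Complex.norm_real, Real.norm_eq_abs, abs_of_pos (by positivity), e2]
            have h7 : t s / s.1 = 1 / (2 * π * s.2) := by rw [ht]; field_simp
            rw [← h7]
            field_simp
          rw [e3]
          have h8 := hmem s hs
          refine mul_le_mul (ha _ h8.1.1 h8.1.2) ?_ (by positivity) hD
          apply one_div_le_one_div_of_le h4
          nlinarith [Real.pi_gt_three]
      _ ≤ _ := by
          rw [hS, Finset.sum_sigma]
          refine Finset.sum_le_sum fun m hm => ?_
          rw [← Finset.mul_sum]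
          refine mul_le_mul_of_nonneg_left ?_ hD
          rw [Finset.sum_add_distrib, ← Finset.mul_sum, ← Finset.mul_sum]
          have hm1 := (Finset.mem_Icc.1 hm).1
          have hN : ∀ ν ∈ saddleFreqs β r A M m, 1 ≤ ν ∧
              (m : ℝ) * (A : ℝ) ^ (β - 1) < r ^ 4 * (2 * π * ν) ∧
              2 * π * ν < r ^ 2 * (m * (A : ℝ) ^ (β - 1)) := fun ν hν =>
            ⟨(mem_saddleFreqs.1 hν).1.1, (mem_saddleFreqs.1 hν).2⟩
          have s1 := saddle_boundary_sum_le (δ := 1 / h) _ hm1 hβ1 hr.le hr2 hA0 le_rfl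
            (by positivity) hN
          have s2 := saddle_boundary_sum_le (δ := 1 / h) _ hm1 hβ1 hr.le hr2 hA0 hAB'
            (by positivity) hN
          have hm0 : (0 : ℝ) < m := by exact_mod_cast hm1
          set L : ℝ := m * (A : ℝ) ^ (β - 1) with hL
          have hL0 : 0 < L := by positivity
          have e4 : 2 * (r ^ 4 * (2 * π)) / (1 / h * L) = 2 * (r ^ 4 * (2 * π)) * (h / L) := by
            field_simp
          rw [e4] at s1 s2
          have hsL : 0 ≤ √L := Real.sqrt_nonneg _
          have hhL : 0 ≤ h / L := by positivity
          have hr4 : 0 ≤ r ^ 4 * (2 * π) := by positivity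
          rw [hK]
          linarith [mul_nonneg hr4 hsL]
  rw [b0, b1]
  have hY : 0 ≤ D * (A / √q) * LM := by positivity
  have b3 : ∑ m ∈ Icc 1 M, D * (K * (h / (m * (A : ℝ) ^ (β - 1)) + √(m * (A : ℝ) ^ (β - 1)))) ≤
      ∑ m ∈ Icc 1 M, D * ((π / c₀ * C₀ + c₁ * π / c₀ * C₁ + K) *
        (h / (m * (A : ℝ) ^ (β - 1)) + √(m * (A : ℝ) ^ (β - 1)))) := by
    refine Finset.sum_le_sum fun m _ => ?_
    have : 0 ≤ π / c₀ * C₀ + c₁ * π / c₀ * C₁ := by positivity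
    gcongr
    linarith
  have hK0 : 0 < K := by positivity
  have := b2.trans b3
  have hKY := mul_nonneg hK0.le hY
  have e5 : (π / c₀ * C₀ + c₁ * π / c₀ * C₁ + K) * D * (A / √q) * LM =
      π / c₀ * C₀ * (D * (A / √q) * LM) + c₁ * π / c₀ * C₁ * (D * (A / √q) * LM) +
        K * (D * (A / √q) * LM) := by ring
  rw [e5]
  linarith

theorem type_one_error_le {β A : ℝ} {M q : ℕ} (hβ : 2 / 3 ≤ β) (hβ1 : β < 1) (hA : 1 ≤ A)
    (hM : (M : ℝ) ≤ 2 * A ^ (1 - β / 2)) (hq : 1 ≤ q) (hqA : (q : ℝ) ≤ A ^ (2 / 3 - β / 2)) :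
    ∑ m ∈ Icc 1 M, (1 + A ^ (β / 2) / (m * A ^ (β - 1)) + √(m * A ^ (β - 1))) ≤
      7 * (A / √q * (Nat.log 2 M + 1 : ℕ)) := by
  have hA0 : 0 < A := by linarith
  set L : ℝ := ((Nat.log 2 M + 1 : ℕ) : ℝ) with hL
  have hL1 : 1 ≤ L := by rw [hL]; push_cast; linarith [(Nat.cast_nonneg (Nat.log 2 M) : (0:ℝ) ≤ _)]
  have hq0 : (0 : ℝ) < q := by exact_mod_cast hq
  have hsq : 0 < √(q : ℝ) := Real.sqrt_pos.2 hq0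
  set G : ℝ := A / √q with hG
  have hG1 : A ^ (1 - β / 4) ≤ G := by
    rw [hG, le_div_iff₀ hsq]
    have h1 : √(q : ℝ) ≤ A ^ (β / 4) := by
      rw [Real.sqrt_le_left (by positivity), ← Real.rpow_natCast, ← Real.rpow_mul hA0.le]
      refine hqA.trans (Real.rpow_le_rpow_of_exponent_le hA ?_)
      push_cast
      linarith
    calc A ^ (1 - β / 4) * √q ≤ A ^ (1 - β / 4) * A ^ (β / 4) := by gcongr
      _ = A := by rw [← Real.rpow_add hA0]; norm_num
  have hG2 : A ^ (1 - β / 2) ≤ G :=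
    (Real.rpow_le_rpow_of_exponent_le hA (by linarith)).trans hG1
  have hG0 : 0 < G := by positivity
  have hGL : G ≤ G * L := le_mul_of_one_le_right hG0.le hL1
  have b1 : ∑ m ∈ Icc 1 M, (1 : ℝ) ≤ 2 * (G * L) := by
    simp only [Finset.sum_const, Nat.card_Icc, Nat.add_sub_cancel, nsmul_eq_mul, mul_one]
    linarith
  have b2 : ∑ m ∈ Icc 1 M, A ^ (β / 2) / (m * A ^ (β - 1)) ≤ G * L := by
    have e : A ^ (β / 2) / A ^ (β - 1) = A ^ (1 - β / 2) := by
      rw [← Real.rpow_sub hA0]; congr 1; ring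
    calc _ = A ^ (1 - β / 2) * ∑ m ∈ Icc 1 M, 1 / (m : ℝ) := by
          rw [Finset.mul_sum, ← e]
          refine Finset.sum_congr rfl fun m hm => ?_
          have : (0 : ℝ) < m := by exact_mod_cast (Finset.mem_Icc.1 hm).1
          have := Real.rpow_pos_of_pos hA0 (β - 1)
          field_simp
      _ ≤ G * L := mul_le_mul hG2 (sum_Icc_inv_le_log_two M) (by positivity) hG0.le
  have b3 : ∑ m ∈ Icc 1 M, √(m * A ^ (β - 1)) ≤ 4 * (G * L) := by
    have h1 : ∀ m ∈ Icc 1 M, √(m * A ^ (β - 1)) ≤ 2 * A ^ (β / 4) := by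
      intro m hm
      have hm' : (m : ℝ) ≤ M := by exact_mod_cast (Finset.mem_Icc.1 hm).2
      rw [Real.sqrt_le_left (by positivity)]
      calc (m : ℝ) * A ^ (β - 1) ≤ 2 * A ^ (1 - β / 2) * A ^ (β - 1) := by gcongr; linarith
        _ = 2 * A ^ (β / 2) := by
          rw [mul_assoc, ← Real.rpow_add hA0]; ring_nf
        _ ≤ 4 * A ^ (β / 2) := by gcongr; norm_num
        _ = (2 * A ^ (β / 4)) ^ 2 := by
          rw [mul_pow, ← Real.rpow_natCast (A ^ (β / 4)), ← Real.rpow_mul hA0.le]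
          norm_num
          ring_nf
    calc _ ≤ ∑ m ∈ Icc 1 M, 2 * A ^ (β / 4) := Finset.sum_le_sum h1
      _ = M * (2 * A ^ (β / 4)) := by simp
      _ ≤ 2 * A ^ (1 - β / 2) * (2 * A ^ (β / 4)) := by gcongr
      _ = 4 * (A ^ (1 - β / 2) * A ^ (β / 4)) := by ring
      _ = 4 * A ^ (1 - β / 4) := by rw [← Real.rpow_add hA0]; ring_nf
      _ ≤ 4 * (G * L) := by linarith
  rw [Finset.sum_add_distrib, Finset.sum_add_distrib]
  linarith

theorem type_one_bound {β κ r : ℝ} (hβ : 2 / 3 ≤ β) (hβ1 : β < 1) (hκ : κ * β = 1)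
    (hr : 1 < r) (hrκ : r ^ 4 < κ) (hr2 : r ^ 2 ≤ 2 * π) :
    ∃ C > 0, ∀ A B M q : ℕ, 1 ≤ A → A ≤ B → (B : ℝ) ≤ r ^ 2 * A →
      (M : ℝ) ≤ 2 * (A : ℝ) ^ (1 - β / 2) → (M : ℝ) * r ≤ (r - 1) * A →
      1 ≤ q → (q : ℝ) ≤ (A : ℝ) ^ (2 / 3 - β / 2) →
      ∀ (a : ℕ → ℂ) (D : ℝ), 0 ≤ D → (∀ m, 1 ≤ m → m ≤ M → ‖a m‖ ≤ D) →
      ‖∑ m ∈ Icc 1 M, a m * ∑ n ∈ Ioc (A / m) (B / m), cis (κ * ((m * n : ℕ) : ℝ) ^ β)‖ ≤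
        C * D * (A / √q) * (Nat.log 2 M + 1 : ℕ) := by
  have hπ := Real.pi_pos
  obtain ⟨C₁, hC₁, h₁⟩ := poisson_rpow (by linarith) hβ1 hκ hr
  obtain ⟨C₂, hC₂, h₂⟩ := type_one_integral_le hβ hβ1 hκ hr hrκ hr2
  refine ⟨8 * (C₁ + C₂), by positivity, ?_⟩
  intro A B M q hA hAB hBA hMA hMr hq hqA a D hD ha
  have hA1 : (1 : ℝ) ≤ A := by exact_mod_cast hA
  have hA0 : (0 : ℝ) < A := by linarith
  have hr0 : 0 < r := by linarith
  set X : ℝ := (A : ℝ) ^ (β - 1) with hX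
  have hX0 : 0 < X := by positivity
  have hX1 : X ≤ 1 := Real.rpow_le_one_of_one_le_of_nonpos hA1 (by linarith)
  set L : ℝ := ((Nat.log 2 M + 1 : ℕ) : ℝ) with hL
  have hpoisson : ∀ m ∈ Icc 1 M, ‖∑ n ∈ Ioc (A / m) (B / m), cis (κ * ((m * n : ℕ) : ℝ) ^ β) -
      ∑ ν ∈ saddleFreqs β r A M m,
        ∫ x in ((A : ℝ) / m)..((B : ℝ) / m), cis (κ * (m * x) ^ β + -(2 * π * ν) * x)‖ ≤
        C₁ * (1 + 1 / (m * X) + √(m * X)) := by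
    intro m hm
    obtain ⟨hm1, hmM⟩ := Finset.mem_Icc.1 hm
    have hmM' : (m : ℝ) ≤ M := by exact_mod_cast hmM
    have hm0 : (0 : ℝ) < m := by exact_mod_cast hm1
    refine h₁ A B m _ hm1 hA ((by gcongr : (m : ℝ) * r ≤ M * r).trans hMr) hAB hBA ?_ ?_
    · intro ν hν
      obtain ⟨⟨hν1, -⟩, -, h⟩ := mem_saddleFreqs.1 hν
      refine ⟨hν1, ?_⟩
      have h3 : 2 * π * ν < 2 * π * (m * X) :=
        h.trans_le (mul_le_mul_of_nonneg_right hr2 (by positivity))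
      exact (lt_of_mul_lt_mul_left h3 (by positivity)).le
    · intro ν hν1 hν
      by_cases hνM : ν ≤ M
      · by_contra! hcon
        exact hν (mem_saddleFreqs.2 ⟨⟨hν1, hνM⟩, hcon⟩)
      · right
        have h4 : (M : ℝ) ≤ ν := by exact_mod_cast (not_le.1 hνM).le
        have h5 : (m : ℝ) * X ≤ ν := by
          calc (m : ℝ) * X ≤ m * 1 := by gcongr
            _ ≤ ν := by linarith
        exact mul_le_mul hr2 h5 (by positivity) (by positivity)
  have hmain := h₂ A B M q hA hAB hBA hMA hq hqA a D hD ha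
  have herr := type_one_error_le hβ hβ1 hA1 hMA hq hqA
  have hh1 : 1 ≤ (A : ℝ) ^ (β / 2) := Real.one_le_rpow hA1 (by linarith)
  have hsplit : ∑ m ∈ Icc 1 M, a m * ∑ n ∈ Ioc (A / m) (B / m), cis (κ * ((m * n : ℕ) : ℝ) ^ β) =
      ∑ m ∈ Icc 1 M, a m * (∑ n ∈ Ioc (A / m) (B / m), cis (κ * ((m * n : ℕ) : ℝ) ^ β) -
        ∑ ν ∈ saddleFreqs β r A M m,
          ∫ x in ((A : ℝ) / m)..((B : ℝ) / m), cis (κ * (m * x) ^ β + -(2 * π * ν) * x)) +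
      ∑ m ∈ Icc 1 M, ∑ ν ∈ saddleFreqs β r A M m, a m *
        ∫ x in ((A : ℝ) / m)..((B : ℝ) / m), cis (κ * (m * x) ^ β + -(2 * π * ν) * x) := by
    rw [← Finset.sum_add_distrib]
    refine Finset.sum_congr rfl fun m _ => ?_
    rw [← Finset.mul_sum]
    ring
  rw [hsplit]
  have hfirst : ‖∑ m ∈ Icc 1 M, a m * (∑ n ∈ Ioc (A / m) (B / m),
        cis (κ * ((m * n : ℕ) : ℝ) ^ β) - ∑ ν ∈ saddleFreqs β r A M m,
          ∫ x in ((A : ℝ) / m)..((B : ℝ) / m), cis (κ * (m * x) ^ β + -(2 * π * ν) * x))‖ ≤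
      D * C₁ * (7 * (A / √q * L)) := by
    calc _ ≤ ∑ m ∈ Icc 1 M, D * C₁ *
          (1 + (A : ℝ) ^ (β / 2) / (m * X) + √(m * X)) := by
          refine (norm_sum_le _ _).trans (Finset.sum_le_sum fun m hm => ?_)
          obtain ⟨hm1, hmM⟩ := Finset.mem_Icc.1 hm
          have hm0 : (0 : ℝ) < m := by exact_mod_cast hm1
          rw [norm_mul, mul_assoc]
          refine mul_le_mul (ha m hm1 hmM) ((hpoisson m hm).trans ?_) (norm_nonneg _) hD
          have : 1 / (m * X) ≤ (A : ℝ) ^ (β / 2) / (m * X) :=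
            div_le_div_of_nonneg_right hh1 (by positivity)
          refine mul_le_mul_of_nonneg_left ?_ hC₁.le
          linarith
      _ ≤ _ := by
          rw [← Finset.mul_sum]
          exact mul_le_mul_of_nonneg_left herr (by positivity)
  have hlast : ∑ m ∈ Icc 1 M, D * (C₂ * ((A : ℝ) ^ (β / 2) / (m * X) + √(m * X))) ≤
      D * C₂ * (7 * (A / √q * L)) := by
    calc _ = D * C₂ * ∑ m ∈ Icc 1 M, ((A : ℝ) ^ (β / 2) / (m * X) + √(m * X)) := by
          rw [Finset.mul_sum]
          exact Finset.sum_congr rfl fun m _ => (mul_assoc _ _ _).symm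
      _ ≤ _ := by
          refine mul_le_mul_of_nonneg_left (le_trans (Finset.sum_le_sum fun m _ => ?_) herr)
            (by positivity)
          rw [add_assoc]
          linarith
  have := (norm_add_le _ _).trans (add_le_add hfirst hmain)
  have h0 : 0 ≤ C₁ * D * (A / √q) * L := by positivity
  linarith

theorem natLog_add_one_le_rpow {ε : ℝ} (hε : 0 < ε) :
    ∃ C > 0, ∀ n : ℕ, 1 ≤ n → ((Nat.log 2 n + 1 : ℕ) : ℝ) ≤ C * (n : ℝ) ^ ε := by
  have hl2 : 0 < Real.log 2 := Real.log_pos (by norm_num)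
  refine ⟨1 / (Real.log 2 * ε) + 1, by positivity, fun n hn => ?_⟩
  have hn1 : (1 : ℝ) ≤ n := by exact_mod_cast hn
  have h1 : (Nat.log 2 n : ℝ) * Real.log 2 ≤ Real.log n := by
    rw [← Real.log_pow]
    exact Real.log_le_log (by positivity)
      (by exact_mod_cast Nat.pow_log_le_self 2 (by omega : n ≠ 0))
  have h2 := Real.log_le_rpow_div (by linarith : (0 : ℝ) ≤ n) hε
  have h3 : (Nat.log 2 n : ℝ) ≤ 1 / (Real.log 2 * ε) * (n : ℝ) ^ ε := by
    calc (Nat.log 2 n : ℝ) ≤ Real.log n / Real.log 2 := (le_div_iff₀ hl2).2 h1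
      _ ≤ ((n : ℝ) ^ ε / ε) / Real.log 2 := by gcongr
      _ = _ := by field_simp
  have h4 : 1 ≤ (n : ℝ) ^ ε := Real.one_le_rpow hn1 hε.le
  push_cast
  linarith

theorem sum_ite_mul_eq_sum_Ioc_div {A B m : ℕ} (hm : 1 ≤ m) (g : ℕ → ℂ) :
    ∑ n ∈ Icc 1 B, (if A < m * n ∧ m * n ≤ B then g n else 0) = ∑ n ∈ Ioc (A / m) (B / m), g n := by
  rw [← Finset.sum_filter]
  refine Finset.sum_congr ?_ fun _ _ => rfl
  ext n
  rw [Finset.mem_filter, Finset.mem_Icc, Finset.mem_Ioc, Nat.div_lt_iff_lt_mul hm,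
    Nat.le_div_iff_mul_le hm, mul_comm m n]
  refine ⟨fun h => h.2, fun h => ⟨⟨?_, (Nat.le_mul_of_pos_right n hm).trans h.2⟩, h⟩⟩
  exact Nat.pos_of_mul_pos_right (Nat.zero_lt_of_lt h.1)

theorem exists_cutoffs {β r : ℝ} (hβ : 2 / 3 ≤ β) (hβ1 : β < 1) (hr : 1 < r) :
    ∃ A₀ : ℕ, ∀ A : ℕ, A₀ ≤ A → 1 ≤ A ∧ ∃ M q : ℕ, 4 ≤ M ∧ 1 ≤ q ∧ q * q ≤ M ∧ M * q ≤ A ∧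
      (A : ℝ) ^ (1 - β / 2) ≤ M ∧ (M : ℝ) ≤ 2 * (A : ℝ) ^ (1 - β / 2) ∧
      (M : ℝ) * r ≤ (r - 1) * A ∧ (q : ℝ) ≤ (A : ℝ) ^ (2 / 3 - β / 2) ∧
      A / √q ≤ 4 * (A : ℝ) ^ (2 / 3 + β / 4) := by
  have t1 := (tendsto_rpow_atTop (by linarith : 0 < 2 / 3 - β / 2)).comp
    (tendsto_natCast_atTop_atTop (R := ℝ))
  have t2 := (tendsto_rpow_atTop (by linarith : 0 < 1 - β / 2)).comp
    (tendsto_natCast_atTop_atTop (R := ℝ))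
  have t3 := (tendsto_rpow_atTop (by linarith : 0 < β / 2)).comp
    (tendsto_natCast_atTop_atTop (R := ℝ))
  have hev := ((t1.eventually_ge_atTop 8).and ((t2.eventually_ge_atTop 4).and
    ((t3.eventually_ge_atTop (2 * r / (r - 1))).and (eventually_ge_atTop 1))))
  obtain ⟨A₀, hA₀⟩ := eventually_atTop.1 hev
  refine ⟨A₀, fun A hA => ?_⟩
  obtain ⟨h1, h2, h3, h4⟩ := hA₀ A hA
  simp only [Function.comp_apply] at h1 h2 h3
  have hA1 : (1 : ℝ) ≤ A := by exact_mod_cast h4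
  have hA0 : (0 : ℝ) < A := by linarith
  set x : ℝ := (A : ℝ) ^ (2 / 3 - β / 2) with hx
  set y : ℝ := (A : ℝ) ^ (1 - β / 2) with hy
  have hM1 := Nat.le_ceil y
  have hM2 := Nat.ceil_lt_add_one (by linarith : 0 ≤ y)
  have hq1 := Nat.le_ceil (x / 8)
  have hq2 := Nat.ceil_lt_add_one (by linarith : 0 ≤ x / 8)
  have hq3 : (⌈x / 8⌉₊ : ℝ) ≤ x / 4 := by linarith
  have hM3 : (⌈y⌉₊ : ℝ) ≤ 2 * y := by linarith
  have hq0 : (0 : ℝ) ≤ ⌈x / 8⌉₊ := Nat.cast_nonneg _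
  have hxy : x * y ≤ A := by
    rw [hx, hy, ← Real.rpow_add hA0]
    exact (Real.rpow_le_rpow_of_exponent_le hA1 (by linarith)).trans (Real.rpow_one _).le
  have hxx : x * x ≤ y := by
    rw [hx, hy, ← Real.rpow_add hA0]
    exact Real.rpow_le_rpow_of_exponent_le hA1 (by linarith)
  refine ⟨h4, ⌈y⌉₊, ⌈x / 8⌉₊, ?_, ?_, ?_, ?_, hM1, hM3, ?_, by linarith, ?_⟩
  · exact_mod_cast h2.trans hM1
  · exact Nat.one_le_ceil_iff.2 (by linarith)
  · have : (⌈x / 8⌉₊ : ℝ) * ⌈x / 8⌉₊ ≤ ⌈y⌉₊ := by nlinarith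
    exact_mod_cast this
  · have : (⌈y⌉₊ : ℝ) * ⌈x / 8⌉₊ ≤ A := by
      calc (⌈y⌉₊ : ℝ) * ⌈x / 8⌉₊ ≤ (2 * y) * (x / 4) := by gcongr
        _ ≤ A := by nlinarith
    exact_mod_cast this
  · have hr1 : 0 < r - 1 := by linarith
    rw [div_le_iff₀ hr1] at h3
    have e : (A : ℝ) ^ (β / 2) * y = A := by
      rw [hy, ← Real.rpow_add hA0]; ring_nf; rw [Real.rpow_one]
    calc (⌈y⌉₊ : ℝ) * r ≤ 2 * y * r := by gcongr
      _ = 2 * r * y := by ring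
      _ ≤ (A : ℝ) ^ (β / 2) * (r - 1) * y := by gcongr
      _ = (r - 1) * ((A : ℝ) ^ (β / 2) * y) := by ring
      _ = _ := by rw [e]
  · have hs : x / 16 ≤ ⌈x / 8⌉₊ := by linarith
    have hs0 : 0 < √(⌈x / 8⌉₊ : ℝ) := Real.sqrt_pos.2 (by linarith)
    rw [div_le_iff₀ hs0]
    have e1 : √(x / 16) = (A : ℝ) ^ (1 / 3 - β / 4) / 4 := by
      rw [Real.sqrt_eq_iff_mul_self_eq (by positivity) (by positivity)]
      rw [show (A : ℝ) ^ (1 / 3 - β / 4) / 4 * ((A : ℝ) ^ (1 / 3 - β / 4) / 4) =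
        (A : ℝ) ^ (1 / 3 - β / 4) * (A : ℝ) ^ (1 / 3 - β / 4) / 16 by ring,
        ← Real.rpow_add hA0, hx]
      ring_nf
    calc (A : ℝ) = 4 * (A : ℝ) ^ (2 / 3 + β / 4) * √(x / 16) := by
          rw [e1, show 4 * (A : ℝ) ^ (2 / 3 + β / 4) * ((A : ℝ) ^ (1 / 3 - β / 4) / 4) =
            (A : ℝ) ^ (2 / 3 + β / 4) * (A : ℝ) ^ (1 / 3 - β / 4) by ring, ← Real.rpow_add hA0]
          ring_nf
          rw [Real.rpow_one]
      _ ≤ _ := by gcongr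

theorem d3_short_sum_bound {β κ ε : ℝ} (hβ : 2 / 3 ≤ β) (hβ1 : β < 1) (hκ : κ * β = 1)
    (hε : 0 < ε) : ∃ ρ > 1, ∃ C > 0, ∃ A₀ : ℕ, ∀ A B : ℕ, A₀ ≤ A → A ≤ B → (B : ℝ) ≤ ρ * A →
      ‖∑ k ∈ Ioc A B, (d3 k : ℂ) * cis (κ * (k : ℝ) ^ β)‖ ≤
        C * (A : ℝ) ^ (2 / 3 + β / 4 + ε) := by
  have hβ0 : 0 < β := by linarith
  have hκ1 : 1 < κ := by nlinarith
  have hκ2 : κ ≤ 3 / 2 := by nlinarith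
  set r : ℝ := κ ^ (1 / 8 : ℝ) with hr
  have hr1 : 1 < r := Real.one_lt_rpow hκ1 (by norm_num)
  have hr8 : r ^ 8 = κ := by
    rw [hr, ← Real.rpow_natCast, ← Real.rpow_mul (by linarith)]; norm_num
  have hr4 : r ^ 4 < κ := by rw [← hr8]; exact pow_lt_pow_right₀ hr1 (by norm_num)
  have hr2 : r ^ 2 ≤ 3 / 2 := by
    refine le_trans ?_ hκ2
    rw [← hr8]; exact pow_le_pow_right₀ hr1.le (by norm_num)
  obtain ⟨C₁, hC₁, h₁⟩ := type_one_bound hβ hβ1 hκ hr1 hr4 (by nlinarith [Real.pi_gt_three])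
  obtain ⟨C₂, hC₂, h₂⟩ := type_two_bound (κ := κ) hβ hβ1 (by linarith)
  obtain ⟨Cd, hCd, hd⟩ := card_divisors_le_rpow (half_pos hε)
  obtain ⟨Cl, hCl, hl⟩ := natLog_add_one_le_rpow (half_pos hε)
  obtain ⟨A₀, hA₀⟩ := exists_cutoffs hβ hβ1 hr1
  refine ⟨r ^ 2, one_lt_pow₀ hr1 two_ne_zero, (C₁ + C₂) * (3 * Cd) * 4 * Cl * 2 ^ ε,
    by positivity, A₀, ?_⟩
  intro A B hA hAB hBA
  obtain ⟨hA1, M, q, hM4, hq1, hqM, hMq, hM1, hM2, hMr, hq, hsq⟩ := hA₀ A hA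
  have hA1' : (1 : ℝ) ≤ A := by exact_mod_cast hA1
  have hB2 : (B : ℝ) ≤ 2 * A := by nlinarith
  have hB2' : B ≤ 2 * A := by exact_mod_cast hB2
  have hMB : M ≤ B := ((Nat.le_mul_of_pos_right M hq1).trans hMq).trans hAB
  obtain ⟨a, b, ha0, hb0, ha, hb, hdec⟩ := exists_d3_decomposition q M hqM
  set D : ℝ := 3 * Cd * (2 * A : ℝ) ^ (ε / 2) with hD
  have hdD : ∀ m : ℕ, 1 ≤ m → m ≤ B → 3 * (m.divisors.card : ℝ) ≤ D := by
    intro m hm hmB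
    have hm' : (m : ℝ) ≤ 2 * A := le_trans (by exact_mod_cast hmB) hB2
    calc 3 * (m.divisors.card : ℝ) ≤ 3 * (Cd * (m : ℝ) ^ (ε / 2)) := by
          gcongr; exact hd m (by omega)
      _ = 3 * Cd * (m : ℝ) ^ (ε / 2) := by ring
      _ ≤ D := by rw [hD]; gcongr
  have hD0 : 0 ≤ D := by positivity
  have haD : ∀ m, 1 ≤ m → m ≤ M → ‖a m‖ ≤ D := fun m h1 h2 =>
    (ha m).trans (hdD m h1 (h2.trans hMB))
  have hbD : ∀ m, 1 ≤ m → m ≤ B → ‖b m‖ ≤ D := fun m h1 h2 =>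
    ((hb m).trans (by gcongr; norm_num)).trans (hdD m h1 h2)
  rw [hdec A B hMq fun k => cis (κ * (k : ℝ) ^ β)]
  have hI : ∑ m ∈ Icc 1 B, ∑ n ∈ Icc 1 B, (if A < m * n ∧ m * n ≤ B then
      a m * cis (κ * ((m * n : ℕ) : ℝ) ^ β) else 0) =
      ∑ m ∈ Icc 1 M, a m * ∑ n ∈ Ioc (A / m) (B / m), cis (κ * ((m * n : ℕ) : ℝ) ^ β) := by
    rw [← Finset.sum_subset (Finset.Icc_subset_Icc_right hMB)]
    · refine Finset.sum_congr rfl fun m hm => ?_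
      rw [sum_ite_mul_eq_sum_Ioc_div (Finset.mem_Icc.1 hm).1, Finset.mul_sum]
    · intro m hm hm'
      have : M < m := by
        rw [Finset.mem_Icc] at hm hm'
        omega
      refine Finset.sum_eq_zero fun n _ => ?_
      rw [ha0 m this, zero_mul, ite_self]
  rw [hI]
  have hG0 : 0 ≤ A / √(q : ℝ) := by positivity
  have hlog : ((Nat.log 2 B + 1 : ℕ) : ℝ) ≤ Cl * (2 * A : ℝ) ^ (ε / 2) :=
    (hl B (hA1.trans hAB)).trans (by gcongr)
  have hlogM : ((Nat.log 2 M + 1 : ℕ) : ℝ) ≤ ((Nat.log 2 B + 1 : ℕ) : ℝ) := by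
    exact_mod_cast Nat.add_le_add_right (Nat.log_mono_right hMB) 1
  have k1 := (h₁ A B M q hA1 hAB hBA hM2 hMr hq1 hq a D hD0 haD).trans
    (mul_le_mul_of_nonneg_left hlogM (by positivity))
  have k2 := h₂ A B M q hA1 hB2' hq1 hM1 hq hM4 b D hD0 hb0 hbD
  calc _ ≤ C₁ * D * (A / √q) * (Nat.log 2 B + 1 : ℕ) + C₂ * D * (A / √q) * (Nat.log 2 B + 1 : ℕ) :=
        (norm_add_le _ _).trans (add_le_add k1 k2)
    _ = (C₁ + C₂) * D * ((A / √q) * (Nat.log 2 B + 1 : ℕ)) := by ring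
    _ ≤ (C₁ + C₂) * D * ((4 * (A : ℝ) ^ (2 / 3 + β / 4)) * (Cl * (2 * A : ℝ) ^ (ε / 2))) := by
        refine mul_le_mul_of_nonneg_left ?_ (by positivity)
        exact mul_le_mul hsq hlog (Nat.cast_nonneg _) (by positivity)
    _ = (C₁ + C₂) * (3 * Cd) * 4 * Cl * ((2 * A : ℝ) ^ (ε / 2) * (2 * A : ℝ) ^ (ε / 2)) *
        (A : ℝ) ^ (2 / 3 + β / 4) := by rw [hD]; ring
    _ = _ := by
        rw [← Real.rpow_add (by linarith), add_halves, Real.mul_rpow (by norm_num) (by linarith),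
          Real.rpow_add (by linarith : (0 : ℝ) < A) (2 / 3 + β / 4)]
        ring

theorem d3_sum_bound {β κ ε : ℝ} (hβ : 2 / 3 ≤ β) (hβ1 : β < 1) (hκ : κ * β = 1)
    (hε : 0 < ε) : ∃ C > 0, ∃ A₀ : ℕ, ∀ A B : ℕ, A₀ ≤ A → A ≤ B → (B : ℝ) ≤ 4 * A →
      ‖∑ k ∈ Ioc A B, (d3 k : ℂ) * cis (κ * (k : ℝ) ^ β)‖ ≤
        C * (A : ℝ) ^ (2 / 3 + β / 4 + ε) := by
  obtain ⟨ρ, hρ, C, hC, A₀, h⟩ := d3_short_sum_bound hβ hβ1 hκ hε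
  set η : ℝ := 2 / 3 + β / 4 + ε with hη
  have hη0 : 0 ≤ η := by linarith
  set σ : ℝ := (1 + ρ) / 2 with hσ
  have hσ1 : 1 < σ := by linarith
  obtain ⟨N, hN⟩ := exists_nat_ge (2 / (ρ - 1))
  have hstep : ∀ A : ℕ, N ≤ A → σ * A ≤ (⌊ρ * A⌋₊ : ℝ) := by
    intro A hA
    have h1 := Nat.lt_floor_add_one (ρ * A)
    have h2 : 2 / (ρ - 1) ≤ A := hN.trans (by exact_mod_cast hA)
    rw [div_le_iff₀ (by linarith)] at h2
    rw [hσ]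
    linarith
  have hind : ∀ j : ℕ, ∃ C' > 0, ∀ A B : ℕ, max A₀ N ≤ A → A ≤ B → (B : ℝ) ≤ σ ^ j * A →
      ‖∑ k ∈ Ioc A B, (d3 k : ℂ) * cis (κ * (k : ℝ) ^ β)‖ ≤ C' * (A : ℝ) ^ η := by
    intro j
    induction j with
    | zero =>
      refine ⟨C, hC, fun A B hA hAB hB => h A B ((le_max_left _ _).trans hA) hAB (hB.trans ?_)⟩
      rw [pow_zero]
      gcongr
    | succ j ih =>
      obtain ⟨C', hC', ih⟩ := ih
      refine ⟨C + C' * ρ ^ η, by positivity, fun A B hA hAB hB => ?_⟩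
      have hA₀ := (le_max_left _ _).trans hA
      have hAN := (le_max_right _ _).trans hA
      have hA0 : (0 : ℝ) ≤ A := Nat.cast_nonneg _
      have hC2 : 0 ≤ C' * ρ ^ η := by positivity
      by_cases hBρ : (B : ℝ) ≤ ρ * A
      · refine (h A B hA₀ hAB hBρ).trans (mul_le_mul_of_nonneg_right ?_ (by positivity))
        linarith
      · have hσA := hstep A hAN
        have hfl : (⌊ρ * A⌋₊ : ℝ) ≤ ρ * A := Nat.floor_le (by positivity)
        have h1 : A ≤ ⌊ρ * A⌋₊ := Nat.le_floor (by nlinarith)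
        have h2 : ⌊ρ * A⌋₊ ≤ B := by
          have : (⌊ρ * A⌋₊ : ℝ) ≤ B := by linarith
          exact_mod_cast this
        have h3 : (B : ℝ) ≤ σ ^ j * ⌊ρ * A⌋₊ := by
          calc (B : ℝ) ≤ σ ^ j * (σ * A) := by rw [← mul_assoc, ← pow_succ]; exact hB
            _ ≤ _ := by gcongr
        rw [← Finset.sum_Ioc_consecutive _ h1 h2]
        calc _ ≤ C * (A : ℝ) ^ η + C' * (⌊ρ * A⌋₊ : ℝ) ^ η :=
              (norm_add_le _ _).trans (add_le_add (h A _ hA₀ h1 hfl) (ih _ B (hA.trans h1) h2 h3))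
          _ ≤ C * (A : ℝ) ^ η + C' * (ρ * A) ^ η := by gcongr
          _ = _ := by rw [Real.mul_rpow (by linarith) hA0]; ring
  obtain ⟨j, hj⟩ := pow_unbounded_of_one_lt 4 hσ1
  obtain ⟨C', hC', h'⟩ := hind j
  exact ⟨C', hC', max A₀ N, fun A B hA hAB hB => h' A B hA hAB (hB.trans (by gcongr))⟩

theorem norm_sum_Ioc_mul_le_of_antitone {f : ℕ → ℂ} {w : ℕ → ℝ} {A B : ℕ} {V : ℝ} (hAB : A ≤ B)
    (hw : ∀ k, A ≤ k → w (k + 1) ≤ w k) (hw0 : 0 ≤ w B)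
    (hf : ∀ k, A ≤ k → k ≤ B → ‖∑ i ∈ Ioc A k, f i‖ ≤ V) :
    ‖∑ k ∈ Ioc A B, (w k : ℂ) * f k‖ ≤ w A * V := by
  have key : ∀ k, A ≤ k → k ≤ B →
      ‖∑ i ∈ Ioc A k, (w i : ℂ) * f i - (w k : ℂ) * ∑ i ∈ Ioc A k, f i‖ ≤ (w A - w k) * V := by
    intro k hk
    induction k, hk using Nat.le_induction with
    | base => simp
    | succ k hk ih =>
      intro hkB
      rw [Finset.sum_Ioc_succ_top hk, Finset.sum_Ioc_succ_top hk]
      calc _ = ‖(∑ i ∈ Ioc A k, (w i : ℂ) * f i - (w k : ℂ) * ∑ i ∈ Ioc A k, f i) +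
            ((w k - w (k + 1) : ℝ) : ℂ) * ∑ i ∈ Ioc A k, f i‖ := by
            congr 1; push_cast; ring
        _ ≤ (w A - w k) * V + (w k - w (k + 1)) * V := by
            refine (norm_add_le _ _).trans (add_le_add (ih (by omega)) ?_)
            rw [norm_mul, Complex.norm_real, Real.norm_eq_abs,
              abs_of_nonneg (sub_nonneg.2 (hw k hk))]
            exact mul_le_mul_of_nonneg_left (hf k hk (by omega)) (sub_nonneg.2 (hw k hk))
        _ = _ := by ring
  calc _ = ‖(∑ i ∈ Ioc A B, (w i : ℂ) * f i - (w B : ℂ) * ∑ i ∈ Ioc A B, f i) +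
        (w B : ℂ) * ∑ i ∈ Ioc A B, f i‖ := by rw [sub_add_cancel]
    _ ≤ (w A - w B) * V + w B * V := by
        refine (norm_add_le _ _).trans (add_le_add (key B hAB le_rfl) ?_)
        rw [norm_mul, Complex.norm_real, Real.norm_eq_abs, abs_of_nonneg hw0]
        exact mul_le_mul_of_nonneg_left (hf B hAB le_rfl) hw0
    _ = _ := by ring

theorem weighted_d3_sum_bound {β κ ε w : ℝ} (hβ : 2 / 3 ≤ β) (hβ1 : β < 1) (hκ : κ * β = 1)
    (hε : 0 < ε) (hw : w ≤ 0) : ∃ C > 0, ∃ A₀ : ℕ, ∀ A B : ℕ, A₀ ≤ A → A ≤ B → (B : ℝ) ≤ 4 * A →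
      ‖∑ k ∈ Ioc A B, (((k : ℝ) ^ w : ℝ) : ℂ) * ((d3 k : ℂ) * cis (κ * (k : ℝ) ^ β))‖ ≤
        C * (A : ℝ) ^ (w + (2 / 3 + β / 4 + ε)) := by
  obtain ⟨C, hC, A₀, h⟩ := d3_sum_bound hβ hβ1 hκ hε
  refine ⟨C, hC, max A₀ 1, fun A B hA hAB hB => ?_⟩
  have hA1 : 1 ≤ A := (le_max_right _ _).trans hA
  have hA0 : (0 : ℝ) < A := by exact_mod_cast hA1
  have := norm_sum_Ioc_mul_le_of_antitone (f := fun k => (d3 k : ℂ) * cis (κ * (k : ℝ) ^ β))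
    (w := fun k => (k : ℝ) ^ w) (V := C * (A : ℝ) ^ (2 / 3 + β / 4 + ε)) hAB
    (fun k hk => Real.rpow_le_rpow_of_nonpos (by exact_mod_cast hA1.trans hk)
      (by push_cast; linarith) hw) (by positivity)
    (fun k hk hkB => h A k ((le_max_left _ _).trans hA) hk
      (le_trans (by exact_mod_cast hkB) hB))
  refine this.trans (le_of_eq ?_)
  rw [Real.rpow_add hA0 w]
  ring

theorem stmt18 (α ε : ℝ) (hα₁ : 0 ≤ α) (hα₂ : α < 1/2) (hε : 0 < ε) :
    (fun T : ℝ =>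
        ∑ k ∈ Finset.Icc ⌈(T / (2 * π)) ^ ((3:ℝ)/2 - α)⌉₊ ⌊(T / π) ^ ((3:ℝ)/2 - α)⌋₊,
          (d3 k : ℂ) * (((k : ℝ) ^ (1 / (3 - 2 * α) - 1/2) : ℝ) : ℂ) *
            Complex.exp (-((((3:ℝ)/2 - α) : ℝ) : ℂ) * I *
              (((k : ℝ) ^ (1 / ((3:ℝ)/2 - α)) : ℝ) : ℂ)))
      =O[atTop] fun T : ℝ => T ^ (1 - α / 6 + ε) := by
  have hπ := Real.pi_gt_three
  set κ : ℝ := (3 : ℝ) / 2 - α with hκdef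
  have hκ1 : 1 < κ := by linarith
  have hκ0 : 0 < κ := by linarith
  set β : ℝ := 1 / κ with hβdef
  have hκβ : κ * β = 1 := by rw [hβdef]; field_simp
  have hβ : 2 / 3 ≤ β := by rw [hβdef, le_div_iff₀ hκ0]; linarith
  have hβ1 : β < 1 := by rw [hβdef, div_lt_one hκ0]; exact hκ1
  set w : ℝ := 1 / (3 - 2 * α) - 1 / 2 with hwdef
  have hw : w = β / 2 - 1 / 2 := by
    rw [hwdef, hβdef, show 3 - 2 * α = 2 * κ by rw [hκdef]; ring]
    field_simp
  obtain ⟨C, hC, A₀, h⟩ := weighted_d3_sum_bound hβ hβ1 hκβ (div_pos hε hκ0)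
    (by linarith : w ≤ 0)
  set η : ℝ := w + (2 / 3 + β / 4 + ε / κ) with hη
  have hη0 : 0 ≤ η := by
    have := div_pos hε hκ0
    linarith
  have hκη : κ * η = 1 - α / 6 + ε := by
    calc κ * η = κ * β * (3 / 4) + κ / 6 + κ * (ε / κ) := by rw [hη, hw]; ring
      _ = 3 / 4 + κ / 6 + ε := by rw [hκβ, mul_div_cancel₀ _ hκ0.ne']; ring
      _ = _ := by rw [hκdef]; ring
  have ht : Tendsto (fun T : ℝ => (T / (2 * π)) ^ κ) atTop atTop :=
    (tendsto_rpow_atTop hκ0).comp (tendsto_id.atTop_div_const (by positivity))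
  refine Asymptotics.IsBigO.of_bound C ?_
  filter_upwards [ht.eventually_ge_atTop (A₀ + 16), eventually_ge_atTop 1] with T hT hT1
  set K : ℝ := (T / (2 * π)) ^ κ with hK
  have hA₀ : (0 : ℝ) ≤ A₀ := Nat.cast_nonneg _
  have hK2 : (T / π) ^ κ = 2 ^ κ * K := by
    rw [hK, ← Real.mul_rpow (by norm_num) (by positivity)]
    congr 1
    field_simp
  have h2κ : 1 ≤ (2 : ℝ) ^ κ ∧ (2 : ℝ) ^ κ ≤ 3 := by
    refine ⟨Real.one_le_rpow (by norm_num) hκ0.le, ?_⟩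
    calc (2 : ℝ) ^ κ ≤ 2 ^ (3 / 2 : ℝ) :=
          Real.rpow_le_rpow_of_exponent_le (by norm_num) (by linarith)
      _ ≤ 3 := by
          rw [show (3 / 2 : ℝ) = 1 + 1 / 2 by norm_num, Real.rpow_add (by norm_num),
            Real.rpow_one, ← Real.sqrt_eq_rpow]
          have : √2 ≤ (3 / 2 : ℝ) := by rw [Real.sqrt_le_left (by norm_num)]; norm_num
          linarith
  rw [hK2]
  obtain ⟨A, hA⟩ : ∃ A, ⌈K⌉₊ = A + 1 :=
    Nat.exists_eq_add_one.2 (Nat.ceil_pos.2 (by linarith))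
  have hA1 : K ≤ A + 1 := by
    have := Nat.le_ceil K
    rw [hA] at this
    exact_mod_cast this
  have hA2 : (A : ℝ) < K := by
    have := Nat.ceil_lt_add_one (by linarith : 0 ≤ K)
    rw [hA] at this
    push_cast at this
    linarith
  have hKle : K ≤ 2 ^ κ * K := le_mul_of_one_le_left (by linarith) h2κ.1
  have hB : (⌊2 ^ κ * K⌋₊ : ℝ) ≤ 4 * A := by
    have h1 := Nat.floor_le (by linarith : 0 ≤ 2 ^ κ * K)
    have h2 : 2 ^ κ * K ≤ 3 * K := mul_le_mul_of_nonneg_right h2κ.2 (by linarith)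
    linarith
  have hmain := h A ⌊2 ^ κ * K⌋₊ (by exact_mod_cast (by linarith : (A₀ : ℝ) ≤ A))
    (Nat.le_floor (by linarith)) hB
  have hsum : ∑ k ∈ Icc ⌈K⌉₊ ⌊2 ^ κ * K⌋₊, (d3 k : ℂ) * (((k : ℝ) ^ w : ℝ) : ℂ) *
      Complex.exp (-((κ : ℝ) : ℂ) * I * (((k : ℝ) ^ β : ℝ) : ℂ)) =
      (starRingEnd ℂ) (∑ k ∈ Ioc A ⌊2 ^ κ * K⌋₊,
        (((k : ℝ) ^ w : ℝ) : ℂ) * ((d3 k : ℂ) * cis (κ * (k : ℝ) ^ β))) := by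
    rw [hA, Finset.Icc_add_one_left_eq_Ioc, map_sum]
    refine Finset.sum_congr rfl fun k _ => ?_
    rw [map_mul, map_mul, Complex.conj_ofReal, Complex.conj_natCast, conj_cis, cis]
    rw [show -((κ : ℝ) : ℂ) * I * (((k : ℝ) ^ β : ℝ) : ℂ) =
      ((-(κ * (k : ℝ) ^ β) : ℝ) : ℂ) * I by push_cast; ring]
    ring
  rw [hsum, RCLike.norm_conj, Real.norm_eq_abs, abs_of_nonneg (by positivity)]
  refine hmain.trans (mul_le_mul_of_nonneg_left ?_ hC.le)
  have hTπ : T / (2 * π) ≤ T := div_le_self (by linarith) (by linarith)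
  calc (A : ℝ) ^ η ≤ K ^ η := Real.rpow_le_rpow (Nat.cast_nonneg _) hA2.le hη0
    _ ≤ (T ^ κ) ^ η := by rw [hK]; gcongr
    _ = T ^ (1 - α / 6 + ε) := by rw [← Real.rpow_mul (by linarith), hκη]
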